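/- arXiv:2106.10630 — 3 statements merged into one kernel-verified Lean document; each statement's English description precedes it below -/
import Mathlib

section
/- Every admissible monomial y of degree 32 in P_5 has weight vector ω(y) equal to one of (4,4,3,1), (4,2,2,2), (2,1,1,1,1) (each followed by zeros). -/
open MvPolynomial

noncomputable section

/-- `P n` is the polynomial algebra `𝔽₂[x_1, …, x_n]`. -/
abbrev P (n : ℕ) : Type := MvPolynomial (Fin n) (ZMod 2)

/-- The total Steenrod square: the `𝔽₂`-algebra endomorphism of `P n`
with `Sq (x_j) = x_j + x_j ^ 2`. -/
def SqT (n : ℕ) : P n →ₐ[ZMod 2] P n := aeval fun j => X j + X j ^ 2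

/-- `u` is hit (in degree `d`): `u = ∑_{i ≥ 1} Sq^i (f i)` where `f i` is homogeneous
of degree `d - i`; here `Sq^i (f i)` is the degree-`d` homogeneous component of
`Sq (f i)`. -/
def IsHit (n d : ℕ) (u : P n) : Prop :=
  ∃ f : ℕ → P n,
    (∀ i, f i ∈ homogeneousSubmodule (Fin n) (ZMod 2) (d - i)) ∧
    u = ∑ i ∈ Finset.Icc 1 d, homogeneousComponent d (SqT n (f i))

/-- The homogeneous part `(P_n)_d`. -/
abbrev homSub (n d : ℕ) : Submodule (ZMod 2) (P n) := homogeneousSubmodule (Fin n) (ZMod 2) d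

/-- The subspace of hit elements of degree `d` (the span of the set of hit elements;
this set is already closed under addition, so this is just the set of hit elements). -/
def hitSub (n d : ℕ) : Submodule (ZMod 2) (P n) := Submodule.span (ZMod 2) {u | IsHit n d u}

/-- The cohit space `(QP_n)_d = (P_n)_d / (A⁺P_n)_d`. -/
abbrev QP (n d : ℕ) : Type :=
  ↥(homSub n d) ⧸ (hitSub n d).comap (homSub n d).subtype

/-- The class `[f]` in `(QP_n)_d` of a polynomial `f` (via its degree-`d` homogeneous
component; for `f` homogeneous of degree `d` this is the class of `f` itself). -/
def cls (n d : ℕ) (f : P n) : QP n d :=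
  Submodule.Quotient.mk
    ⟨homogeneousComponent d f,
      (mem_homogeneousSubmodule _ _).2 (homogeneousComponent_isHomogeneous d f)⟩

/-- The monomial `x^a = x_1^{a_1} ⋯ x_n^{a_n}`. -/
def mono {n : ℕ} (a : Fin n →₀ ℕ) : P n := monomial a 1

/-- The (total) degree of the monomial with exponent vector `a`. -/
def degA {n : ℕ} (a : Fin n →₀ ℕ) : ℕ := ∑ i, a i

/-- The weight vector: `wVec a t = ω_{t+1}(x^a) = ∑_j α_t(a_j)`. -/
def wVec {n : ℕ} (a : Fin n →₀ ℕ) : ℕ → ℕ :=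
  fun t => ∑ j, if Nat.testBit (a j) t then 1 else 0

/-- Left lexicographic (strict) order on sequences. -/
def lexLtN (f g : ℕ → ℕ) : Prop := ∃ i, (∀ j, j < i → f j = g j) ∧ f i < g i

/-- Left lexicographic (strict) order on exponent vectors. -/
def lexLtS {n : ℕ} (a b : Fin n →₀ ℕ) : Prop :=
  ∃ i : Fin n, (∀ j, j < i → a j = b j) ∧ a i < b i

/-- The order on monomials: `u < v` iff `ω(u) < ω(v)` lexicographically, or
`ω(u) = ω(v)` and `σ(u) < σ(v)` lexicographically. -/
def monLt {n : ℕ} (a b : Fin n →₀ ℕ) : Prop :=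
  lexLtN (wVec a) (wVec b) ∨ (wVec a = wVec b ∧ lexLtS a b)

/-- A monomial is admissible iff it is not inadmissible, i.e. there is no finite set of
monomials of the same degree, all smaller than it, such that subtracting their sum
yields a hit polynomial. -/
def Admissible {n : ℕ} (a : Fin n →₀ ℕ) : Prop :=
  ¬ ∃ S : Finset (Fin n →₀ ℕ),
      (∀ b ∈ S, degA b = degA a ∧ monLt b a) ∧
      IsHit n (degA a) (mono a - ∑ b ∈ S, mono b)

/-- `P_n^0`: the span of the monomials in which some variable has exponent `0`. -/
def PzeroSub (n : ℕ) : Submodule (ZMod 2) (P n) :=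
  Submodule.span (ZMod 2) {x : P n | ∃ a : Fin n →₀ ℕ, (∃ i, a i = 0) ∧ x = mono a}

/-- `P_n^+`: the span of the monomials in which every variable occurs. -/
def PplusSub (n : ℕ) : Submodule (ZMod 2) (P n) :=
  Submodule.span (ZMod 2) {x : P n | ∃ a : Fin n →₀ ℕ, (∀ i, 0 < a i) ∧ x = mono a}

/-- `(QP_n^0)_d`: the image of `(P_n^0)_d` in `(QP_n)_d`. -/
def Qzero (n d : ℕ) : Submodule (ZMod 2) (QP n d) :=
  (((PzeroSub n).comap (homSub n d).subtype)).map
    ((hitSub n d).comap (homSub n d).subtype).mkQ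

/-- `(QP_n^+)_d`: the image of `(P_n^+)_d` in `(QP_n)_d`. -/
def Qplus (n d : ℕ) : Submodule (ZMod 2) (QP n d) :=
  (((PplusSub n).comap (homSub n d).subtype)).map
    ((hitSub n d).comap (homSub n d).subtype).mkQ

/-- Kameko-type map `S_5 : P_5 → P_5`, the `𝔽₂`-linear map with
`S_5(x_1x_2x_3x_4x_5 · y²) = y` on monomials of that form and `S_5 = 0` on all
other monomials. -/
def S5 : P 5 →ₗ[ZMod 2] P 5 :=
  (basisMonomials (Fin 5) (ZMod 2)).constr (ZMod 2) fun a =>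
    if ∀ i, Odd (a i) then mono (Finsupp.equivFunOnFinite.symm fun i => a i / 2) else 0

/-- `Φ(f) = x_1x_2x_3x_4x_5 · f²`. -/
def Phi (f : P 5) : P 5 := (∏ i : Fin 5, X i) * f ^ 2

/-! ### The certificate checker -/

/-- `frc n f = f n`; makes the kernel evaluate `n` first -/
def frc {α : Type} (n : ℕ) (f : ℕ → α) : α :=
  @Nat.rec (fun _ => α) (f 0) (fun k _ => f (Nat.succ k)) n

/-- exponents `k` with `binom(a,k)` odd (for `a < 2 ^ fuel`) -/
def subs : ℕ → ℕ → ℕ → ℕ → List ℕ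
  | 0, _, _, acc => [acc]
  | n + 1, p, a, acc =>
    frc (Nat.div a 2) fun a' =>
    bif Nat.beq (Nat.mod a 2) 1 then
      subs n (Nat.mul 2 p) a' acc ++ frc (Nat.add acc p) (subs n (Nat.mul 2 p) a')
    else subs n (Nat.mul 2 p) a' acc

def sumB : List ℕ → ℕ
  | [] => 0
  | a :: l => Nat.add a (sumB l)

/-- all monomials of `Sq^i` applied to the monomial with exponent list `m` -/
def enum : List ℕ → ℕ → List (List ℕ)
  | [], i => bif Nat.beq i 0 then [[]] else []
  | a :: m, i =>
    (subs 5 1 a 0).flatMap fun k =>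
      bif Nat.ble k i && Nat.ble i (Nat.add k (sumB m)) then
        frc (Nat.add a k) fun s => frc (Nat.sub i k) fun i' =>
        (enum m i').map (List.cons s) else []

def spreadAux : ℕ → ℕ → ℕ
  | 0, _ => 0
  | n + 1, a => Nat.add (Nat.mul (Nat.mod a 2) (Nat.pow 8 n)) (spreadAux n (Nat.div a 2))

def spread (a : ℕ) : ℕ := spreadAux 6 a

def wc : List ℕ → ℕ
  | [] => 0
  | a :: l => Nat.add (spread a) (wc l)

def insB (a : ℕ) : List ℕ → List ℕ
  | [] => [a]
  | b :: l => bif Nat.ble a b then a :: b :: l else b :: insB a l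

def sortB : List ℕ → List ℕ
  | [] => []
  | a :: l => insB a (sortB l)

def eqB : List ℕ → List ℕ → Bool
  | [], [] => true
  | a :: l, b :: m => Nat.beq a b && eqB l m
  | _, _ => false

def memB (t : List ℕ) : List (List ℕ) → Bool
  | [] => false
  | s :: L => eqB t s || memB t L

def toggle (t : List ℕ) : List (List ℕ) → List (List ℕ)
  | [] => [t]
  | s :: L => bif eqB t s then L else s :: toggle t L

def toggles : List (List ℕ) → List (List ℕ)
  | [] => []
  | t :: L => toggle t (toggles L)

def dec (n : ℕ) : List ℕ :=
  frc (Nat.div n 100000000) fun a => frc (Nat.mod (Nat.div n 1000000) 100) fun b =>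
  frc (Nat.mod (Nat.div n 10000) 100) fun c => frc (Nat.mod (Nat.div n 100) 100) fun d =>
  frc (Nat.mod n 100) fun e => [a, b, c, d, e]

def okTerm (W : ℕ) (proven : List (List ℕ)) (l : List ℕ) : Bool :=
  Nat.blt (wc l) W || (Nat.beq (wc l) W && memB (sortB l) proven)

def goodM (n : ℕ) : Bool :=
  (dec n).all (fun a => Nat.blt a 32) && Nat.blt (sumB (dec n)) 32

def stepOk (W : ℕ) (proven : List (List ℕ)) (tgt : List ℕ) (ms : List ℕ) : Bool :=
  ms.all goodM &&
  match toggles ((ms.flatMap fun n => enum (dec n) (Nat.sub 32 (sumB (dec n)))).filter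
      fun l => !okTerm W proven l) with
  | [t] => eqB (sortB t) tgt && Nat.beq (wc t) W
  | _ => false

def runOk (W : ℕ) : List (List ℕ) → List (ℕ × List ℕ) → Bool
  | _, [] => true
  | proven, c :: cs => stepOk W proven (dec c.1) c.2 && runOk W (dec c.1 :: proven) cs

/-! ### Soundness of the checker -/

theorem frc_eq {α : Type} (n : ℕ) (f : ℕ → α) : frc n f = f n := by
  cases n <;> rfl

theorem ndiv (a b : ℕ) : Nat.div a b = a / b := rfl

theorem nmod (a b : ℕ) : Nat.mod a b = a % b := rfl

theorem sum_flatMap' {α : Type} (L : List α) (f : α → List (P 5)) :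
    (L.flatMap f).sum = (L.map fun a => (f a).sum).sum := by
  induction L with
  | nil => rfl
  | cons a L ih => simp [List.flatMap_cons, ih]

theorem sumB_eq (l : List ℕ) : sumB l = l.sum := by
  induction l with
  | nil => rfl
  | cons a l ih => simp [sumB, ih]

theorem eqB_eq : ∀ {l m : List ℕ}, eqB l m = true → l = m
  | [], [], _ => rfl
  | a :: l, b :: m, h => by
    simp only [eqB, Bool.and_eq_true] at h
    rw [Nat.eq_of_beq_eq_true h.1, eqB_eq h.2]
  | [], b :: m, h => by simp [eqB] at h
  | a :: l, [], h => by simp [eqB] at h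

theorem memB_mem {t : List ℕ} {L : List (List ℕ)} (h : memB t L = true) : t ∈ L := by
  induction L with
  | nil => simp [memB] at h
  | cons s L ih =>
    simp only [memB, Bool.or_eq_true] at h
    rcases h with h | h
    · rw [eqB_eq h]; simp
    · exact List.mem_cons_of_mem _ (ih h)

theorem insB_perm (a : ℕ) (l : List ℕ) : (insB a l).Perm (a :: l) := by
  induction l with
  | nil => exact List.Perm.refl _
  | cons b l ih =>
    simp only [insB]
    cases Nat.ble a b
    · exact (ih.cons b).trans (List.Perm.swap _ _ _)
    · exact List.Perm.refl _

theorem sortB_perm (l : List ℕ) : (sortB l).Perm l := by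
  induction l with
  | nil => exact List.Perm.refl _
  | cons a l ih => exact (insB_perm _ _).trans (ih.cons a)

theorem subs_bound : ∀ (n p a acc k : ℕ), k ∈ subs n p a acc → acc ≤ k ∧ k ≤ acc + p * a
  | 0, p, a, acc, k, h => by
    simp only [subs, List.mem_singleton] at h
    subst h; exact ⟨le_rfl, Nat.le_add_right _ _⟩
  | n + 1, p, a, acc, k, h => by
    simp only [subs, frc_eq, ndiv, nmod, Nat.mul_eq, Nat.add_eq] at h
    have e : a = 2 * (a / 2) + a % 2 := by omega
    have key : 2 * p * (a / 2) + p * (a % 2) = p * a := by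
      conv_rhs => rw [e]
      ring
    cases hb : Nat.beq (a % 2) 1
    · rw [hb] at h
      have := subs_bound _ _ _ _ _ h
      exact ⟨this.1, by nlinarith [Nat.zero_le (p * (a % 2))]⟩
    · have h1 : a % 2 = 1 := Nat.eq_of_beq_eq_true hb
      rw [hb] at h
      simp only [cond_true, List.mem_append] at h
      rw [h1] at key
      rcases h with h | h
      · have := subs_bound _ _ _ _ _ h
        exact ⟨this.1, by nlinarith⟩
      · have := subs_bound _ _ _ _ _ h
        exact ⟨by omega, by nlinarith⟩

theorem subs_sum (v : P 5) : ∀ (n p a acc : ℕ), a < 2 ^ n →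
    ((subs n p a acc).map (fun k => v ^ k)).sum = v ^ acc * (1 + v ^ p) ^ a
  | 0, p, a, acc, h => by
    have : a = 0 := by simpa using h
    subst this; simp [subs]
  | n + 1, p, a, acc, h => by
    simp only [subs, frc_eq, ndiv, nmod, Nat.mul_eq, Nat.add_eq]
    have h' : a / 2 < 2 ^ n := by rw [pow_succ] at h; omega
    have e : a = 2 * (a / 2) + a % 2 := by omega
    have sq : (1 + v ^ p) ^ 2 = 1 + v ^ (2 * p) := by
      rw [CharTwo.add_sq, one_pow, ← pow_mul, mul_comm]
    cases hb : Nat.beq (a % 2) 1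
    · have h1 : a % 2 = 0 := by
        have : a % 2 ≠ 1 := Nat.ne_of_beq_eq_false hb
        omega
      simp only [cond_false]
      rw [subs_sum v _ _ _ _ h', ← sq, ← pow_mul]
      conv_rhs => rw [e, h1, add_zero]
    · have h1 : a % 2 = 1 := Nat.eq_of_beq_eq_true hb
      simp only [cond_true, List.map_append, List.sum_append]
      rw [subs_sum v _ _ _ _ h', subs_sum v _ _ _ _ h', ← sq, ← pow_mul]
      conv_rhs => rw [e, h1]
      ring

def enumAll : List ℕ → List (List ℕ)
  | [] => [[]]
  | a :: m => (subs 5 1 a 0).flatMap fun k => (enumAll m).map (List.cons (a + k))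

theorem enumAll_bound : ∀ (m l : List ℕ), l ∈ enumAll m →
    m.sum ≤ l.sum ∧ l.sum ≤ 2 * m.sum ∧ l.length = m.length
  | [], l, h => by
    simp only [enumAll, List.mem_singleton] at h
    subst h; simp
  | a :: m, l, h => by
    simp only [enumAll, List.mem_flatMap, List.mem_map] at h
    obtain ⟨k, hk, l', hl', rfl⟩ := h
    have := subs_bound _ _ _ _ _ hk
    have := enumAll_bound m l' hl'
    simp only [List.sum_cons, List.length_cons]
    omega

theorem enum_eq : ∀ (m : List ℕ) (i : ℕ),
    enum m i = (enumAll m).filter (fun l => decide (l.sum = m.sum + i))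
  | [], i => by
    cases i <;> simp [enum, enumAll, Nat.beq]
  | a :: m, i => by
    simp only [enum, enumAll, frc_eq, List.filter_flatMap, List.filter_map, sumB_eq, Nat.add_eq,
      Nat.sub_eq]
    apply List.flatMap_congr
    intro k hk
    cases hb : (Nat.ble k i && Nat.ble i (k + m.sum))
    · simp only [cond_false]
      symm
      rw [List.map_eq_nil_iff, List.filter_eq_nil_iff]
      intro l hl
      have := enumAll_bound m l hl
      have hb' : ¬ (k ≤ i ∧ i ≤ k + m.sum) := by
        rintro ⟨h1, h2⟩
        rw [Nat.ble_eq_true_of_le h1, Nat.ble_eq_true_of_le h2] at hb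
        simp at hb
      have : ¬ (((a + k) :: l).sum = (a :: m).sum + i) := by
        simp only [List.sum_cons]; omega
      exact fun hc => this (of_decide_eq_true hc)
    · simp only [cond_true]
      rw [enum_eq m]
      simp only [Bool.and_eq_true] at hb
      have h1 := Nat.le_of_ble_eq_true hb.1
      congr 1
      apply List.filter_congr
      intro l hl
      have : (l.sum = m.sum + (i - k)) ↔ (((a + k) :: l).sum = (a :: m).sum + i) := by
        simp only [List.sum_cons]; omega
      exact decide_eq_decide.2 this

def ev : List (P 5) → List ℕ → P 5
  | v :: vs, a :: l => v ^ a * ev vs l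
  | _, _ => 1

theorem sq_ev : ∀ (vs : List (P 5)) (m : List ℕ),
    (∀ v ∈ vs, SqT 5 v = v + v ^ 2) → (∀ a ∈ m, a < 32) → m.length = vs.length →
    SqT 5 (ev vs m) = ((enumAll m).map (ev vs)).sum
  | [], [], _, _, _ => by simp [ev, enumAll]
  | v :: vs, a :: m, hv, hm, hl => by
    have ih := sq_ev vs m (fun w hw => hv w (List.mem_cons_of_mem _ hw))
      (fun b hb => hm b (List.mem_cons_of_mem _ hb)) (by simpa using hl)
    have h1 : SqT 5 (v ^ a) = ((subs 5 1 a 0).map (fun k => v ^ (a + k))).sum := by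
      rw [map_pow, hv v (by simp)]
      have := subs_sum v 5 1 a 0 (hm a (by simp))
      simp only [pow_add, List.sum_map_mul_left]
      rw [this, pow_zero, one_mul, pow_one, ← mul_pow]
      ring
    simp only [ev, enumAll, map_mul, h1, ih]
    rw [List.map_flatMap, sum_flatMap', ← List.sum_map_mul_right]
    congr 1
    apply List.map_congr_left
    intro k _
    rw [List.map_map, ← List.sum_map_mul_left]
    rfl
  | [], _ :: _, _, _, h => by simp at h
  | _ :: _, [], _, _, h => by simp at h

theorem ev_hom : ∀ (vs : List (P 5)) (m : List ℕ),
    (∀ v ∈ vs, v.IsHomogeneous 1) → m.length = vs.length → (ev vs m).IsHomogeneous m.sum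
  | [], [], _, _ => by simpa [ev] using isHomogeneous_one (Fin 5) (ZMod 2)
  | v :: vs, a :: m, hv, hl => by
    have ih := ev_hom vs m (fun w hw => hv w (List.mem_cons_of_mem _ hw)) (by simpa using hl)
    have := (hv v (by simp)).pow a
    rw [one_mul] at this
    exact this.mul ih
  | [], _ :: _, _, h => by simp at h
  | _ :: _, [], _, h => by simp at h

def vars5 : List (P 5) := [X 0, X 1, X 2, X 3, X 4]

theorem vars5_sq : ∀ v ∈ vars5, SqT 5 v = v + v ^ 2 := by
  intro v hv
  simp only [vars5, List.mem_cons, List.not_mem_nil, or_false] at hv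
  rcases hv with rfl | rfl | rfl | rfl | rfl <;> simp [SqT]

theorem vars5_hom : ∀ v ∈ vars5, v.IsHomogeneous 1 := by
  intro v hv
  simp only [vars5, List.mem_cons, List.not_mem_nil, or_false] at hv
  rcases hv with rfl | rfl | rfl | rfl | rfl <;> exact isHomogeneous_X _ _

theorem hc_sum (d : ℕ) : ∀ L : List (List ℕ), (∀ l ∈ L, l.length = 5) →
    homogeneousComponent d ((L.map (ev vars5)).sum) =
      ((L.filter (fun l => decide (l.sum = d))).map (ev vars5)).sum
  | [], _ => by simp
  | l :: L, h => by
    have ih := hc_sum d L (fun l hl => h l (List.mem_cons_of_mem _ hl))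
    have hl := ev_hom vars5 l vars5_hom (h l (by simp))
    rw [List.map_cons, List.sum_cons, map_add, ih,
      homogeneousComponent_of_mem ((mem_homogeneousSubmodule _ _).2 hl), List.filter_cons]
    by_cases hd : l.sum = d
    · simp [hd]
    · simp [hd, Ne.symm hd]

theorem hc_sq (m : List ℕ) (h5 : m.length = 5) (hm : ∀ a ∈ m, a < 32) (i : ℕ) :
    homogeneousComponent (m.sum + i) (SqT 5 (ev vars5 m)) =
      ((enum m i).map (ev vars5)).sum := by
  rw [sq_ev vars5 m vars5_sq hm (by simpa [vars5] using h5), hc_sum, enum_eq]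
  intro l hl
  rw [(enumAll_bound m l hl).2.2, h5]

def MF (f : Fin 5 → ℕ) : P 5 := ∏ i, X i ^ f i

def gl (l : List ℕ) : Fin 5 → ℕ := fun i => l.getD i 0

def wF (f : Fin 5 → ℕ) : ℕ := ∑ i, spread (f i)

theorem five {l : List ℕ} (h : l.length = 5) : ∃ a b c d e, l = [a, b, c, d, e] := by
  match l, h with
  | [a, b, c, d, e], _ => exact ⟨a, b, c, d, e, rfl⟩

theorem ev_eq {l : List ℕ} (h : l.length = 5) : ev vars5 l = MF (gl l) := by
  obtain ⟨a, b, c, d, e, rfl⟩ := five h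
  simp [ev, vars5, MF, gl, Fin.prod_univ_five, mul_assoc]

theorem wc_eq {l : List ℕ} (h : l.length = 5) : wc l = wF (gl l) := by
  obtain ⟨a, b, c, d, e, rfl⟩ := five h
  simp [wc, wF, gl, Fin.sum_univ_five, add_assoc]

theorem sum_eq {l : List ℕ} (h : l.length = 5) : l.sum = ∑ i, gl l i := by
  obtain ⟨a, b, c, d, e, rfl⟩ := five h
  simp [gl, Fin.sum_univ_five, add_assoc]

def HitS : Submodule (ZMod 2) (P 5) :=
  Submodule.span (ZMod 2) {u | ∃ e < 32, ∃ g : P 5, g.IsHomogeneous e ∧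
    u = homogeneousComponent 32 (SqT 5 g)}

def LowS (W : ℕ) : Submodule (ZMod 2) (P 5) :=
  Submodule.span (ZMod 2) {u | ∃ f : Fin 5 → ℕ, ∑ i, f i = 32 ∧ wF f < W ∧ u = MF f}

def ZS (W : ℕ) : Submodule (ZMod 2) (P 5) := HitS ⊔ LowS W

theorem hitS_isHit {u : P 5} (h : u ∈ HitS) : IsHit 5 32 u := by
  induction h using Submodule.span_induction with
  | mem u hu =>
    obtain ⟨e, he, g, hg, rfl⟩ := hu
    refine ⟨fun i => if i = 32 - e then g else 0, ?_, ?_⟩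
    · intro i
      by_cases hi : i = 32 - e
      · have : 32 - i = e := by omega
        simp only [hi, if_true]
        rw [← hi, this]
        exact (mem_homogeneousSubmodule _ _).2 hg
      · simp [hi]
    · rw [Finset.sum_eq_single (32 - e)]
      · simp
      · intro b _ hb
        simp [hb]
      · intro hb
        exfalso
        apply hb
        rw [Finset.mem_Icc]
        omega
  | zero => exact ⟨fun _ => 0, fun i => Submodule.zero_mem _, by simp⟩
  | add u v _ _ hu hv =>
    obtain ⟨f, hf, rfl⟩ := hu
    obtain ⟨g, hg, rfl⟩ := hv
    exact ⟨fun i => f i + g i, fun i => Submodule.add_mem _ (hf i) (hg i), by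
      simp [Finset.sum_add_distrib]⟩
  | smul c u _ hu =>
    obtain ⟨f, hf, rfl⟩ := hu
    exact ⟨fun i => c • f i, fun i => Submodule.smul_mem _ _ (hf i), by
      simp [Finset.smul_sum]⟩

theorem hc_rename (σ : Equiv.Perm (Fin 5)) (d : ℕ) (p : P 5) :
    homogeneousComponent d (rename σ p) = rename σ (homogeneousComponent d p) := by
  induction p using MvPolynomial.induction_on' with
  | monomial u c =>
    have h : (monomial u c : P 5).IsHomogeneous u.degree := isHomogeneous_monomial _ rfl
    have h' : (rename σ (monomial u c : P 5)).IsHomogeneous u.degree := h.rename_isHomogeneous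
    rw [homogeneousComponent_of_mem ((mem_homogeneousSubmodule _ _).2 h),
      homogeneousComponent_of_mem ((mem_homogeneousSubmodule _ _).2 h')]
    split_ifs <;> simp
  | add p q hp hq => rw [map_add, map_add, map_add, map_add, hp, hq]

theorem sq_rename (σ : Equiv.Perm (Fin 5)) (p : P 5) :
    SqT 5 (rename σ p) = rename σ (SqT 5 p) := by
  have : (SqT 5).comp (rename σ) = (rename σ : P 5 →ₐ[ZMod 2] P 5).comp (SqT 5) := by
    apply MvPolynomial.algHom_ext
    intro i
    simp [SqT]
  exact DFunLike.congr_fun this p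

theorem MF_rename (σ : Equiv.Perm (Fin 5)) (f : Fin 5 → ℕ) :
    rename σ (MF f) = MF (f ∘ σ.symm) := by
  simp only [MF, map_prod, map_pow, rename_X]
  rw [← Equiv.prod_comp σ (fun i => (X i : P 5) ^ (f ∘ σ.symm) i)]
  simp

theorem ZS_rename (W : ℕ) (σ : Equiv.Perm (Fin 5)) {u : P 5} (h : u ∈ ZS W) :
    rename σ u ∈ ZS W := by
  obtain ⟨x, hx, y, hy, rfl⟩ := Submodule.mem_sup.1 h
  rw [map_add]
  refine Submodule.add_mem_sup ?_ ?_
  · clear h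
    induction hx using Submodule.span_induction with
    | mem u hu =>
      obtain ⟨e, he, g, hg, rfl⟩ := hu
      exact Submodule.subset_span ⟨e, he, rename σ g, hg.rename_isHomogeneous, by
        rw [sq_rename, hc_rename]⟩
    | zero => simp
    | add u v _ _ hu hv => rw [map_add]; exact Submodule.add_mem _ hu hv
    | smul c u _ hu => rw [map_smul]; exact Submodule.smul_mem _ _ hu
  · clear h
    induction hy using Submodule.span_induction with
    | mem u hu =>
      obtain ⟨f, h1, h2, rfl⟩ := hu
      refine Submodule.subset_span ⟨f ∘ σ.symm, ?_, ?_, MF_rename σ f⟩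
      · rw [← h1]; exact Equiv.sum_comp σ.symm f
      · rw [show wF (f ∘ σ.symm) = wF f from
          Equiv.sum_comp σ.symm (fun i => spread (f i))]
        exact h2
    | zero => simp
    | add u v _ _ hu hv => rw [map_add]; exact Submodule.add_mem _ hu hv
    | smul c u _ hu => rw [map_smul]; exact Submodule.smul_mem _ _ hu

theorem ofFn_gl {l : List ℕ} (h : l.length = 5) : List.ofFn (gl l) = l := by
  obtain ⟨a, b, c, d, e, rfl⟩ := five h
  simp [gl, List.ofFn_succ]

theorem perm_fun {f g : Fin 5 → ℕ} (h : (List.ofFn f).Perm (List.ofFn g)) :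
    ∃ σ : Equiv.Perm (Fin 5), g = f ∘ σ := by
  have h1 := Equiv.Perm.ofFn_comp_perm (Tuple.sort f) f
  have h2 := Equiv.Perm.ofFn_comp_perm (Tuple.sort g) g
  have h3 : List.ofFn (f ∘ Tuple.sort f) = List.ofFn (g ∘ Tuple.sort g) :=
    ((h1.trans h).trans h2.symm).eq_of_pairwise'
      (Tuple.monotone_sort f).sortedLE_ofFn.pairwise (Tuple.monotone_sort g).sortedLE_ofFn.pairwise
  have h4 := List.ofFn_injective h3
  refine ⟨(Tuple.sort g).symm.trans (Tuple.sort f), ?_⟩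
  funext i
  have := congrFun h4 ((Tuple.sort g).symm i)
  simpa using this.symm

theorem ZS_perm {W : ℕ} {l l' : List ℕ} (h5 : l.length = 5) (h : l.Perm l')
    (hz : ev vars5 l ∈ ZS W) : ev vars5 l' ∈ ZS W := by
  have h5' : l'.length = 5 := by rw [← h.length_eq, h5]
  rw [ev_eq h5] at hz
  rw [ev_eq h5']
  rw [← ofFn_gl h5, ← ofFn_gl h5'] at h
  obtain ⟨σ, hσ⟩ := perm_fun h
  have := ZS_rename W σ.symm hz
  rw [MF_rename] at this
  rw [hσ]
  simpa using this

theorem dec_len (n : ℕ) : (dec n).length = 5 := by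
  simp [dec, frc_eq]

theorem toggle_sum (t : List ℕ) (L : List (List ℕ)) :
    ((toggle t L).map (ev vars5)).sum = ev vars5 t + (L.map (ev vars5)).sum := by
  induction L with
  | nil => simp [toggle]
  | cons s L ih =>
    simp only [toggle]
    cases hb : eqB t s
    · simp only [cond_false, List.map_cons, List.sum_cons, ih]; ring
    · rw [eqB_eq hb]
      simp only [cond_true, List.map_cons, List.sum_cons, ← add_assoc]
      rw [CharTwo.add_self_eq_zero, zero_add]

theorem toggles_sum (L : List (List ℕ)) :
    ((toggles L).map (ev vars5)).sum = (L.map (ev vars5)).sum := by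
  induction L with
  | nil => rfl
  | cons t L ih => rw [toggles, toggle_sum, ih, List.map_cons, List.sum_cons]

theorem toggle_mem {t x : List ℕ} {L : List (List ℕ)} (h : x ∈ toggle t L) : x = t ∨ x ∈ L := by
  induction L with
  | nil => simpa [toggle] using h
  | cons s L ih =>
    simp only [toggle] at h
    cases hb : eqB t s <;> rw [hb] at h
    · simp only [cond_false, List.mem_cons] at h ⊢
      tauto
    · simp only [cond_true, List.mem_cons] at h ⊢
      tauto

theorem toggles_mem {x : List ℕ} {L : List (List ℕ)} (h : x ∈ toggles L) : x ∈ L := by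
  induction L with
  | nil => simp [toggles] at h
  | cons t L ih =>
    rw [List.mem_cons]
    exact (toggle_mem h).imp id ih

theorem filter_split (L : List (List ℕ)) (p : List ℕ → Bool) :
    (L.map (ev vars5)).sum = ((L.filter p).map (ev vars5)).sum +
      ((L.filter fun l => !p l).map (ev vars5)).sum := by
  induction L with
  | nil => simp
  | cons l L ih =>
    rw [List.map_cons, List.sum_cons, ih, List.filter_cons, List.filter_cons]
    cases p l <;> simp <;> ring

theorem listsum_mem5 (S : Submodule (ZMod 2) (P 5)) (L : List (P 5)) (h : ∀ x ∈ L, x ∈ S) :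
    L.sum ∈ S := by
  induction L with
  | nil => simp
  | cons a L ih =>
    rw [List.sum_cons]
    exact S.add_mem (h a (by simp)) (ih fun x hx => h x (List.mem_cons_of_mem _ hx))

theorem goodM_spec {n : ℕ} (h : goodM n = true) :
    (∀ a ∈ dec n, a < 32) ∧ (dec n).sum < 32 := by
  simp only [goodM, Bool.and_eq_true, List.all_eq_true, sumB_eq] at h
  exact ⟨fun a ha => Nat.le_of_ble_eq_true (h.1 a ha), Nat.le_of_ble_eq_true h.2⟩

theorem enum_mem {n : ℕ} (hn : goodM n = true) {l : List ℕ}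
    (hl : l ∈ enum (dec n) (Nat.sub 32 (sumB (dec n)))) : l.length = 5 ∧ l.sum = 32 := by
  have h := (goodM_spec hn).2
  rw [enum_eq, List.mem_filter] at hl
  have h1 := (enumAll_bound _ _ hl.1).2.2
  have h2 := of_decide_eq_true hl.2
  rw [dec_len] at h1
  refine ⟨h1, ?_⟩
  rw [h2, sumB_eq, Nat.sub_eq]
  omega

theorem enum_hit {n : ℕ} (hn : goodM n = true) :
    ((enum (dec n) (Nat.sub 32 (sumB (dec n)))).map (ev vars5)).sum ∈ HitS := by
  have h := goodM_spec hn
  rw [← hc_sq (dec n) (dec_len n) h.1]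
  refine Submodule.subset_span ⟨(dec n).sum, h.2, _, ev_hom _ _ vars5_hom (dec_len n), ?_⟩
  congr 2
  rw [sumB_eq, Nat.sub_eq]
  omega

theorem step_sound {W : ℕ} {proven : List (List ℕ)} {tgt : List ℕ} {ms : List ℕ}
    (hp : ∀ p ∈ proven, ev vars5 p ∈ ZS W) (h : stepOk W proven tgt ms = true) :
    ev vars5 tgt ∈ ZS W := by
  simp only [stepOk, Bool.and_eq_true] at h
  obtain ⟨hg, h⟩ := h
  rw [List.all_eq_true] at hg
  set T := ms.flatMap fun n => enum (dec n) (Nat.sub 32 (sumB (dec n))) with hT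
  have hTm : ∀ l ∈ T, l.length = 5 ∧ l.sum = 32 := by
    intro l hl
    obtain ⟨n, hn, hl⟩ := List.mem_flatMap.1 hl
    exact enum_mem (hg n hn) hl
  have hTs : (T.map (ev vars5)).sum ∈ ZS W := by
    rw [hT, List.map_flatMap, sum_flatMap']
    apply listsum_mem5
    intro x hx
    obtain ⟨n, hn, rfl⟩ := List.mem_map.1 hx
    exact Submodule.mem_sup_left (enum_hit (hg n hn))
  have hok : ((T.filter fun l => okTerm W proven l).map (ev vars5)).sum ∈ ZS W := by
    apply listsum_mem5
    intro x hx
    obtain ⟨l, hl, rfl⟩ := List.mem_map.1 hx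
    rw [List.mem_filter] at hl
    obtain ⟨hl, ho⟩ := hl
    obtain ⟨h5, h32⟩ := hTm l hl
    simp only [okTerm, Bool.or_eq_true, Bool.and_eq_true] at ho
    rcases ho with ho | ho
    · have : wc l < W := Nat.le_of_ble_eq_true ho
      refine Submodule.mem_sup_right (Submodule.subset_span ⟨gl l, ?_, ?_, ev_eq h5⟩)
      · rw [← sum_eq h5, h32]
      · rwa [← wc_eq h5]
    · refine ZS_perm ?_ (sortB_perm l) (hp _ (memB_mem ho.2))
      rw [(sortB_perm l).length_eq, h5]
  have hrem : ((toggles (T.filter fun l => !okTerm W proven l)).map (ev vars5)).sum ∈ ZS W := by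
    rw [toggles_sum]
    have := filter_split T (okTerm W proven)
    rw [this] at hTs
    exact (Submodule.add_mem_iff_right _ hok).1 hTs
  split at h
  · rename_i t ht
    rw [ht] at hrem
    simp only [List.map_cons, List.map_nil, List.sum_cons, List.sum_nil, add_zero] at hrem
    simp only [Bool.and_eq_true] at h
    have htm : t ∈ T := by
      have : t ∈ toggles (T.filter fun l => !okTerm W proven l) := by rw [ht]; simp
      exact (List.mem_filter.1 (toggles_mem this)).1
    rw [← eqB_eq h.1]
    exact ZS_perm (hTm t htm).1 (sortB_perm t).symm hrem
  · simp at h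

theorem run_sound {W : ℕ} : ∀ (cs : List (ℕ × List ℕ)) (proven : List (List ℕ)),
    (∀ p ∈ proven, ev vars5 p ∈ ZS W) → runOk W proven cs = true →
    ∀ c ∈ cs, ev vars5 (dec c.1) ∈ ZS W
  | [], _, _, _, c, hc => by simp at hc
  | c :: cs, proven, hp, h, c', hc' => by
    simp only [runOk, Bool.and_eq_true] at h
    have h1 := step_sound hp h.1
    rcases List.mem_cons.1 hc' with rfl | hc'
    · exact h1
    · refine run_sound cs (dec c.1 :: proven) ?_ h.2 c' hc'
      intro p hp'
      rcases List.mem_cons.1 hp' with rfl | hp'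
      · exact h1
      · exact hp p hp'

def certGroups : List (ℕ × List (ℕ × List ℕ)) := [
  (1, [
    (32, [16])]),
  (16, [
    (1616, [808])]),
  (136, [
    (824, [412]), (80816, [40408])]),
  (256, [
    (8080808, [4040404])]),
  (1096, [
    (428, [214]), (1220, [610]), (40424, [20212]), (40820, [20410]), (41216, [20608]),
    (4040816, [2020408])]),
  (1216, [
    (81212, [40606]), (4080812, [2040406]), (404080808, [202040404])]),
  (2056, [
    (4040420, [2020210]), (404040416, [202020208])]),
  (2176, [
    (4041212, [2020606]), (404040812, [202020406])]),
  (8776, [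
    (230, [115]), (626, [313]), (1022, [511]), (1418, [709]), (20228, [10114]), (20426, [10213]),
    (20624, [10312]), (20822, [10411]), (21020, [10510]), (21218, [10609]), (21416, [10708]),
    (41018, [20509]), (60818, [30409]), (61016, [30508]), (2020424, [1010212]),
    (2020820, [1010410]), (2021216, [1010608]), (2040818, [1020409]), (2041016, [1020508]),
    (2060816, [1030408]), (202040816, [101020408])]),
  (8896, [
    (81014, [40507]), (101012, [50506]), (2080814, [1040407]), (2081012, [1040506]),
    (4081010, [2040505]), (6080810, [3040405]), (202080812, [101040406]),
    (204080810, [102040405]), (206080808, [103040404])]),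
  (9736, [
    (40622, [20311]), (60620, [30310]), (2040422, [1020211]), (2040620, [1020310]),
    (4040618, [2020309]), (4060616, [2030308]), (202040420, [101020210]),
    (204040418, [102020209]), (204040616, [102020308])]),
  (9856, [
    (41414, [20707]), (61214, [30607]), (2041214, [1020607]), (2061212, [1030606]),
    (4041014, [2020507]), (4060814, [2030407]), (4061012, [2030506]), (6060812, [3030406]),
    (202041212, [101020606]), (204040814, [102020407]), (204041012, [102020506]),
    (204060812, [102030406]), (404041010, [202020505]), (404060810, [202030405]),
    (406060808, [203030404])]),
  (10816, [
    (404040614, [202020307]), (404060612, [202030306])]),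
  (16456, [
    (2020226, [1010113]), (2021018, [1010509]), (202020224, [101010112]),
    (202020818, [101010409]), (202021016, [101010508])]),
  (16576, [
    (2101010, [1050505]), (202081010, [101040505])]),
  (17416, [
    (2020622, [1010311]), (2060618, [1030309]), (202020422, [101010211]),
    (202020620, [101010310]), (202040618, [101020309]), (202060616, [101030308])]),
  (17536, [
    (2021414, [1010707]), (2061014, [1030507]), (6061010, [3030505]), (202021214, [101010607]),
    (202041014, [101020507]), (202060814, [101030407]), (202061012, [101030506]),
    (204061010, [102030505]), (206060810, [103030405])]),
  (18496, [
    (6060614, [3030307]), (204060614, [102030307]), (206060612, [103030306]),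
    (406060610, [203030305]), (606060608, [303030304])]),
  (70336, [
    (80915, [40915]), (81113, [41113]), (90914, [50914]), (91013, [51013]), (91112, [51112]),
    (1080815, [1040815]), (1080914, [1040914]), (1081013, [1041013]), (1081112, [1041112]),
    (1091012, [1051012]), (2080913, [2040913]), (2090912, [2050912]), (3080813, [3040813]),
    (3080912, [3040912]), (101080814, [101040814]), (101081012, [101041012]),
    (102080813, [102040813]), (102080912, [102040912]), (103080812, [103040812]),
    (4080911, [2080911]), (5080811, [4050811]), (7080809, [4070809]), (4090910, [2090910]),
    (5080910, [4050910]), (6080909, [4060909]), (104080811, [102080811]),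
    (107080808, [104070808]), (104080910, [102080910]), (105080810, [104050810]),
    (106080809, [104060809]), (204080909, [104080909]), (205080809, [204050809]),
    (304080809, [203080809]), (305080808, [304050808])]),
  (71176, [
    (40523, [20523]), (40721, [20721]), (50522, [30522]), (50621, [30621]), (50720, [30720]),
    (1040423, [1020423]), (1040522, [1020522]), (1040621, [1020621]), (1040720, [1020720]),
    (1050620, [1030620]), (4040717, [2040717]), (4050617, [2050617]), (4050716, [2050716]),
    (5050616, [3050616]), (101040422, [101020422]), (101040620, [101020620]),
    (104040617, [102040617]), (104040716, [102040716]), (104050616, [102050616]),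
    (2040521, [1040521]), (3040421, [2030421]), (4040519, [2040519]), (2050520, [1050520]),
    (3040520, [2030520]), (4050518, [2050518]), (204050516, [104050516]),
    (304040516, [203040516]), (102040421, [102040413]), (104040419, [102040419]),
    (102040520, [102040512]), (103040420, [102030420]), (104040518, [102040518]),
    (204040517, [104040517]), (304040417, [203040417])]),
  (71296, [
    (41315, [21315]), (51215, [31215]), (51314, [31314]), (61313, [61113]), (71213, [71013]),
    (1041215, [1021215]), (1041314, [1021314]), (1051214, [1031214]), (1061213, [1061013]),
    (1071212, [1071012]), (4040915, [2040915]), (4050815, [2050815]), (4050914, [2050914]),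
    (4060913, [2060913]), (4070813, [2070813]), (4070912, [2070912]), (5050814, [3050814]),
    (5060813, [3060813]), (5060912, [3060912]), (5070812, [3070812]), (101041214, [101021214]),
    (101061212, [101061012]), (104040815, [102040815]), (104040914, [102040914]),
    (104050814, [102050814]), (104060813, [102060813]), (104060912, [102060912]),
    (104070812, [102070812]), (105060812, [103060812]), (404060909, [204060909]),
    (404070809, [204070809]), (405060809, [205060809]), (405070808, [205070808]),
    (505060808, [305060808]), (2041313, [1041313]), (4041113, [2041113]), (2051213, [1051213]),
    (3041213, [2031213]), (4051013, [2051013]), (4051112, [2051112]), (5051012, [5050912]),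
    (3051212, [3051012]), (204050813, [104050813]), (304040813, [203040813]),
    (404050811, [204050811]), (205050812, [105050812]), (304050812, [203050812]),
    (405050810, [205050810]), (104041013, [104040613]), (102041213, [102041013]),
    (104041112, [102041112]), (204040913, [104040913]), (404040911, [204040911]),
    (104051012, [104050612]), (102051212, [102051012]), (103041212, [102031212]),
    (204050912, [104050912]), (304040912, [203040912]), (404050910, [204050910])]),
  (72256, [
    (404040515, [204040515]), (404040713, [204040713]), (404050514, [204050514]),
    (404050613, [204050613]), (404050712, [204050712]), (405050612, [205050612])]),
  (77896, [
    (20327, [10327]), (21119, [11119]), (30326, [30325]), (31019, [30919]), (31118, [31011]),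
    (2030324, [1030324]), (2030819, [1030819]), (2031116, [2030811]), (3030818, [3030817]),
    (3031016, [3030810]), (203030816, [103030816]), (1020227, [1020223]), (1020326, [1020322]),
    (2020325, [1020325]), (1021019, [1020619]), (1021118, [1021011]), (2020919, [1020919]),
    (2021117, [2020911]), (1031018, [1030618]), (2030918, [1030918]), (2031017, [2030910]),
    (101020226, [101020222]), (101021018, [101020618]), (102020225, [102020221]),
    (102020324, [102020320]), (102020819, [102020419]), (102021116, [102020811]),
    (102020918, [102020518]), (102021017, [102020910]), (202020917, [102020917]),
    (102030818, [102030418]), (102031016, [102030810]), (202030817, [102030817]),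
    (202030916, [202030809])]),
  (78016, [
    (101111, [91111]), (2081111, [1081111]), (3081011, [3080911]), (203080811, [103080811]),
    (303080810, [303080809]), (1101011, [1061011]), (2091011, [1091011]), (3091010, [3051010]),
    (101101010, [101061010]), (102081011, [102041011]), (202080911, [102080911]),
    (102091010, [102051010]), (202090910, [102090910]), (103081010, [103041010]),
    (203080910, [103080910])]),
  (78856, [
    (20723, [10723]), (30623, [30523]), (30722, [30721]), (60719, [50719]), (70718, [70717]),
    (2030423, [1030423]), (2030720, [1030720]), (2040719, [1040719]), (2070716, [1070716]),
    (3030422, [3030421]), (3030620, [3030520]), (3040619, [3040519]), (3040718, [3040717]),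
    (3060716, [3050716]), (203030420, [103030420]), (203040419, [103040419]),
    (203040716, [103040716]), (303040418, [303040417]), (303040616, [303040516]),
    (2020523, [2020323]), (1020623, [1020523]), (2020721, [2020719]), (1020722, [1020721]),
    (2050718, [2030718]), (1060718, [1050718]), (2060717, [1060717]), (202050716, [202030716]),
    (102060716, [102050716]), (1030622, [1030614]), (2030522, [1030522]), (2030621, [1030621]),
    (2050619, [2030619]), (1060619, [1050619]), (3050618, [3050610]), (3060617, [3050617]),
    (101020622, [101020614]), (101060618, [101060610]), (102020423, [102020415]),
    (102020522, [102020514]), (102020621, [102020613]), (202020521, [102020521]),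
    (102020720, [102020712]), (102030422, [102030414]), (202030421, [102030421]),
    (202040519, [202030419]), (102040619, [102040519]), (102030620, [102030612]),
    (202030520, [102030520]), (102040718, [102040710]), (202040717, [102040717]),
    (102050618, [102050610]), (202050518, [102050518]), (103040618, [102030618]),
    (203040518, [103040518]), (203040617, [103040617]), (202050617, [202030617]),
    (102060617, [102050617]), (103060616, [103060608]), (203050616, [103050616])]),
  (78976, [
    (21515, [11515]), (31415, [31315]), (61115, [51115]), (71015, [70915]), (71114, [71113]),
    (2031215, [1031215]), (2041115, [1041115]), (2070815, [1070815]), (2071112, [1071112]),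
    (3031214, [3031213]), (3041015, [3040915]), (3041114, [3041113]), (3060815, [3050815]),
    (3061112, [3051112]), (4061111, [3061111]), (3070814, [3070813]), (3071012, [3070912]),
    (4071011, [3071011]), (6070811, [5070811]), (7070810, [7070809]), (203031212, [103031212]),
    (203040815, [103040815]), (203041112, [103041112]), (203070812, [103070812]),
    (204041111, [104041111]), (204070811, [104070811]), (207070808, [107070808]),
    (303040814, [303040813]), (303041012, [303040912]), (303060812, [303050812]),
    (304041011, [304040911]), (304060811, [304050811]), (304070810, [304070809]),
    (306070808, [305070808]), (2021315, [2021115]), (1021415, [1021315]), (2051015, [2031015]),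
    (1061015, [1051015]), (2060915, [1060915]), (2071013, [2071011]), (1071014, [1071013]),
    (2070914, [1070914]), (5071010, [3071010]), (6070910, [5070910]), (202050815, [202030815]),
    (102060815, [102050815]), (202070813, [202070811]), (102070814, [102070813]),
    (205070810, [203070810]), (106070810, [105070810]), (206070809, [106070809]),
    (1061114, [1060714]), (2051114, [1051114]), (2061113, [1061113]), (2031314, [2031114]),
    (1031414, [1031314]), (5061011, [5060710]), (6060911, [5060911]), (3061013, [3061011]),
    (3051014, [3051013]), (3060914, [3050914]), (102041015, [102040615]),
    (202040915, [102040915]), (102021215, [102021015]), (102041114, [102040714]),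
    (202041113, [102041113]), (102021314, [102021114]), (101021414, [101021314]),
    (202021313, [102021313]), (106060811, [106060708]), (205060811, [105060811]),
    (203060813, [203060811]), (103060814, [103060813]), (203050814, [103050814]),
    (103041014, [103040614]), (203040914, [103040914]), (203041013, [103041013]),
    (202050914, [202030914]), (204051011, [203041011]), (104061011, [104051011]),
    (204060911, [104060911]), (202060913, [202060911]), (202051013, [202050913]),
    (202031213, [202031013]), (102031214, [102031213]), (102051014, [102031014]),
    (101061014, [101051014]), (102060914, [102050914]), (102061013, [102051013]),
    (102061112, [102061011]), (202051112, [102051112]), (102071012, [102060712]),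
    (202070912, [102070912]), (104071010, [102071010]), (204070910, [104070910]),
    (205051010, [103051012, 103051210, 103061010, 106031010, 105031012, 105031210, 203031012, 203031210, 105051010]),
    (305060810, [306090210, 305090212, 305090410, 309060210, 505060210, 905050210, 506050210, 305060410, 305060212]),
    (306060809, [305060809]), (304060910, [306060504, 310060504]), (304051010, [304050910]),
    (105061010, [103051012, 103051210, 203051010, 103061010]), (106060910, [105060610]),
    (205060910, [105060910]), (206060909, [106060909]), (203060912, [203060910]),
    (103061012, [103060912]), (203051012, [103051012])]),
  (79936, [
    (4060715, [3060715]), (4070714, [3070714]), (6070712, [5070712]), (204040715, [104040715]),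
    (204070712, [104070712]), (304040615, [304040515]), (304040714, [304040713]),
    (304060712, [304050712]), (404060711, [304060711]), (404070710, [304070710]),
    (406070708, [306070708]), (5060615, [3060615]), (5060714, [3060714]), (6060713, [5060713]),
    (104060615, [102060615]), (204050615, [104050615]), (104060714, [102060714]),
    (204050714, [104050714]), (204060713, [104060713]), (105060614, [103060614]),
    (205050614, [105050614]), (106060613, [106060611]), (205060613, [105060613]),
    (106060712, [106060710]), (205060712, [105060712]), (304050614, [203050614]),
    (304060613, [304050613]), (405060611, [205060611]), (405060710, [205060710]),
    (406060709, [405060709]), (506060609, [306060609]), (505060610, [505060609]),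
    (305060612, [305060610]), (506060708, [306060708])]),
  (86536, [
    (202020323, [102020323]), (202020719, [102020719]), (202030322, [102030322]),
    (202030619, [102030619]), (202030718, [102030718]), (203030618, [103030618])]),
  (86656, [
    (202021115, [102021115]), (202031015, [102031015]), (202031114, [102031114]),
    (202061111, [102061111]), (202071011, [102071011]), (203031014, [103031014]),
    (203061011, [103061011]), (203071010, [103071010]), (303061010, [303051010])]),
  (87616, [
    (202060715, [102060715]), (202070714, [102070714]), (203060615, [103060615]),
    (203060714, [103060714]), (206060711, [106060711]), (206070710, [106070710]),
    (303060614, [303050614]), (306060611, [305060611]), (306060710, [305060710])]),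
  (88576, [
    (606060707, [506060707])]),
  (131656, [
    (1010129, [1010127]), (1010525, [1010325]), (1010921, [1010521]), (1011317, [1010913]),
    (1050917, [1030917]), (101010128, [101010126]), (101010425, [101010225]),
    (101010821, [101010421]), (101011316, [101010813]), (101011217, [101011213]),
    (101010920, [101010912]), (101010524, [101010520]), (101040917, [101020917]),
    (101050817, [101040517]), (101050916, [101050809])]),
  (131776, [
    (1090913, [1050913]), (101080913, [101040913]), (101090912, [101050912]),
    (5090909, [3090909]), (104090909, [102090909]), (105080909, [104050909])]),
  (132616, [
    (1050521, [1050513]), (5050517, [5050509]), (101040521, [101040513]),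
    (101050520, [101050512]), (104050517, [104050509]), (105050516, [105050508])]),
  (132736, [
    (1051313, [1031313]), (5050913, [3050913]), (101041313, [101021313]),
    (101051213, [101031213]), (104050913, [102050913]), (105050813, [104050513]),
    (105050912, [103050912]), (405050909, [205050909]), (505050809, [405050509])]),
  (133696, [
    (405050513, [205050513]), (505050512, [305050512])]),
  (139336, [
    (1010327, [1010323]), (1011119, [1010719]), (1030325, [1030321]), (1030919, [1030519]),
    (1031117, [1030911]), (3030917, [3030517]), (101010227, [101010223]),
    (101010326, [101010322]), (101011019, [101010619]), (101011118, [101011011]),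
    (101020325, [101020321]), (101020919, [101020519]), (101021117, [101020911]),
    (101030324, [101030320]), (101030819, [101030419]), (101031116, [101030811]),
    (101030918, [101030518]), (101031017, [101030910]), (102030917, [102030517]),
    (103030817, [103030417]), (103030916, [103030809])]),
  (139456, [
    (1091111, [1051111]), (3090911, [3050911]), (101081111, [101041111]),
    (101091011, [101051011]), (102090911, [102050911]), (103080911, [103040911]),
    (103090910, [103050910]), (203090909, [103090909]), (303080909, [303040909])]),
  (140296, [
    (1010723, [1010715]), (1030523, [1030515]), (1030721, [1030713]), (1050719, [1030719]),
    (1070717, [1070709]), (3030521, [3030513]), (3050519, [3050511]), (3050717, [3050709]),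
    (101010623, [101010615]), (101010722, [101010714]), (101020523, [101020515]),
    (101030423, [101020323]), (101020721, [101020713]), (101040719, [101020719]),
    (101030522, [101030514]), (101030621, [101030613]), (101050619, [101030619]),
    (101030720, [101030712]), (101050718, [101030718]), (101060717, [101060709]),
    (101070716, [101070708]), (102030521, [102030513]), (103030421, [102030321]),
    (102050519, [102050511]), (103040519, [102030519]), (102050717, [102050709]),
    (103040717, [102030717]), (103030520, [103030512]), (103050518, [103050510]),
    (103050617, [103050609]), (203050517, [103050517]), (303040517, [203030517]),
    (103050716, [103050708]), (303050516, [303050508])]),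
  (141376, [
    (5050715, [3050715]), (5070713, [3070713]), (104050715, [102050715]),
    (104070713, [102070713]), (105050615, [103050615]), (205050515, [105050515]),
    (105050714, [103050714]), (105060713, [103060713]), (205050713, [105050713]),
    (105070712, [103070712]), (304050515, [203050515]), (304050713, [203050713]),
    (405050711, [205050711]), (405070709, [205070709]), (505060709, [305060709]),
    (505050710, [505050709]), (305050712, [305050710]), (505070708, [305070708]),
    (505050611, [505050607]), (305050613, [305050611]), (305050514, [305050513])]),
  (147976, [
    (3030323, [3030315]), (3030719, [3030711]), (102030323, [102030315]),
    (102030719, [102030711]), (103030322, [103030314]), (203030321, [103030321]),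
    (103030619, [103030611]), (203030519, [103030519]), (303030419, [203030319]),
    (303030320, [303030319]), (103030718, [103030710]), (203030717, [103030717]),
    (303030518, [303030510]), (303030617, [303030517]), (303030716, [303030708])]),
  (148096, [
    (3031115, [3030715]), (102031115, [102030715]), (103031015, [103030615]),
    (203030915, [103030915]), (103031114, [103030714]), (203031113, [103031113]),
    (303030815, [303030415]), (303030914, [303030514]), (303031013, [303030913]),
    (303031112, [303030712]), (3071111, [3070707, 3071107]), (102071111, [102071107, 102070707]),
    (103071011, [103060707, 103061107]), (203070911, [103070911]), (103061111, [103060711]),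
    (203051111, [103051111]), (303041111, [203031111]), (303070811, [303040711]),
    (303060911, [303051007, 303050607]), (303051011, [303050911]), (303070910, [303050710])]),
  (150016, [
    (407070707, [307070707]), (506070707, [306070707])])]

set_option maxRecDepth 100000 in
theorem certs_ok : certGroups.all (fun g => runOk g.1 [] g.2) = true := by
  decide +kernel

def goodW (w : ℕ) : Bool :=
  Nat.beq w 149056 || (Nat.beq w 140416 || Nat.beq w 70216)

def covered (l : List ℕ) : Bool :=
  frc (wc l) fun w =>
    goodW w || certGroups.any fun g => Nat.beq g.1 w && g.2.any fun c => eqB (dec c.1) l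

def coverAll : Bool :=
  (List.range 7).all fun a => (List.range 9).all fun b => Nat.blt b a ||
    (List.range 11).all fun c => Nat.blt c b ||
      (List.range 17).all fun d => Nat.blt d c || (Nat.blt 32 (a + b + c + 2 * d) ||
        covered [a, b, c, d, 32 - a - b - c - d])

set_option maxRecDepth 100000 in
theorem cover_ok : coverAll = true := by
  decide +kernel

theorem spread_eq (a : ℕ) : spread a = ∑ t ∈ Finset.range 6,
    (if Nat.testBit a t then 1 else 0) * 8 ^ (5 - t) := by
  simp only [spread, spreadAux, ndiv, nmod, Nat.add_eq, Nat.mul_eq, Nat.pow_eq,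
    Nat.testBit_eq_decide_div_mod_eq, Finset.sum_range_succ, Finset.sum_range_zero,
    decide_eq_true_eq, Nat.div_div_eq_div_mul]
  have h : ∀ x : ℕ, (if x % 2 = 1 then 1 else 0) = x % 2 := by
    intro x; split_ifs <;> omega
  simp only [h]
  norm_num
  ring

theorem wF_eq (a : Fin 5 →₀ ℕ) : wF a = wVec a 0 * 32768 + wVec a 1 * 4096 + wVec a 2 * 512 +
    wVec a 3 * 64 + wVec a 4 * 8 + wVec a 5 := by
  have : wF a = ∑ t ∈ Finset.range 6, wVec a t * 8 ^ (5 - t) := by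
    simp only [wF, spread_eq, wVec, Finset.sum_mul]
    rw [Finset.sum_comm]
  rw [this]
  simp only [Finset.sum_range_succ, Finset.sum_range_zero]
  norm_num

theorem wVec_le (a : Fin 5 →₀ ℕ) (t : ℕ) : wVec a t ≤ 5 := by
  calc wVec a t ≤ ∑ _j : Fin 5, 1 := Finset.sum_le_sum fun j _ => by split_ifs <;> simp
    _ = 5 := by simp

theorem wVec_big (a : Fin 5 →₀ ℕ) (h : degA a = 32) (t : ℕ) (ht : 6 ≤ t) : wVec a t = 0 := by
  apply Finset.sum_eq_zero
  intro j _
  have h1 : a j ≤ 32 := by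
    rw [← h]; exact Finset.single_le_sum (f := fun i => a i) (fun _ _ => Nat.zero_le _)
      (Finset.mem_univ j)
  have h2 : a j < 2 ^ t := lt_of_le_of_lt h1
    (lt_of_lt_of_le (by norm_num) (Nat.pow_le_pow_right (by norm_num) ht))
  rw [Nat.testBit_lt_two_pow h2]
  simp

theorem lex_of_wF {a b : Fin 5 →₀ ℕ} (h : wF b < wF a) : lexLtN (wVec b) (wVec a) := by
  by_contra hc
  simp only [lexLtN, not_exists, not_and] at hc
  have A := wVec_le a
  have B := wVec_le b
  have a0 := A 0; have a1 := A 1; have a2 := A 2; have a3 := A 3; have a4 := A 4; have a5 := A 5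
  have b0 := B 0; have b1 := B 1; have b2 := B 2; have b3 := B 3; have b4 := B 4; have b5 := B 5
  rw [wF_eq, wF_eq] at h
  have c0 := hc 0 (by intro j hj; omega)
  have e0 : wVec b 0 = wVec a 0 := by omega
  have c1 := hc 1 (by intro j hj; interval_cases j; assumption)
  have e1 : wVec b 1 = wVec a 1 := by omega
  have c2 := hc 2 (by intro j hj; interval_cases j <;> assumption)
  have e2 : wVec b 2 = wVec a 2 := by omega
  have c3 := hc 3 (by intro j hj; interval_cases j <;> assumption)
  have e3 : wVec b 3 = wVec a 3 := by omega
  have c4 := hc 4 (by intro j hj; interval_cases j <;> assumption)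
  have e4 : wVec b 4 = wVec a 4 := by omega
  have c5 := hc 5 (by intro j hj; interval_cases j <;> assumption)
  omega

theorem wVec_of_wF (a : Fin 5 →₀ ℕ) (h : degA a = 32) (x0 x1 x2 x3 x4 : ℕ)
    (hx : x0 ≤ 5 ∧ x1 ≤ 5 ∧ x2 ≤ 5 ∧ x3 ≤ 5 ∧ x4 ≤ 5)
    (hw : wF a = x0 * 32768 + x1 * 4096 + x2 * 512 + x3 * 64 + x4 * 8) :
    wVec a 0 = x0 ∧ wVec a 1 = x1 ∧ wVec a 2 = x2 ∧ wVec a 3 = x3 ∧ wVec a 4 = x4 ∧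
      ∀ t, wVec a (t + 5) = 0 := by
  have A := wVec_le a
  have a0 := A 0; have a1 := A 1; have a2 := A 2; have a3 := A 3; have a4 := A 4; have a5 := A 5
  rw [wF_eq] at hw
  refine ⟨by omega, by omega, by omega, by omega, by omega, ?_⟩
  intro t
  cases t with
  | zero => show wVec a 5 = 0; omega
  | succ t => exact wVec_big a h _ (by omega)

theorem mono_eq_MF (a : Fin 5 →₀ ℕ) : mono a = MF a := by
  rw [mono, monomial_eq, MF, Finsupp.prod_fintype]
  · simp
  · simp

theorem not_adm {a : Fin 5 →₀ ℕ} (h : degA a = 32) (hz : MF a ∈ ZS (wF a)) : ¬ Admissible a := by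
  intro hA
  apply hA
  obtain ⟨x, hx, s, hs, hxs⟩ := Submodule.mem_sup.1 hz
  have key : ∀ b, coeff b s ≠ 0 → degA b = 32 ∧ wF b < wF a := by
    clear hxs
    induction hs using Submodule.span_induction with
    | mem u hu =>
      obtain ⟨f, h1, h2, rfl⟩ := hu
      intro b hb
      have e : MF f = mono (Finsupp.equivFunOnFinite.symm f) := by
        rw [mono_eq_MF]; rfl
      rw [e, mono, coeff_monomial] at hb
      split_ifs at hb with hfb
      · subst hfb
        exact ⟨h1, h2⟩
      · exact absurd rfl hb
    | zero => intro b hb; simp at hb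
    | add u v _ _ hu hv =>
      intro b hb
      by_cases h0 : coeff b u = 0
      · apply hv b
        intro h1
        apply hb
        rw [coeff_add, h0, h1, add_zero]
      · exact hu b h0
    | smul c u _ hu =>
      intro b hb
      apply hu b
      intro h0
      apply hb
      rw [coeff_smul, h0, smul_zero]
  refine ⟨s.support, ?_, ?_⟩
  · intro b hb
    have := key b (mem_support_iff.1 hb)
    exact ⟨by rw [this.1, h], Or.inl (lex_of_wF this.2)⟩
  · have hs' : ∑ b ∈ s.support, mono b = s := by
      conv_rhs => rw [s.as_sum]
      apply Finset.sum_congr rfl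
      intro b hb
      have h01 : ∀ c : ZMod 2, c ≠ 0 → c = 1 := by decide
      rw [h01 _ (mem_support_iff.1 hb), mono]
    rw [hs', mono_eq_MF, ← hxs, add_sub_cancel_right, h]
    exact hitS_isHit hx

theorem cover_spec (a b c d e : ℕ) (h1 : a ≤ b) (h2 : b ≤ c) (h3 : c ≤ d) (h4 : d ≤ e)
    (hs : a + b + c + d + e = 32) : covered [a, b, c, d, e] = true := by
  have h := cover_ok
  simp only [coverAll, List.all_eq_true, List.mem_range] at h
  have h := h a (by omega) b (by omega)
  have nb : ∀ x y : ℕ, y ≤ x → Nat.blt x y = true → False := fun x y hxy hb => by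
    have : x < y := Nat.le_of_ble_eq_true hb
    omega
  rw [Bool.or_eq_true] at h
  rcases h with h | h
  · exact (nb _ _ h1 h).elim
  simp only [List.all_eq_true, List.mem_range] at h
  have h := h c (by omega)
  rw [Bool.or_eq_true] at h
  rcases h with h | h
  · exact (nb _ _ h2 h).elim
  simp only [List.all_eq_true, List.mem_range] at h
  have h := h d (by omega)
  rw [Bool.or_eq_true, Bool.or_eq_true] at h
  rcases h with h | h | h
  · exact (nb _ _ h3 h).elim
  · exact (nb _ _ (by omega) h).elim
  · have : 32 - a - b - c - d = e := by omega
    rwa [this] at h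

theorem wF_cases (a : Fin 5 →₀ ℕ) (h1 : degA a = 32) (h2 : Admissible a) :
    wF a = 149056 ∨ wF a = 140416 ∨ wF a = 70216 := by
  set g : Fin 5 → ℕ := a ∘ Tuple.sort a with hg
  have hm : Monotone g := Tuple.monotone_sort a
  have hsum : ∑ i, g i = 32 := by
    rw [← h1]; exact Equiv.sum_comp (Tuple.sort a) a
  have hw : wF g = wF a := Equiv.sum_comp (Tuple.sort a) fun i => spread (a i)
  rw [Fin.sum_univ_five] at hsum
  have hc := cover_spec (g 0) (g 1) (g 2) (g 3) (g 4) (hm (by decide)) (hm (by decide))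
    (hm (by decide)) (hm (by decide)) hsum
  have hgl : gl [g 0, g 1, g 2, g 3, g 4] = g := by
    funext i; fin_cases i <;> rfl
  have h5 : [g 0, g 1, g 2, g 3, g 4].length = 5 := rfl
  rw [covered, frc_eq, wc_eq h5, hgl, hw, Bool.or_eq_true] at hc
  rcases hc with hc | hc
  · simp only [goodW, Bool.or_eq_true] at hc
    exact hc.imp Nat.eq_of_beq_eq_true (Or.imp Nat.eq_of_beq_eq_true Nat.eq_of_beq_eq_true)
  · exfalso
    rw [List.any_eq_true] at hc
    obtain ⟨G, hG, hc⟩ := hc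
    rw [Bool.and_eq_true, List.any_eq_true] at hc
    obtain ⟨hW, c, hcm, hcl⟩ := hc
    have hW := Nat.eq_of_beq_eq_true hW
    have hrun := (List.all_eq_true.1 certs_ok) G hG
    have hz := run_sound G.2 [] (by simp) hrun c hcm
    rw [eqB_eq hcl, ev_eq h5, hgl, hW] at hz
    have hz' := ZS_rename _ (Tuple.sort a) hz
    rw [MF_rename] at hz'
    have : g ∘ (Tuple.sort a).symm = a := by
      funext i; simp [hg]
    rw [this] at hz'
    exact not_adm h1 hz' h2

/-- every admissible monomial `y = x^a` of degree `32` in `P_5` has weight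
vector `(4,4,3,1)`, `(4,2,2,2)` or `(2,1,1,1,1)` (each followed by zeros). -/
theorem statement13 (a : Fin 5 →₀ ℕ) (h1 : degA a = 32) (h2 : Admissible a) :
    wVec a = (fun t => [4, 4, 3, 1].getD t 0) ∨
    wVec a = (fun t => [4, 2, 2, 2].getD t 0) ∨
    wVec a = (fun t => [2, 1, 1, 1, 1].getD t 0) := by
  rcases wF_cases a h1 h2 with h | h | h
  · left
    obtain ⟨e0, e1, e2, e3, e4, e5⟩ := wVec_of_wF a h1 4 4 3 1 0 (by norm_num) h
    funext t
    match t with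
    | 0 => exact e0
    | 1 => exact e1
    | 2 => exact e2
    | 3 => exact e3
    | 4 => exact e4
    | t + 5 => rw [e5]; rfl
  · right; left
    obtain ⟨e0, e1, e2, e3, e4, e5⟩ := wVec_of_wF a h1 4 2 2 2 0 (by norm_num) h
    funext t
    match t with
    | 0 => exact e0
    | 1 => exact e1
    | 2 => exact e2
    | 3 => exact e3
    | 4 => exact e4
    | t + 5 => rw [e5]; rfl
  · right; right
    obtain ⟨e0, e1, e2, e3, e4, e5⟩ := wVec_of_wF a h1 2 1 1 1 1 (by norm_num) h
    funext t
    match t with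
    | 0 => exact e0
    | 1 => exact e1
    | 2 => exact e2
    | 3 => exact e3
    | 4 => exact e4
    | t + 5 => rw [e5]; rfl

end
end

section
/- The 𝔽₂-vector space (QP_3^+)_67 has dimension 14, and the 𝔽₂-vector space (QP_4^+)_67 has dimension 64. -/
open MvPolynomial

noncomputable section

namespace HitP

abbrev PP (n : ℕ) := Polynomial (P n)

def St (n : ℕ) : P n →ₐ[ZMod 2] PP n :=
  aeval fun j => Polynomial.C (X j) + Polynomial.X * Polynomial.C (X j ^ 2)

def sq {n : ℕ} (k : ℕ) : P n →ₗ[ZMod 2] P n :=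
  { toFun := fun f => (St n f).coeff k
    map_add' := by intro f g; simp
    map_smul' := by intro c f; simp }

variable {n : ℕ}

lemma sq_def (k : ℕ) (f : P n) : sq k f = (St n f).coeff k := rfl

lemma sq_mul (k : ℕ) (f g : P n) :
    sq k (f * g) = ∑ x ∈ Finset.HasAntidiagonal.antidiagonal k, sq x.1 f * sq x.2 g := by
  simp [sq_def, Polynomial.coeff_mul]

lemma St_X (j : Fin n) :
    St n (X j) = Polynomial.C (X j) + Polynomial.X * Polynomial.C (X j ^ 2) := by
  simp [St]

lemma sq_zero (f : P n) : sq 0 f = f := by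
  have : (Polynomial.constantCoeff.comp (St n).toRingHom) = RingHom.id (P n) := by
    apply MvPolynomial.ringHom_ext
    · intro r
      have : (St n) (C r) = algebraMap (ZMod 2) _ r := by
        rw [← MvPolynomial.algebraMap_eq]; exact (St n).commutes r
      simp [this, Polynomial.algebraMap_apply, MvPolynomial.algebraMap_eq]
    · intro i
      simp [St_X]
  have h := RingHom.congr_fun this f
  simpa [sq_def] using h

lemma two_eq (f : P n) : f + f = 0 := CharTwo.add_self_eq_zero f

lemma add_sq2 (f g : P n) : (f + g) ^ 2 = f ^ 2 + g ^ 2 := CharTwo.add_sq f g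

lemma St_sq (f : P n) :
    St n (f ^ 2) = Polynomial.expand (P n) 2 ((St n f).map (frobenius (P n) 2)) := by
  rw [map_pow, ← Polynomial.map_expand, Polynomial.map_frobenius_expand]

lemma sq_even_sq (k : ℕ) (f : P n) : sq (2 * k) (f ^ 2) = (sq k f) ^ 2 := by
  rw [sq_def, St_sq, mul_comm, Polynomial.coeff_expand_mul (by norm_num), Polynomial.coeff_map]
  rfl

lemma sq_odd_sq (k : ℕ) (f : P n) : sq (2 * k + 1) (f ^ 2) = 0 := by
  rw [sq_def, St_sq, Polynomial.coeff_expand (by norm_num), if_neg (by omega)]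

lemma sq1_X (j : Fin n) : sq 1 (X j : P n) = X j ^ 2 := by
  rw [sq_def, St_X, Polynomial.coeff_add, Polynomial.coeff_C, Polynomial.coeff_X_mul,
    Polynomial.coeff_C]
  simp

lemma sq_X_big (k : ℕ) (j : Fin n) : sq (k + 2) (X j : P n) = 0 := by
  rw [sq_def, St_X, Polynomial.coeff_add, Polynomial.coeff_C, Polynomial.coeff_X_mul,
    Polynomial.coeff_C]
  simp

lemma sq1_mul (f g : P n) : sq 1 (f * g) = sq 1 f * g + f * sq 1 g := by
  rw [sq_mul, Finset.Nat.antidiagonal_succ]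
  simp [sq_zero, add_comm]

lemma sq2_mul (f g : P n) : sq 2 (f * g) = sq 2 f * g + sq 1 f * sq 1 g + f * sq 2 g := by
  rw [sq_mul, Finset.Nat.sum_antidiagonal_succ, Finset.Nat.sum_antidiagonal_succ]
  simp [sq_zero]
  ring

lemma sq1_sq (f : P n) : sq 1 (f ^ 2) = 0 := sq_odd_sq 0 f
lemma sq2_sq (f : P n) : sq 2 (f ^ 2) = (sq 1 f) ^ 2 := sq_even_sq 1 f
lemma sq2_X (j : Fin n) : sq 2 (X j : P n) = 0 := sq_X_big 0 j

/-- Homogeneity and instability of the squares. -/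
def Good (m : ℕ) (f : P n) : Prop :=
  (∀ k, (sq k f).IsHomogeneous (m + k)) ∧ (St n f).natDegree ≤ m ∧ sq m f = f ^ 2

lemma good_mul {a b : ℕ} {f g : P n} (hf : Good a f) (hg : Good b g) : Good (a + b) (f * g) := by
  refine ⟨?_, ?_, ?_⟩
  · intro k
    rw [sq_mul]
    apply IsHomogeneous.sum
    rintro ⟨i, j⟩ hij
    rw [Finset.HasAntidiagonal.mem_antidiagonal] at hij
    have := (hf.1 i).mul (hg.1 j)
    convert this using 1
    simp only at hij
    omega
  · rw [map_mul]
    exact Polynomial.natDegree_mul_le_of_le hf.2.1 hg.2.1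
  · rw [sq_def, map_mul, Polynomial.coeff_mul_add_eq_of_natDegree_le hf.2.1 hg.2.1]
    have h1 := hf.2.2
    have h2 := hg.2.2
    rw [sq_def] at h1 h2
    rw [h1, h2]; ring

lemma good_one : Good 0 (1 : P n) := by
  refine ⟨?_, ?_, ?_⟩
  · intro k
    rw [sq_def, map_one, Polynomial.coeff_one]
    split_ifs with h
    · subst h; exact isHomogeneous_one _ _
    · exact isHomogeneous_zero _ _ _
  · simp
  · rw [sq_zero]; simp

lemma good_X (j : Fin n) : Good 1 (X j : P n) := by
  refine ⟨?_, ?_, ?_⟩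
  · intro k
    match k with
    | 0 => rw [sq_zero]; exact isHomogeneous_X _ _
    | 1 => rw [sq1_X]; exact (isHomogeneous_X _ j).pow 2
    | k + 2 => rw [sq_X_big]; exact isHomogeneous_zero _ _ _
  · rw [St_X]
    refine (Polynomial.natDegree_add_le _ _).trans ?_
    simp only [Polynomial.natDegree_C]
    refine max_le (by norm_num) ?_
    exact (Polynomial.natDegree_mul_C_le _ _).trans (by simp)
  · exact sq1_X j

lemma good_pow {a : ℕ} {f : P n} (hf : Good a f) (k : ℕ) : Good (k * a) (f ^ k) := by
  induction k with
  | zero => simpa using good_one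
  | succ k ih => rw [pow_succ, add_mul, one_mul]; exact good_mul ih hf

lemma good_monomial (a : Fin n →₀ ℕ) : Good a.degree (monomial a (1 : ZMod 2) : P n) := by
  induction a using Finsupp.induction_linear with
  | zero => simpa using good_one
  | add f g hf hg =>
    rw [map_add]
    have := good_mul hf hg
    rwa [monomial_mul, mul_one] at this
  | single j k =>
    have := good_pow (good_X j) k
    rw [Finsupp.degree_single, ← X_pow_eq_monomial]
    simpa using this

lemma hom_ind {d : ℕ} {p : P n → Prop} (h0 : p 0) (ha : ∀ f g, p f → p g → p (f + g))
    (hm : ∀ a : Fin n →₀ ℕ, a.degree = d → p (monomial a 1)) :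
    ∀ f : P n, f.IsHomogeneous d → p f := by
  intro f hf
  rw [f.as_sum]
  apply Finset.sum_induction _ p ha h0
  intro a hA
  have hc : coeff a f ≠ 0 := by simpa [mem_support_iff] using hA
  have h1 : coeff a f = 1 := by
    generalize coeff a f = c at hc
    revert hc; revert c; decide
  rw [h1]
  apply hm
  have := hf hc
  rwa [Finsupp.degree_eq_weight_one]

lemma good_hom {d : ℕ} (f : P n) (hf : f.IsHomogeneous d) : Good d f := by
  refine hom_ind (p := Good d) ?_ ?_ ?_ f hf
  · refine ⟨fun k => ?_, by simp, ?_⟩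
    · rw [map_zero]; exact isHomogeneous_zero _ _ _
    · simp
  · intro f g hf hg
    refine ⟨fun k => ?_, ?_, ?_⟩
    · rw [map_add]; exact (hf.1 k).add (hg.1 k)
    · rw [map_add]; exact Polynomial.natDegree_add_le_of_degree_le hf.2.1 hg.2.1
    · rw [map_add, hf.2.2, hg.2.2, add_sq2]
  · rintro a rfl
    exact good_monomial a

lemma sq_hom {d : ℕ} {f : P n} (hf : f.IsHomogeneous d) (k : ℕ) :
    (sq k f).IsHomogeneous (d + k) := (good_hom f hf).1 k

lemma sq_top {d : ℕ} {f : P n} (hf : f.IsHomogeneous d) : sq d f = f ^ 2 := (good_hom f hf).2.2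

lemma SqT_eq (f : P n) : SqT n f = (St n f).eval 1 := by
  have : SqT n = ((Polynomial.aeval (R := P n) (1 : P n)).restrictScalars (ZMod 2)).comp (St n) := by
    apply MvPolynomial.algHom_ext
    intro i
    simp [SqT, St_X]
  rw [this]
  simp

lemma comp_SqT {m k : ℕ} {f : P n} (hf : f.IsHomogeneous m) :
    homogeneousComponent (m + k) (SqT n f) = sq k f := by
  rw [SqT_eq, Polynomial.eval_eq_sum_range, map_sum]
  simp only [one_pow, mul_one]
  have : ∀ i, homogeneousComponent (m + k) ((St n f).coeff i) = if i = k then sq k f else 0 := by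
    intro i
    rw [← sq_def, homogeneousComponent_of_mem (sq_hom hf i)]
    split_ifs with h1 h2 h2
    · subst h2; rfl
    · omega
    · omega
    · rfl
  simp only [this]
  rw [Finset.sum_ite_eq']
  split_ifs with h
  · rfl
  · rw [sq_def, Polynomial.coeff_eq_zero_of_natDegree_lt]
    simpa using h

/-- hits of degree `d` -/
def Hd (n d : ℕ) : Submodule (ZMod 2) (P n) :=
  Submodule.span (ZMod 2) {u | ∃ k h m, 1 ≤ k ∧ m + k = d ∧ IsHomogeneous h m ∧ u = sq k h}

lemma sq_mem {d : ℕ} (k m : ℕ) {h : P n} (hh : h.IsHomogeneous m) (hk : 1 ≤ k) (hd : m + k = d) :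
    sq k h ∈ Hd n d := Submodule.subset_span ⟨k, h, m, hk, hd, hh, rfl⟩

lemma Hd_eq (d : ℕ) : Hd n d = hitSub n d := by
  apply le_antisymm
  · apply Submodule.span_le.2
    rintro u ⟨k, h, m, hk, hd, hh, rfl⟩
    apply Submodule.subset_span
    refine ⟨fun i => if i = k then h else 0, ?_, ?_⟩
    · intro i
      dsimp only
      split_ifs with hi
      · subst hi
        have : d - i = m := by omega
        rw [this]; exact hh
      · exact Submodule.zero_mem _
    · rw [Finset.sum_eq_single k]
      · dsimp only
        rw [if_pos rfl, ← hd, comp_SqT hh]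
      · intro b _ hb
        dsimp only
        rw [if_neg hb]; simp
      · intro hk'
        exfalso; apply hk'
        rw [Finset.mem_Icc]; omega
  · apply Submodule.span_le.2
    rintro u ⟨f, hf, rfl⟩
    apply Submodule.sum_mem
    intro i hi
    rw [Finset.mem_Icc] at hi
    have hh : (f i).IsHomogeneous (d - i) := hf i
    have := comp_SqT (k := i) hh
    rw [show d - i + i = d by omega] at this
    rw [this]
    exact sq_mem i (d - i) hh hi.1 (by omega)

lemma Hd_hom {d : ℕ} {u : P n} (hu : u ∈ Hd n d) : u.IsHomogeneous d := by
  have : Hd n d ≤ homogeneousSubmodule (Fin n) (ZMod 2) d := by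
    apply Submodule.span_le.2
    rintro u ⟨k, h, m, hk, hd, hh, rfl⟩
    rw [← hd]; exact sq_hom hh k
  exact this hu

/-- Naturality. -/
lemma St_nat {m : ℕ} (α : P n →ₐ[ZMod 2] P m)
    (hα : ∀ j, St m (α (X j)) = Polynomial.C (α (X j)) + Polynomial.X * Polynomial.C (α (X j) ^ 2))
    (f : P n) : St m (α f) = (St n f).map α.toRingHom := by
  have : (St m).comp α = (Polynomial.mapAlgHom α).comp (St n) := by
    apply MvPolynomial.algHom_ext
    intro i
    simp only [AlgHom.comp_apply, hα, St_X]
    simp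
  exact DFunLike.congr_fun this f

lemma sq_nat {m : ℕ} (α : P n →ₐ[ZMod 2] P m)
    (hα : ∀ j, St m (α (X j)) = Polynomial.C (α (X j)) + Polynomial.X * Polynomial.C (α (X j) ^ 2))
    (k : ℕ) (f : P n) : sq k (α f) = α (sq k f) := by
  rw [sq_def, St_nat α hα, Polynomial.coeff_map]; rfl

lemma sq_Xpow_mul (m k : ℕ) (j : Fin n) (g : P n) :
    sq m (X j ^ (2 ^ k) * g) = X j ^ (2 ^ k) * sq m g +
      (if 2 ^ k ≤ m then X j ^ (2 ^ (k + 1)) * sq (m - 2 ^ k) g else 0) := by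
  have h : St n (X j ^ (2 ^ k)) = Polynomial.C (X j ^ (2 ^ k)) +
      Polynomial.X ^ (2 ^ k) * Polynomial.C (X j ^ (2 ^ (k + 1))) := by
    rw [map_pow, St_X, add_pow_char_pow, mul_pow, ← Polynomial.C_pow, ← Polynomial.C_pow, ← pow_mul,
      pow_succ' 2 k]
  rw [sq_def, map_mul, h, add_mul, Polynomial.coeff_add, Polynomial.coeff_C_mul, mul_assoc,
    Polynomial.coeff_X_pow_mul', Polynomial.coeff_C_mul]
  rfl

lemma chain1 (d m k e : ℕ) (j : Fin n) {g : P n} (hg : g.IsHomogeneous e) (hm : 1 ≤ m)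
    (hk : 2 ^ k ≤ m) (hd : 2 ^ k + e + m = d)
    (h : X j ^ (2 ^ (k + 1)) * sq (m - 2 ^ k) g ∈ Hd n d) : X j ^ (2 ^ k) * sq m g ∈ Hd n d := by
  have h1 : (X j ^ (2 ^ k) * g).IsHomogeneous (2 ^ k + e) := by
    have := ((isHomogeneous_X (ZMod 2) j).pow (2 ^ k)).mul hg
    rwa [one_mul] at this
  have h2 := sq_mem m _ h1 hm hd
  rw [sq_Xpow_mul, if_pos hk] at h2
  exact (Submodule.add_mem_iff_left _ h).1 h2

lemma chain2 (d m k e : ℕ) (j : Fin n) {g : P n} (hg : g.IsHomogeneous e) (hm : 1 ≤ m)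
    (hk : m < 2 ^ k) (hd : 2 ^ k + e + m = d) : X j ^ (2 ^ k) * sq m g ∈ Hd n d := by
  have h1 : (X j ^ (2 ^ k) * g).IsHomogeneous (2 ^ k + e) := by
    have := ((isHomogeneous_X (ZMod 2) j).pow (2 ^ k)).mul hg
    rwa [one_mul] at this
  have h2 := sq_mem m _ h1 hm hd
  rw [sq_Xpow_mul, if_neg (by omega), add_zero] at h2
  exact h2

lemma low1 (j : Fin n) {y : P n} (hy : y.IsHomogeneous 33) : X j * y ^ 2 ∈ Hd n 67 := by
  rw [← sq_top hy]
  have h5 : X j ^ (2 ^ 5) * sq 2 y ∈ Hd n 67 := chain2 67 2 5 33 j hy (by norm_num) (by norm_num) rfl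
  have h4 : X j ^ (2 ^ 4) * sq 18 y ∈ Hd n 67 :=
    chain1 67 18 4 33 j hy (by norm_num) (by norm_num) rfl h5
  have h3 : X j ^ (2 ^ 3) * sq 26 y ∈ Hd n 67 :=
    chain1 67 26 3 33 j hy (by norm_num) (by norm_num) rfl h4
  have h2 : X j ^ (2 ^ 2) * sq 30 y ∈ Hd n 67 :=
    chain1 67 30 2 33 j hy (by norm_num) (by norm_num) rfl h3
  have h1 : X j ^ (2 ^ 1) * sq 32 y ∈ Hd n 67 :=
    chain1 67 32 1 33 j hy (by norm_num) (by norm_num) rfl h2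
  have h0 : X j ^ (2 ^ 0) * sq 33 y ∈ Hd n 67 :=
    chain1 67 33 0 33 j hy (by norm_num) (by norm_num) rfl h1
  simpa using h0

lemma sq_mul_sq (f h : P n) (k : ℕ) (hf : ∀ j, 4 ≤ j → sq j f = 0) :
    sq (2 * (k + 1)) (f * h ^ 2) = f * (sq (k + 1) h) ^ 2 + sq 2 f * (sq k h) ^ 2 := by
  have hodd : ∀ j, sq (2 * j + 1) (h ^ 2) = 0 := fun j => sq_odd_sq j h
  rw [sq_mul, show 2 * (k + 1) = 2 * k + 1 + 1 by ring, Finset.Nat.sum_antidiagonal_succ,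
    Finset.Nat.sum_antidiagonal_succ]
  simp only [sq_zero, zero_add]
  rw [hodd k, mul_zero, zero_add, show 2 * k + 1 + 1 = 2 * (k + 1) by ring, sq_even_sq]
  congr 1
  rw [Finset.sum_eq_single (0, 2 * k)]
  · simp only [sq_even_sq]
  · rintro ⟨a, b⟩ hab hne
    rw [Finset.HasAntidiagonal.mem_antidiagonal] at hab
    simp only at hab ⊢
    rcases Nat.even_or_odd b with ⟨c, hc⟩ | ⟨c, hc⟩
    · have : a ≠ 0 := by
        rintro rfl
        apply hne
        ext <;> simp; omega
      rw [hf _ (by omega), zero_mul]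
    · rw [hc, hodd, mul_zero]
  · intro h
    exfalso; apply h
    rw [Finset.HasAntidiagonal.mem_antidiagonal]; simp

lemma sq_XX (a b : Fin n) (j : ℕ) (hj : 4 ≤ j) : sq j (X a * X b : P n) = 0 := by
  rw [sq_def, Polynomial.coeff_eq_zero_of_natDegree_lt]
  exact lt_of_le_of_lt (good_mul (good_X a) (good_X b)).2.1 (by omega)

lemma sq_XXX (a b c : Fin n) (j : ℕ) (hj : 4 ≤ j) : sq j (X a * X b * X c : P n) = 0 := by
  rw [sq_def, Polynomial.coeff_eq_zero_of_natDegree_lt]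
  exact lt_of_le_of_lt (good_mul (good_mul (good_X a) (good_X b)) (good_X c)).2.1 (by omega)

lemma hX (a : Fin n) : (X a : P n).IsHomogeneous 1 := isHomogeneous_X _ a

lemma low2 {y : P n} (hy : y.IsHomogeneous 16) : y ^ 2 ∈ Hd n 32 := by
  rw [← sq_top hy]
  exact sq_mem 16 16 hy (by norm_num) rfl

/-- transfer of a square map from degree `d` to degree `D` -/
lemma lift_gen (d D : ℕ) (p : P n)
    (hp : ∀ k m h, m + (k + 1) = d → IsHomogeneous h m → p * (sq (k + 1) h) ^ 2 ∈ Hd n D)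
    {u : P n} (hu : u ∈ Hd n d) : p * u ^ 2 ∈ Hd n D := by
  induction hu using Submodule.span_induction with
  | mem x hx =>
    obtain ⟨k, h, m, hk, hd, hh, rfl⟩ := hx
    obtain ⟨k, rfl⟩ : ∃ j, k = j + 1 := ⟨k - 1, by omega⟩
    exact hp k m h hd hh
  | zero => simp
  | add x y _ _ hx hy => rw [add_sq2, mul_add]; exact Submodule.add_mem _ hx hy
  | smul c x _ hx =>
    rw [smul_pow, mul_smul_comm]; exact Submodule.smul_mem _ _ hx

lemma lift1 (a b c : Fin n) {u : P n} (hu : u ∈ Hd n 32) : X a * X b * X c * u ^ 2 ∈ Hd n 67 := by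
  refine lift_gen 32 67 _ ?_ hu
  intro k m h hm hh
  have h1 : (X a * X b * X c * h ^ 2 : P n).IsHomogeneous (1 + 1 + 1 + m * 2) :=
    (((hX a).mul (hX b)).mul (hX c)).mul (hh.pow 2)
  have h2 := sq_mem (d := 67) (2 * (k + 1)) _ h1 (by omega) (by omega)
  rw [sq_mul_sq _ _ _ (sq_XXX a b c)] at h2
  refine (Submodule.add_mem_iff_left _ ?_).1 h2
  have h3 : (sq k h).IsHomogeneous 31 := by
    have := sq_hom hh k
    rwa [show m + k = 31 by omega] at this
  have key : ∀ a b c : Fin n, X c * (X a * X b * sq k h) ^ 2 ∈ Hd n 67 := fun a b c =>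
    low1 c (((hX a).mul (hX b)).mul h3)
  have e : sq 2 (X a * X b * X c : P n) * (sq k h) ^ 2 = X c * (X a * X b * sq k h) ^ 2 +
      X b * (X a * X c * sq k h) ^ 2 + X a * (X b * X c * sq k h) ^ 2 := by
    simp only [sq2_mul, sq1_mul, sq1_X, sq2_X]; ring
  rw [e]
  exact Submodule.add_mem _ (Submodule.add_mem _ (key _ _ _) (key _ _ _)) (key _ _ _)

lemma lift2 (a b : Fin n) {u : P n} (hu : u ∈ Hd n 15) : X a * X b * u ^ 2 ∈ Hd n 32 := by
  refine lift_gen 15 32 _ ?_ hu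
  intro k m h hm hh
  have h1 : (X a * X b * h ^ 2 : P n).IsHomogeneous (1 + 1 + m * 2) :=
    ((hX a).mul (hX b)).mul (hh.pow 2)
  have h2 := sq_mem (d := 32) (2 * (k + 1)) _ h1 (by omega) (by omega)
  rw [sq_mul_sq _ _ _ (sq_XX a b)] at h2
  refine (Submodule.add_mem_iff_left _ ?_).1 h2
  have h3 : (sq k h).IsHomogeneous 14 := by
    have := sq_hom hh k
    rwa [show m + k = 14 by omega] at this
  have e : sq 2 (X a * X b : P n) * (sq k h) ^ 2 = (X a * X b * sq k h) ^ 2 := by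
    simp only [sq2_mul, sq1_X, sq2_X]; ring
  rw [e]
  exact low2 (((hX a).mul (hX b)).mul h3)

lemma lift3 (d : ℕ) (a : Fin n) {u : P n} (hu : u ∈ Hd n d) : X a * u ^ 2 ∈ Hd n (2 * d + 1) := by
  refine lift_gen d (2 * d + 1) _ ?_ hu
  intro k m h hm hh
  have h1 : (X a * h ^ 2 : P n).IsHomogeneous (1 + m * 2) := (hX a).mul (hh.pow 2)
  have h2 := sq_mem (d := 2 * d + 1) (2 * (k + 1)) _ h1 (by omega) (by omega)
  rw [sq_mul_sq _ _ _ (fun j hj => by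
    obtain ⟨i, rfl⟩ : ∃ i, j = i + 2 := ⟨j - 2, by omega⟩
    exact sq_X_big i a), sq2_X, zero_mul, add_zero] at h2
  exact h2

def XI (i : Fin 4) : P 4 :=
  ![X 1 * X 2 * X 3, X 0 * X 2 * X 3, X 0 * X 1 * X 3, X 0 * X 1 * X 2] i

def X4 : P 4 := X 0 * X 1 * X 2 * X 3

lemma XIe0 : (X 1 * X 2 * X 3 : P 4) = XI 0 := rfl
lemma XIe1 : (X 0 * X 2 * X 3 : P 4) = XI 1 := rfl
lemma XIe2 : (X 0 * X 1 * X 3 : P 4) = XI 2 := rfl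
lemma XIe3 : (X 0 * X 1 * X 2 : P 4) = XI 3 := rfl
lemma X4e : (X 0 * X 1 * X 2 * X 3 : P 4) = X4 := rfl

lemma XI_hom (i : Fin 4) : (XI i).IsHomogeneous 3 := by
  fin_cases i <;> exact ((hX _).mul (hX _)).mul (hX _)

lemma XI_lift (i : Fin 4) {u : P 4} (hu : u ∈ Hd 4 32) : XI i * u ^ 2 ∈ Hd 4 67 := by
  fin_cases i <;> exact lift1 _ _ _ hu

lemma mon_dec (a : Fin 4 →₀ ℕ) : ∃ q : Fin 4 →₀ ℕ,
    (monomial a (1 : ZMod 2) : P 4) = (X 0 ^ (a 0 % 2) * X 1 ^ (a 1 % 2) * X 2 ^ (a 2 % 2) *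
      X 3 ^ (a 3 % 2)) * (monomial q 1) ^ 2 ∧
    a.degree = a 0 % 2 + a 1 % 2 + a 2 % 2 + a 3 % 2 + 2 * q.degree := by
  refine ⟨Finsupp.equivFunOnFinite.symm fun i => a i / 2, ?_, ?_⟩
  · rw [monomial_eq, monomial_eq, Finsupp.prod_fintype _ _ (by simp),
      Finsupp.prod_fintype _ _ (by simp)]
    simp only [Fin.prod_univ_four, map_one, one_mul, Finsupp.equivFunOnFinite_symm_apply_apply]
    have : ∀ j : Fin 4, (X j : P 4) ^ (a j) = X j ^ (a j % 2) * (X j ^ (a j / 2)) ^ 2 := by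
      intro j
      rw [← pow_mul, ← pow_add]
      congr 1
      omega
    rw [this 0, this 1, this 2, this 3]
    ring
  · rw [Finsupp.degree_eq_sum, Finsupp.degree_eq_sum]
    simp only [Fin.sum_univ_four, Finsupp.equivFunOnFinite_symm_apply_apply]
    omega

lemma mon_hom (q : Fin n →₀ ℕ) : (monomial q (1 : ZMod 2) : P n).IsHomogeneous q.degree :=
  isHomogeneous_monomial _ rfl

lemma dec_odd (d : ℕ) (hd : d % 2 = 1) {p : P 4 → Prop} (h0 : p 0)
    (ha : ∀ f g, p f → p g → p (f + g))
    (h1 : ∀ m c q, 2 * m + 1 = d → IsHomogeneous q m → p (X c * q ^ 2))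
    (h3 : ∀ m k q, 2 * m + 3 = d → IsHomogeneous q m → p (XI k * q ^ 2)) :
    ∀ f : P 4, f.IsHomogeneous d → p f := by
  apply hom_ind h0 ha
  intro a hA
  obtain ⟨q, hq, hdeg⟩ := mon_dec a
  rw [hq]
  have hq' := mon_hom q
  rcases Nat.mod_two_eq_zero_or_one (a 0) with e0 | e0 <;>
  rcases Nat.mod_two_eq_zero_or_one (a 1) with e1 | e1 <;>
  rcases Nat.mod_two_eq_zero_or_one (a 2) with e2 | e2 <;>
  rcases Nat.mod_two_eq_zero_or_one (a 3) with e3 | e3 <;>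
  rw [e0, e1, e2, e3] at hdeg ⊢ <;> simp only [pow_zero, pow_one, one_mul, mul_one, XIe0, XIe1, XIe2, XIe3] <;>
  first
  | (exfalso; omega)
  | (with_reducible refine h1 _ _ _ ?_ hq'); omega
  | (with_reducible refine h3 _ _ _ ?_ hq'); omega

lemma dec_even (d : ℕ) (hd : d % 2 = 0) {p : P 4 → Prop} (h0 : p 0)
    (ha : ∀ f g, p f → p g → p (f + g))
    (h1 : ∀ m q, 2 * m = d → IsHomogeneous q m → p (q ^ 2))
    (h2 : ∀ m a b q, 2 * m + 2 = d → IsHomogeneous q m → p (X a * X b * q ^ 2))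
    (h4 : ∀ m q, 2 * m + 4 = d → IsHomogeneous q m → p (X4 * q ^ 2)) :
    ∀ f : P 4, f.IsHomogeneous d → p f := by
  apply hom_ind h0 ha
  intro a hA
  obtain ⟨q, hq, hdeg⟩ := mon_dec a
  rw [hq]
  have hq' := mon_hom q
  rcases Nat.mod_two_eq_zero_or_one (a 0) with e0 | e0 <;>
  rcases Nat.mod_two_eq_zero_or_one (a 1) with e1 | e1 <;>
  rcases Nat.mod_two_eq_zero_or_one (a 2) with e2 | e2 <;>
  rcases Nat.mod_two_eq_zero_or_one (a 3) with e3 | e3 <;>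
  rw [e0, e1, e2, e3] at hdeg ⊢ <;> simp only [pow_zero, pow_one, one_mul, mul_one, X4e] <;>
  first
  | (exfalso; omega)
  | (with_reducible refine h1 _ _ ?_ hq'); omega
  | (with_reducible refine h2 _ _ _ _ ?_ hq'); omega
  | (with_reducible refine h4 _ _ ?_ hq'); omega

def br (i d e : Fin 4) (z : P 4) : P 4 := XI i * (X d * X e * z ^ 2) ^ 2

lemma br_add (i d e : Fin 4) (z z' : P 4) : br i d e (z + z') = br i d e z + br i d e z' := by
  simp only [br, add_sq2, mul_add]

lemma br_zero (i d e : Fin 4) : br i d e 0 = 0 := by simp [br]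

lemma br_comm (i d e : Fin 4) (z : P 4) : br i d e z = br i e d z := by
  simp only [br, mul_comm (X d)]

lemma br_hit (i d e : Fin 4) {z : P 4} (hz : z ∈ Hd 4 15) : br i d e z ∈ Hd 4 67 :=
  XI_lift i (lift2 d e hz)

lemma br_hit7 (i d e c : Fin 4) {z : P 4} (hz : z ∈ Hd 4 7) : br i d e (X c * z ^ 2) ∈ Hd 4 67 :=
  br_hit i d e (lift3 7 c hz)

lemma br_hit3 (i d e c c' : Fin 4) {z : P 4} (hz : z ∈ Hd 4 3) :
    br i d e (X c * (X c' * z ^ 2) ^ 2) ∈ Hd 4 67 :=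
  br_hit7 i d e c (lift3 3 c' hz)

lemma relB (i a b c : Fin 4) {w : P 4} (hw : w.IsHomogeneous 14) :
    br i b c (X a * w) + br i a c (X b * w) + br i a b (X c * w) ∈ Hd 4 67 := by
  have h := sq_mem (d := 32) 1 31 (h := X a * X b * X c * w ^ 2)
    ((((hX a).mul (hX b)).mul (hX c)).mul (hw.pow 2)) le_rfl rfl
  have h2 := XI_lift i h
  convert h2 using 1
  simp only [br, sq1_mul, sq1_X, sq1_sq, ← mul_add, ← add_sq2]
  ring

lemma XI_spec (i : Fin 4) : X4 = X i * XI i := by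
  fin_cases i <;> simp [X4, XI] <;> ring

lemma sq1_X4 (g : P 4) : sq 1 (X4 * g ^ 2) = XI 0 * (X 0 * g) ^ 2 + XI 1 * (X 1 * g) ^ 2 +
    XI 2 * (X 2 * g) ^ 2 + XI 3 * (X 3 * g) ^ 2 := by
  simp only [X4, sq1_mul, sq1_X, sq1_sq]
  simp [XI]; ring

lemma XI_split : ∀ a i : Fin 4, a ≠ i → ∃ b c, XI i = X a * (X b * X c) ∧ XI a = X i * (X b * X c) ∧
    X4 = X a * X i * X b * X c := by
  have key : ∀ a i b c : Fin 4, (XI i = X a * (X b * X c)) → X4 = X a * X i * X b * X c := by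
    intro a i b c h; rw [XI_spec i, h]; ring
  have : ∀ a i : Fin 4, a ≠ i → ∃ b c, XI i = X a * (X b * X c) ∧ XI a = X i * (X b * X c) := by
    intro a i h
    fin_cases a <;> fin_cases i <;> (try exact absurd rfl h) <;>
      simp only [Fin.zero_eta, Fin.mk_one, Fin.reduceFinMk, ← XIe0, ← XIe1, ← XIe2, ← XIe3] <;> first
    | exact ⟨0, 1, by ring1, by ring1⟩
    | exact ⟨0, 2, by ring1, by ring1⟩
    | exact ⟨0, 3, by ring1, by ring1⟩
    | exact ⟨1, 2, by ring1, by ring1⟩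
    | exact ⟨1, 3, by ring1, by ring1⟩
    | exact ⟨2, 3, by ring1, by ring1⟩
  intro a i h
  obtain ⟨b, c, h1, h2⟩ := this a i h
  exact ⟨b, c, h1, h2, key a i b c h1⟩

lemma relA (a : Fin 4) {z : P 4} (hz : z.IsHomogeneous 15) :
    (∑ i ∈ Finset.univ.erase a, br i i a z) ∈ Hd 4 67 := by
  have h := sq_mem (d := 67) 1 66 (h := X4 * (X a * z ^ 2) ^ 2)
    (((((hX 0).mul (hX 1)).mul (hX 2)).mul (hX 3)).mul (((hX a).mul (hz.pow 2)).pow 2)) le_rfl rfl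
  have e : sq 1 (X4 * (X a * z ^ 2) ^ 2) =
      (∑ i ∈ Finset.univ.erase a, br i i a z) + XI a * ((X a * z) ^ 2) ^ 2 := by
    have : XI a * ((X a * z) ^ 2) ^ 2 = br a a a z := by simp only [br]; ring
    rw [this, Finset.sum_erase_add _ _ (Finset.mem_univ a), Fin.sum_univ_four, sq1_X4]
    simp only [br]; ring
  rw [e] at h
  exact (Submodule.add_mem_iff_left _ (XI_lift a (low2 ((hX a).mul hz)))).1 h


lemma red2 {N : Submodule (ZMod 2) (P 4)} (hN : Hd 4 67 ≤ N) {z : P 4} (hz : z.IsHomogeneous 14) (i : Fin 4)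
    (H : ∀ i a b c, br i b c (X a * z) ∈ N) : XI i * (X4 * z ^ 2) ^ 2 ∈ N := by
  have h := hN (sq_mem (d := 67) 1 66 (h := X4 * (XI i * z ^ 2) ^ 2)
    (((((hX 0).mul (hX 1)).mul (hX 2)).mul (hX 3)).mul (((XI_hom i).mul (hz.pow 2)).pow 2)) le_rfl rfl)
  have e : sq 1 (X4 * (XI i * z ^ 2) ^ 2) =
      (∑ a ∈ Finset.univ.erase i, XI a * (X a * (XI i * z ^ 2)) ^ 2) + XI i * (X4 * z ^ 2) ^ 2 := by
    have : XI i * (X4 * z ^ 2) ^ 2 = XI i * (X i * (XI i * z ^ 2)) ^ 2 := by rw [XI_spec i]; ring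
    rw [this, Finset.sum_erase_add _ _ (Finset.mem_univ i), Fin.sum_univ_four, sq1_X4]
  rw [e] at h
  refine (Submodule.add_mem_iff_right _ ?_).1 h
  apply Submodule.sum_mem
  intro a hA
  obtain ⟨b, c, h1, -, -⟩ := XI_split a i (Finset.ne_of_mem_erase hA)
  have := H a a b c
  convert this using 1
  rw [h1, br]; ring

lemma red3a {N : Submodule (ZMod 2) (P 4)} (hN : Hd 4 67 ≤ N) (H : ∀ i d e c q, IsHomogeneous q 7 → br i d e (X c * q ^ 2) ∈ N) (i a b c : Fin 4)
    {q : P 4} (hq : q.IsHomogeneous 6) : br i b c (X a * (X b * X c) * q ^ 2) ∈ N := by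
  have h := hN (relB i a b c (w := X b * X c * q ^ 2) (((hX b).mul (hX c)).mul (hq.pow 2)))
  have h1 := H i a c c (X b * q) ((hX b).mul hq)
  have h2 := H i a b b (X c * q) ((hX c).mul hq)
  have e1 : X b * (X b * X c * q ^ 2) = X c * (X b * q) ^ 2 := by ring
  have e2 : X c * (X b * X c * q ^ 2) = X b * (X c * q) ^ 2 := by ring
  rw [e1, e2, add_assoc] at h
  have := (Submodule.add_mem_iff_left _ (Submodule.add_mem _ h1 h2)).1 h
  convert this using 2
  ring

lemma red3b {N : Submodule (ZMod 2) (P 4)} (hN : Hd 4 67 ≤ N) (H : ∀ i d e c q, IsHomogeneous q 7 → br i d e (X c * q ^ 2) ∈ N) (i a b s d : Fin 4)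
    {q : P 4} (hq : q.IsHomogeneous 6) :
    br i b s (X a * (X s * X d) * q ^ 2) + br i a s (X b * (X s * X d) * q ^ 2) ∈ N := by
  have h := hN (relB i a b s (w := X s * X d * q ^ 2) (((hX s).mul (hX d)).mul (hq.pow 2)))
  have h1 := H i a b d (X s * q) ((hX s).mul hq)
  have e1 : X s * (X s * X d * q ^ 2) = X d * (X s * q) ^ 2 := by ring
  rw [e1] at h
  have := (Submodule.add_mem_iff_left _ h1).1 h
  convert this using 3 <;> ring

lemma red3c {N : Submodule (ZMod 2) (P 4)} (hN : Hd 4 67 ≤ N) (H : ∀ i d e c q, IsHomogeneous q 7 → br i d e (X c * q ^ 2) ∈ N) (i s b a d : Fin 4)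
    (hp : X s * X b * X a * X d = X4)
    {q : P 4} (hq : q.IsHomogeneous 6) : br i s b (X s * X a * X d * q ^ 2) ∈ N := by
  have hv : (X s * q ^ 2).IsHomogeneous 13 := (hX s).mul (hq.pow 2)
  have h0 := sq_mem (d := 32) 2 30 (h := X s * X b * X a * X d * (X s * q ^ 2) ^ 2)
    (((((hX s).mul (hX b)).mul (hX a)).mul (hX d)).mul (hv.pow 2)) (by norm_num) rfl
  have h := hN (XI_lift i h0)
  have e : XI i * (sq 2 (X s * X b * X a * X d * (X s * q ^ 2) ^ 2)) ^ 2 =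
      br i s b (X s * X a * X d * q ^ 2) + br i s a (X s * X b * X d * q ^ 2) +
      br i s d (X s * X b * X a * q ^ 2) + br i b a (X d * (X s * q) ^ 2) +
      br i b d (X a * (X s * q) ^ 2) + br i a d (X b * (X s * q) ^ 2) +
      XI i * (X4 * ((X s * q) ^ 2) ^ 2) ^ 2 := by
    rw [← hp]
    simp only [sq2_mul, sq1_mul, sq1_X, sq2_X, sq1_sq, sq2_sq, br, ← mul_add, ← add_sq2]
    ring
  rw [e] at h
  have t1 := H i b a d (X s * q) ((hX s).mul hq)
  have t2 := H i b d a (X s * q) ((hX s).mul hq)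
  have t3 := H i a d b (X s * q) ((hX s).mul hq)
  have t4 := red2 hN (z := (X s * q) ^ 2) (((hX s).mul hq).pow 2) i
    (fun i a b c => H i b c a (X s * q) ((hX s).mul hq))
  have h := (Submodule.add_mem_iff_left _ t4).1 h
  have h := (Submodule.add_mem_iff_left _ t3).1 h
  have h := (Submodule.add_mem_iff_left _ t2).1 h
  have h := (Submodule.add_mem_iff_left _ t1).1 h
  have u := red3b hN H i b a s d hq
  have u' := red3b hN H i b d s a hq
  have h' := Submodule.add_mem _ (Submodule.add_mem _ h u) u'
  have two : ∀ f : P 4, f + f = 0 := two_eq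
  have e2 : br i s b (X s * X a * X d * q ^ 2) + br i s a (X s * X b * X d * q ^ 2) +
      br i s d (X s * X b * X a * q ^ 2) +
      (br i a s (X b * (X s * X d) * q ^ 2) + br i b s (X a * (X s * X d) * q ^ 2)) +
      (br i d s (X b * (X s * X a) * q ^ 2) + br i b s (X d * (X s * X a) * q ^ 2)) =
      br i s b (X s * X a * X d * q ^ 2) +
      2 * (br i s b (X s * X a * X d * q ^ 2) + br i s a (X s * X b * X d * q ^ 2) +
      br i s d (X s * X b * X a * q ^ 2)) := by
    simp only [br]; ring
  rw [e2, two_mul, two, add_zero] at h'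
  exact h'


lemma XI_third : ∀ d e k : Fin 4, d ≠ e → k ≠ d → k ≠ e → ∃ a, XI k = X a * (X d * X e) := by
  intro d e k h1 h2 h3
  fin_cases d <;> fin_cases e <;> (try exact absurd rfl h1) <;> fin_cases k <;>
    (try exact absurd rfl h2) <;> (try exact absurd rfl h3) <;>
    simp only [Fin.zero_eta, Fin.mk_one, Fin.reduceFinMk, ← XIe0, ← XIe1, ← XIe2, ← XIe3] <;> first
    | exact ⟨0, by ring1⟩
    | exact ⟨1, by ring1⟩
    | exact ⟨2, by ring1⟩
    | exact ⟨3, by ring1⟩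

lemma red3 {N : Submodule (ZMod 2) (P 4)} (hN : Hd 4 67 ≤ N)
    (H : ∀ i d e c q, IsHomogeneous q 7 → br i d e (X c * q ^ 2) ∈ N) (i d e k : Fin 4)
    {q : P 4} (hq : q.IsHomogeneous 6) : br i d e (XI k * q ^ 2) ∈ N := by
  have key : ∀ d e : Fin 4, d ≠ e → br i d e (XI d * q ^ 2) ∈ N := by
    intro d e h
    obtain ⟨b, c, h1, -, h3⟩ := XI_split e d (Ne.symm h)
    have := red3c hN H i e d b c h3.symm hq
    rw [br_comm, h1]
    convert this using 2
    ring
  by_cases hde : d = e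
  · subst hde
    have : br i d d (XI k * q ^ 2) = XI i * ((X d * (XI k * q ^ 2)) ^ 2) ^ 2 := by
      simp only [br]; ring
    rw [this]
    exact hN (XI_lift i (low2 ((hX d).mul ((XI_hom k).mul (hq.pow 2)))))
  by_cases hkd : k = d
  · subst hkd
    exact key k e hde
  by_cases hke : k = e
  · subst hke
    rw [br_comm]
    exact key k d (Ne.symm hde)
  obtain ⟨a, h⟩ := XI_third d e k hde hkd hke
  rw [h]
  exact red3a hN H i a d e hq

lemma pair15 {N : Submodule (ZMod 2) (P 4)} (hN : Hd 4 67 ≤ N) (i d e : Fin 4) {A B : P 4} (f : P 4)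
    (hf : f.IsHomogeneous 14) (hs : sq 1 f = A + B) (hA : br i d e A ∈ N) : br i d e B ∈ N := by
  have h := hN (br_hit i d e (sq_mem (d := 15) 1 14 hf le_rfl rfl))
  rw [hs, br_add] at h
  exact (Submodule.add_mem_iff_right _ hA).1 h

lemma pair7 {N : Submodule (ZMod 2) (P 4)} (hN : Hd 4 67 ≤ N) (i d e c : Fin 4) {A B : P 4} (f : P 4)
    (hf : f.IsHomogeneous 6) (hs : sq 1 f = A + B) (hA : br i d e (X c * A ^ 2) ∈ N) :
    br i d e (X c * B ^ 2) ∈ N := by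
  have h := hN (br_hit7 i d e c (sq_mem (d := 7) 1 6 hf le_rfl rfl))
  rw [hs, add_sq2, mul_add, br_add] at h
  exact (Submodule.add_mem_iff_right _ hA).1 h

lemma ex_sq (c e : Fin 4) (g : P 4) :
    sq 1 (X c * X e * g ^ 2) = X e * (X c * g) ^ 2 + X c * (X e * g) ^ 2 := by
  simp only [sq1_mul, sq1_X, sq1_sq]; ring

lemma cube_sq (c f g : Fin 4) (t : P 4) :
    sq 1 (X c * X c ^ 2 * X f * (X g * t ^ 2) ^ 2) =
      X f * (X g * (X c * t) ^ 2) ^ 2 + X c * (X c * (X f * X g) * t ^ 2) ^ 2 := by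
  simp only [sq1_mul, sq1_X, sq1_sq]; ring

lemma XI_ex (a k : Fin 4) (h : a ≠ k) (t : P 4) : ∃ b c, sq 1 (X k * X a * (X b * X c * t ^ 2) ^ 2) =
    X a * (XI a * t ^ 2) ^ 2 + X k * (XI k * t ^ 2) ^ 2 := by
  obtain ⟨b, c, h1, h2, -⟩ := XI_split a k h
  refine ⟨b, c, ?_⟩
  rw [ex_sq, h1, h2]; ring

lemma red4 {N : Submodule (ZMod 2) (P 4)} (hN : Hd 4 67 ≤ N)
    (H : ∀ i d e c c' t, IsHomogeneous t 3 → br i d e (X c * (X c' * t ^ 2) ^ 2) ∈ N)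
    (i d e c k : Fin 4) {t : P 4} (ht : t.IsHomogeneous 2) :
    br i d e (X c * (XI k * t ^ 2) ^ 2) ∈ N := by
  have key : ∀ d e c k : Fin 4, c ≠ k → br i d e (X c * (XI k * t ^ 2) ^ 2) ∈ N := by
    intro d e c k h
    obtain ⟨f, g, h1, -, -⟩ := XI_split c k h
    rw [h1]
    exact pair15 hN i d e _ (((((hX c).mul ((hX c).pow 2)).mul (hX f)).mul
      (((hX g).mul (ht.pow 2)).pow 2))) (cube_sq c f g t) (H i d e f g _ ((hX c).mul ht))
  by_cases hck : c = k
  swap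
  · exact key d e c k hck
  subst hck
  obtain ⟨a, had, hae⟩ : ∃ a : Fin 4, d ≠ a ∧ e ≠ a := by revert d e; decide
  have h0 : br i d e (X a * (XI a * t ^ 2) ^ 2) ∈ N := by
    have h := hN (relB i a d e (w := (XI a * t ^ 2) ^ 2) (((XI_hom a).mul (ht.pow 2)).pow 2))
    rw [add_assoc] at h
    exact (Submodule.add_mem_iff_left _ (Submodule.add_mem _ (key a e d a had) (key a d e a hae))).1 h
  by_cases hac : a = c
  · subst hac; exact h0
  obtain ⟨f, g, h⟩ := XI_ex a c hac t
  exact pair15 hN i d e _ (((hX c).mul (hX a)).mul ((((hX f).mul (hX g)).mul (ht.pow 2)).pow 2)) h h0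

lemma red5 {N : Submodule (ZMod 2) (P 4)} (hN : Hd 4 67 ≤ N)
    (H : ∀ i d e c c' x t, IsHomogeneous t 1 → br i d e (X c * (X c' * (X x * t ^ 2) ^ 2) ^ 2) ∈ N)
    (i d e c x k : Fin 4) {t : P 4} (ht : t.IsHomogeneous 0) :
    br i d e (X c * (X x * (XI k * t ^ 2) ^ 2) ^ 2) ∈ N := by
  have key : ∀ c x k : Fin 4, x ≠ k → br i d e (X c * (X x * (XI k * t ^ 2) ^ 2) ^ 2) ∈ N := by
    intro c x k h
    obtain ⟨f, g, h1, -, -⟩ := XI_split x k h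
    rw [h1]
    exact pair7 hN i d e c _ (((((hX x).mul ((hX x).pow 2)).mul (hX f)).mul
      (((hX g).mul (ht.pow 2)).pow 2))) (cube_sq x f g t) (H i d e c f g _ ((hX x).mul ht))
  have key2 : ∀ c k : Fin 4, c ≠ k → br i d e (X c * (X k * (XI k * t ^ 2) ^ 2) ^ 2) ∈ N := by
    intro c k h
    exact pair15 hN i d e _ (((hX c).mul (hX k)).mul ((((XI_hom k).mul (ht.pow 2)).pow 2).pow 2))
      (ex_sq c k _) (key k c k h)
  by_cases hxk : x = k
  swap
  · exact key c x k hxk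
  subst hxk
  by_cases hcx : c = x
  swap
  · exact key2 c x hcx
  subst hcx
  obtain ⟨a, hac⟩ : ∃ a : Fin 4, a ≠ c := by revert c; decide
  obtain ⟨f, g, h⟩ := XI_ex a c hac t
  exact pair7 hN i d e c _ (((hX c).mul (hX a)).mul ((((hX f).mul (hX g)).mul (ht.pow 2)).pow 2)) h
    (key2 c a hac.symm)

def wd (c1 c2 c3 c4 : Fin 4) : P 4 := X c1 * (X c2 * (X c3 * (X c4) ^ 2) ^ 2) ^ 2

lemma all_mem {N : Submodule (ZMod 2) (P 4)} (hN : Hd 4 67 ≤ N)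
    (H : ∀ i d e c1 c2 c3 c4, br i d e (wd c1 c2 c3 c4) ∈ N) :
    ∀ f : P 4, f.IsHomogeneous 67 → f ∈ N := by
  have H4 : ∀ i d e c c' x t, IsHomogeneous t 1 →
      br i d e (X c * (X c' * (X x * t ^ 2) ^ 2) ^ 2) ∈ N := by
    intro i d e c c' x t ht
    revert t
    apply hom_ind
    · simp [br_zero]
    · intro f g hf hg
      simp only [add_sq2, mul_add, br_add] at *
      exact Submodule.add_mem _ hf hg
    · intro a ha
      obtain ⟨j, rfl⟩ : ∃ j, a = Finsupp.single j 1 := by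
        rw [Finsupp.degree_eq_sum, Fin.sum_univ_four] at ha
        have : a 0 = 1 ∧ a 1 = 0 ∧ a 2 = 0 ∧ a 3 = 0 ∨ a 0 = 0 ∧ a 1 = 1 ∧ a 2 = 0 ∧ a 3 = 0 ∨
          a 0 = 0 ∧ a 1 = 0 ∧ a 2 = 1 ∧ a 3 = 0 ∨ a 0 = 0 ∧ a 1 = 0 ∧ a 2 = 0 ∧ a 3 = 1 := by omega
        rcases this with h | h | h | h
        · exact ⟨0, by ext j; fin_cases j <;> simp [h]⟩
        · exact ⟨1, by ext j; fin_cases j <;> simp [h]⟩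
        · exact ⟨2, by ext j; fin_cases j <;> simp [h]⟩
        · exact ⟨3, by ext j; fin_cases j <;> simp [h]⟩
      exact H i d e c c' x j
  have H3 : ∀ i d e c c' t, IsHomogeneous t 3 → br i d e (X c * (X c' * t ^ 2) ^ 2) ∈ N := by
    intro i d e c c'
    refine dec_odd 3 rfl (p := fun t => br i d e (X c * (X c' * t ^ 2) ^ 2) ∈ N) ?_ ?_ ?_ ?_
    · simp [br_zero]
    · intro f g hf hg
      simp only [add_sq2, mul_add, br_add] at *
      exact Submodule.add_mem _ hf hg
    · intro m x q hm hq
      obtain rfl : m = 1 := by omega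
      exact H4 i d e c c' x q hq
    · intro m k q hm hq
      obtain rfl : m = 0 := by omega
      exact red5 hN H4 i d e c c' k hq
  have H2 : ∀ i d e c q, IsHomogeneous q 7 → br i d e (X c * q ^ 2) ∈ N := by
    intro i d e c
    refine dec_odd 7 rfl (p := fun t => br i d e (X c * t ^ 2) ∈ N) ?_ ?_ ?_ ?_
    · simp [br_zero]
    · intro f g hf hg
      simp only [add_sq2, mul_add, br_add] at *
      exact Submodule.add_mem _ hf hg
    · intro m x q hm hq
      obtain rfl : m = 3 := by omega
      exact H3 i d e c x q hq
    · intro m k q hm hq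
      obtain rfl : m = 2 := by omega
      exact red4 hN H3 i d e c k hq
  have H1 : ∀ i d e z, IsHomogeneous z 15 → br i d e z ∈ N := by
    intro i d e
    refine dec_odd 15 rfl (p := fun t => br i d e t ∈ N) ?_ ?_ ?_ ?_
    · simp [br_zero]
    · intro f g hf hg
      simp only [br_add]
      exact Submodule.add_mem _ hf hg
    · intro m x q hm hq
      obtain rfl : m = 7 := by omega
      exact H2 i d e x q hq
    · intro m k q hm hq
      obtain rfl : m = 6 := by omega
      exact red3 hN H2 i d e k hq
  have H0 : ∀ i y, IsHomogeneous y 32 → XI i * y ^ 2 ∈ N := by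
    intro i
    refine dec_even 32 rfl (p := fun t => XI i * t ^ 2 ∈ N) ?_ ?_ ?_ ?_ ?_
    · simp
    · intro f g hf hg
      simp only [add_sq2, mul_add]
      exact Submodule.add_mem _ hf hg
    · intro m q hm hq
      obtain rfl : m = 16 := by omega
      exact hN (XI_lift i (low2 hq))
    · intro m a b q hm hq
      obtain rfl : m = 15 := by omega
      exact H1 i a b q hq
    · intro m q hm hq
      obtain rfl : m = 14 := by omega
      exact red2 hN hq i (fun i a b c => H1 i b c _ ((hX a).mul hq))
  refine dec_odd 67 rfl (p := fun t => t ∈ N) ?_ ?_ ?_ ?_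
  · simp
  · intro f g hf hg
    exact Submodule.add_mem _ hf hg
  · intro m c q hm hq
    obtain rfl : m = 33 := by omega
    exact hN (low1 c hq)
  · intro m k q hm hq
    obtain rfl : m = 32 := by omega
    exact H0 k q hq

abbrev W := Fin 4 × Fin 4 × Fin 4 × Fin 4

def wdW (w : W) : P 4 := wd w.1 w.2.1 w.2.2.1 w.2.2.2

def Wq (w w' : W) : Prop := ∀ i d e, br i d e (wdW w) + br i d e (wdW w') ∈ Hd 4 67

lemma Wq.refl (w : W) : Wq w w := fun i d e => by rw [two_eq]; exact Submodule.zero_mem _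

lemma Wq.trans {a b c : W} (h : Wq a b) (h' : Wq b c) : Wq a c := fun i d e => by
  have := Submodule.add_mem _ (h i d e) (h' i d e)
  have e1 : br i d e (wdW a) + br i d e (wdW b) + (br i d e (wdW b) + br i d e (wdW c)) =
    br i d e (wdW a) + br i d e (wdW c) + (br i d e (wdW b) + br i d e (wdW b)) := by ring
  rwa [e1, two_eq, add_zero] at this

lemma wq15 {w w' : W} (f : P 4) (hf : f.IsHomogeneous 14) (hs : sq 1 f = wdW w + wdW w') :
    Wq w w' := fun i d e => by
  have h := br_hit i d e (sq_mem (d := 15) 1 14 hf le_rfl rfl)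
  rwa [hs, br_add] at h

lemma wq7 (c a1 a2 a3 b1 b2 b3 : Fin 4) (f : P 4) (hf : f.IsHomogeneous 6)
    (hs : sq 1 f = X a1 * (X a2 * (X a3) ^ 2) ^ 2 + X b1 * (X b2 * (X b3) ^ 2) ^ 2) :
    Wq (c, a1, a2, a3) (c, b1, b2, b3) := fun i d e => by
  have h := br_hit7 i d e c (sq_mem (d := 7) 1 6 hf le_rfl rfl)
  rwa [hs, add_sq2, mul_add, br_add] at h

def s1 (w : W) : W := if w.2.1 < w.1 then (w.2.1, w.1, w.2.2) else w
def s2 (w : W) : W := if w.2.2.1 < w.2.1 then (w.1, w.2.2.1, w.2.1, w.2.2.2) else w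
def s3 (w : W) : W := if w.2.2.2 < w.2.2.1 then (w.1, w.2.1, w.2.2.2, w.2.2.1) else w
def g1 (w : W) : W := if w.1 = w.2.1 ∧ w.1 ≠ w.2.2.1 then (w.2.2.1, w.2.2.1, w.1, w.2.2.2) else w
def g2 (w : W) : W := if w.2.1 = w.2.2.1 ∧ w.2.1 ≠ w.2.2.2 then (w.1, w.2.2.2, w.2.2.2, w.2.1) else w

lemma s1_q (w : W) : Wq w (s1 w) := by
  obtain ⟨a, b, c, d⟩ := w
  unfold s1
  split_ifs
  · refine wq15 (X a * X b * ((X c * (X d) ^ 2) ^ 2) ^ 2)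
      (((hX a).mul (hX b)).mul ((((hX c).mul ((hX d).pow 2)).pow 2).pow 2)) ?_
    rw [ex_sq, add_comm]; rfl
  · exact Wq.refl _

lemma s2_q (w : W) : Wq w (s2 w) := by
  obtain ⟨a, b, c, d⟩ := w
  unfold s2
  split_ifs
  · refine wq7 _ _ _ _ _ _ _ (X b * X c * ((X d) ^ 2) ^ 2)
      (((hX b).mul (hX c)).mul (((hX d).pow 2).pow 2)) ?_
    rw [ex_sq, add_comm]
  · exact Wq.refl _

lemma s3_q (w : W) : Wq w (s3 w) := by
  obtain ⟨a, b, c, d⟩ := w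
  unfold s3
  split_ifs
  · intro i x y
    have h := br_hit3 i x y a b (sq_mem (d := 3) 1 2 ((hX c).mul (hX d)) le_rfl rfl)
    have e : sq 1 (X c * X d : P 4) = X c * X d ^ 2 + X d * X c ^ 2 := by
      simp only [sq1_mul, sq1_X]; ring
    rwa [e, add_sq2, mul_add, add_sq2, mul_add, br_add] at h
  · exact Wq.refl _

lemma g1_q (w : W) : Wq w (g1 w) := by
  obtain ⟨a, b, c, d⟩ := w
  unfold g1
  split_ifs with h
  · obtain ⟨h1, -⟩ := h
    obtain rfl : a = b := h1
    refine wq15 (X a * X a ^ 2 * (X c * X c ^ 2) * (((X d) ^ 2) ^ 2) ^ 2)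
      ((((hX a).mul ((hX a).pow 2)).mul ((hX c).mul ((hX c).pow 2))).mul
        ((((hX d).pow 2).pow 2).pow 2)) ?_
    simp only [sq1_mul, sq1_X, sq1_sq, wdW, wd]; ring
  · exact Wq.refl _

lemma g2_q (w : W) : Wq w (g2 w) := by
  obtain ⟨x, a, b, c⟩ := w
  unfold g2
  split_ifs with h
  · obtain ⟨h1, -⟩ := h
    obtain rfl : a = b := h1
    refine wq7 _ _ _ _ _ _ _ (X a * X a ^ 2 * (X c * X c ^ 2))
      (((hX a).mul ((hX a).pow 2)).mul ((hX c).mul ((hX c).pow 2))) ?_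
    simp only [sq1_mul, sq1_X, sq1_sq]; ring
  · exact Wq.refl _

def srt (w : W) : W := s1 (s2 (s1 (s3 (s2 (s1 w)))))

lemma srt_q (w : W) : Wq w (srt w) :=
  ((((((s1_q _).trans (s2_q _)).trans (s3_q _)).trans (s1_q _)).trans (s2_q _)).trans (s1_q _))

def nrm (w : W) : W := srt (g2 (srt (g1 (srt (g2 (srt w))))))

lemma nrm_q (w : W) : Wq w (nrm w) :=
  ((((((srt_q _).trans (g2_q _)).trans (srt_q _)).trans (g1_q _)).trans (srt_q _)).trans
    (g2_q _)).trans (srt_q _)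

def msk (w : W) : ℕ := 2 ^ w.1.val ||| 2 ^ w.2.1.val ||| 2 ^ w.2.2.1.val ||| 2 ^ w.2.2.2.val

def rep (m : ℕ) : W :=
  match m with
  | 1 => (0, 0, 0, 0) | 2 => (1, 1, 1, 1) | 3 => (0, 1, 1, 1) | 4 => (2, 2, 2, 2)
  | 5 => (0, 2, 2, 2) | 6 => (1, 2, 2, 2) | 7 => (0, 1, 2, 2) | 8 => (3, 3, 3, 3)
  | 9 => (0, 3, 3, 3) | 10 => (1, 3, 3, 3) | 11 => (0, 1, 3, 3) | 12 => (2, 3, 3, 3)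
  | 13 => (0, 2, 3, 3) | 14 => (1, 2, 3, 3) | _ => (0, 1, 2, 3)

lemma nrm_rep : ∀ w : W, nrm w = rep (msk w) := by decide +kernel

lemma rep_q (w : W) : Wq w (rep (msk w)) := nrm_rep w ▸ nrm_q w

def prr (m : ℕ) : Fin 4 × Fin 4 :=
  match m with
  | 3 => (0, 1) | 5 => (0, 2) | 6 => (1, 2) | 9 => (0, 3) | 10 => (1, 3) | _ => (2, 3)

def dI (k : ℕ) : Fin 4 := Fin.ofNat 4 (k / 256)

def semN (k : ℕ) : P 4 :=
  br (dI k) (prr (k / 16 % 16)).1 (prr (k / 16 % 16)).2 (wdW (rep (k % 16)))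

def ix (i d e : Fin 4) (m : ℕ) : ℕ := i.val * 256 + (2 ^ d.val ||| 2 ^ e.val) * 16 + m

lemma ix_dec : ∀ (i d e : Fin 4) (s : Fin 16), d ≠ e → dI (ix i d e s) = i ∧ ix i d e s % 16 = s ∧
    (prr (ix i d e s / 16 % 16) = (d, e) ∨ prr (ix i d e s / 16 % 16) = (e, d)) := by decide +kernel

lemma sem_ix (i d e : Fin 4) (s : ℕ) (hs : s < 16) (h : d ≠ e) :
    semN (ix i d e s) = br i d e (wdW (rep s)) := by
  obtain ⟨h1, h2, h3⟩ := ix_dec i d e ⟨s, hs⟩ h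
  simp only at h1 h2 h3
  rw [semN, h1, h2]
  rcases h3 with h3 | h3 <;> rw [h3]
  exact br_comm _ _ _ _

def oth : Fin 4 → Fin 4 × Fin 4 × Fin 4 := ![(1, 2, 3), (0, 2, 3), (0, 1, 3), (0, 1, 2)]

def relsA : List (ℕ × ℕ × ℕ) :=
  (List.finRange 4).flatMap fun a => (List.range' 1 15).map fun s =>
    (ix (oth a).1 (oth a).1 a s, ix (oth a).2.1 (oth a).2.1 a s, ix (oth a).2.2 (oth a).2.2 a s)

def relsB : List (ℕ × ℕ × ℕ) :=
  (List.finRange 4).flatMap fun i => (List.finRange 4).flatMap fun t => (List.range' 1 14).map fun u =>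
    (ix i (oth t).2.1 (oth t).2.2 (u ||| 2 ^ (oth t).1.val),
     ix i (oth t).1 (oth t).2.2 (u ||| 2 ^ (oth t).2.1.val),
     ix i (oth t).1 (oth t).2.1 (u ||| 2 ^ (oth t).2.2.val))

def RelOK (r : ℕ × ℕ × ℕ) : Prop := semN r.1 + semN r.2.1 + semN r.2.2 ∈ Hd 4 67

lemma wdW_hom (w : W) : (wdW w).IsHomogeneous 15 :=
  (hX _).mul (((hX _).mul (((hX _).mul ((hX _).pow 2)).pow 2)).pow 2)

lemma relsA_ok : ∀ r ∈ relsA, RelOK r := by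
  intro r hr
  simp only [relsA, List.mem_flatMap, List.mem_map, List.mem_range'_1] at hr
  obtain ⟨a, -, s, ⟨-, hs⟩, rfl⟩ := hr
  have h := relA a (wdW_hom (rep s))
  have ho : ∀ a : Fin 4, (oth a).1 ≠ a ∧ (oth a).2.1 ≠ a ∧ (oth a).2.2 ≠ a := by decide
  obtain ⟨h1, h2, h3⟩ := ho a
  unfold RelOK
  rw [sem_ix _ _ _ _ hs h1, sem_ix _ _ _ _ hs h2, sem_ix _ _ _ _ hs h3]
  convert h using 1
  have e : ∀ a : Fin 4, Finset.univ.erase a = {(oth a).1, (oth a).2.1, (oth a).2.2} := by decide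
  have e' : ∀ a : Fin 4, (oth a).1 ∉ ({(oth a).2.1, (oth a).2.2} : Finset (Fin 4)) ∧
    (oth a).2.1 ∉ ({(oth a).2.2} : Finset (Fin 4)) := by decide
  rw [e, Finset.sum_insert (e' a).1, Finset.sum_insert (e' a).2, Finset.sum_singleton, add_assoc]

lemma relB_word (i b c a x y z : Fin 4) (u : ℕ) (hu : msk (a, x, y, z) = u) (hb : b ≠ c) (h16 : u < 16) :
    semN (ix i b c u) + br i b c (X a * (X x * (X y * X z ^ 2) ^ 2) ^ 2) ∈ Hd 4 67 := by
  rw [sem_ix _ _ _ _ h16 hb, add_comm, ← hu]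
  exact rep_q (a, x, y, z) i b c

lemma relsB_ok : ∀ r ∈ relsB, RelOK r := by
  intro r hr
  simp only [relsB, List.mem_flatMap, List.mem_map, List.mem_range'_1] at hr
  obtain ⟨i, -, t, -, u, ⟨hu0, hu⟩, rfl⟩ := hr
  have ho : ∀ a : Fin 4, (oth a).2.1 ≠ (oth a).2.2 ∧ (oth a).1 ≠ (oth a).2.2 ∧ (oth a).1 ≠ (oth a).2.1 := by
    decide
  obtain ⟨h1, h2, h3⟩ := ho t
  obtain ⟨x, y, z, hm, hlt⟩ : ∃ x y z : Fin 4, (∀ a, msk (a, x, y, z) = u ||| 2 ^ a.val) ∧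
      (∀ a : Fin 4, u ||| 2 ^ a.val < 16) := by
    clear h1 h2 h3 ho t i
    have : ∀ u : Fin 15, u ≠ 0 → ∃ x y z : Fin 4, (∀ a, msk (a, x, y, z) = u.val ||| 2 ^ a.val) ∧
      (∀ a : Fin 4, u.val ||| 2 ^ a.val < 16) := by decide +kernel
    exact this ⟨u, hu⟩ (by intro h; simp [Fin.ext_iff] at h; omega)
  have hw : ((X x * (X y * X z ^ 2) ^ 2 : P 4) ^ 2).IsHomogeneous 14 :=
    ((hX _).mul (((hX _).mul ((hX _).pow 2)).pow 2)).pow 2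
  have hB := relB i (oth t).1 (oth t).2.1 (oth t).2.2 hw
  have k1 := relB_word i _ _ _ x y z _ (hm (oth t).1) h1 (hlt _)
  have k2 := relB_word i _ _ _ x y z _ (hm (oth t).2.1) h2 (hlt _)
  have k3 := relB_word i _ _ _ x y z _ (hm (oth t).2.2) h3 (hlt _)
  have := Submodule.add_mem _ hB (Submodule.add_mem _ (Submodule.add_mem _ k1 k2) k3)
  have gen : ∀ a b c x y z : P 4, x + y + z + (a + x + (b + y) + (c + z)) = a + b + c := by
    intro a b c x y z
    have : x + y + z + (a + x + (b + y) + (c + z)) = a + b + c + ((x + x) + (y + y) + (z + z)) := by ring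
    rw [this, two_eq x, two_eq y, two_eq z]; simp
  rw [gen] at this
  exact this

def run : List (ℕ × ℕ × ℕ) → ℕ → ℕ
  | [], m => m
  | r :: rs, m =>
    match m.testBit r.1, m.testBit r.2.1, m.testBit r.2.2 with
    | true, true, false => run rs (m ||| 1 <<< r.2.2)
    | true, false, true => run rs (m ||| 1 <<< r.2.1)
    | false, true, true => run rs (m ||| 1 <<< r.1)
    | _, _, _ => run rs m

def Snd (N : Submodule (ZMod 2) (P 4)) (m : ℕ) : Prop := ∀ k, m.testBit k = true → semN k ∈ N

lemma Snd.set {N : Submodule (ZMod 2) (P 4)} {m k : ℕ} (h : Snd N m) (hk : semN k ∈ N) :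
    Snd N (m ||| 1 <<< k) := by
  intro j hj
  by_cases hjk : k = j
  · exact hjk ▸ hk
  · apply h
    simpa [Nat.testBit_or, Nat.shiftLeft_eq, Nat.testBit_two_pow, hjk] using hj

lemma run_snd {N : Submodule (ZMod 2) (P 4)} (hN : Hd 4 67 ≤ N) (l : List (ℕ × ℕ × ℕ)) :
    ∀ m, (∀ r ∈ l, RelOK r) → Snd N m → Snd N (run l m) := by
  induction l with
  | nil => intro m _ h; exact h
  | cons r rs ih =>
    intro m hl h
    have hr := hN (hl r List.mem_cons_self)
    have hrs : ∀ r ∈ rs, RelOK r := fun r h => hl r (List.mem_cons_of_mem _ h)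
    rw [run]
    split
    · rename_i a b c
      refine ih _ hrs (h.set ?_)
      exact (Submodule.add_mem_iff_right _ (Submodule.add_mem _ (h _ a) (h _ b))).1 hr
    · rename_i a b c
      refine ih _ hrs (h.set ?_)
      rw [add_right_comm] at hr
      exact (Submodule.add_mem_iff_right _ (Submodule.add_mem _ (h _ a) (h _ c))).1 hr
    · rename_i a b c
      refine ih _ hrs (h.set ?_)
      rw [add_assoc] at hr
      exact (Submodule.add_mem_iff_left _ (Submodule.add_mem _ (h _ b) (h _ c))).1 hr
    · exact ih _ hrs h

def iter : ℕ → ℕ → ℕ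
  | 0, m => m
  | n + 1, m => run relsA (run relsB (iter n m))

lemma iter_snd {N : Submodule (ZMod 2) (P 4)} (hN : Hd 4 67 ≤ N) {m : ℕ} (h : Snd N m) :
    ∀ k, Snd N (iter k m)
  | 0 => h
  | k + 1 => run_snd hN _ _ relsA_ok (run_snd hN _ _ relsB_ok (iter_snd hN h k))

def L4 : List ℕ := [
  593, 913, 610, 930, 84, 356, 101, 309, 917, 99, 424, 712, 169, 193, 922, 426, 706, 708, 145,
   403, 915, 594, 598, 962, 339, 82, 86, 707, 165, 827, 313, 153, 427, 604, 876, 941, 972,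
   156, 428, 713, 601, 925, 429, 918, 346, 362, 458, 874, 963, 87, 359, 617, 621, 942, 974,
   863, 687, 63, 207, 975, 347, 363, 415, 367]

def L3 : List ℕ := [
  817, 849, 818, 866, 819, 850, 852, 868, 853, 820, 821, 870, 823, 855]

def LR : List ℕ := [
  98, 100, 102, 108, 162, 164, 166, 168, 170, 174, 194, 196, 200, 204, 337, 340, 341, 344,
   349, 401, 405, 408, 409, 413, 452, 456, 457, 460, 561, 562, 563, 657, 659, 664, 665, 666,
   673, 674, 675, 680, 681, 682]

def bits : List ℕ → ℕ
  | [] => 0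
  | k :: l => bits l ||| 1 <<< k

lemma bits_snd {N : Submodule (ZMod 2) (P 4)} (l : List ℕ) (h : ∀ k ∈ l, semN k ∈ N) : Snd N (bits l) := by
  induction l with
  | nil => intro k hk; simp [bits] at hk
  | cons a l ih =>
    exact (ih fun k hk => h k (List.mem_cons_of_mem _ hk)).set (h a List.mem_cons_self)

lemma final_mask : ∀ (i d e : Fin 4) (s : Fin 16), d ≠ e → s ≠ 0 →
    (iter 16 (bits (L4 ++ L3 ++ LR))).testBit (ix i d e s) = true := by decide +kernel

lemma msk_ok : ∀ w : W, msk w < 16 ∧ msk w ≠ 0 := by decide +kernel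

lemma span_all {N : Submodule (ZMod 2) (P 4)} (hN : Hd 4 67 ≤ N)
    (h : ∀ k ∈ L4 ++ L3 ++ LR, semN k ∈ N) : ∀ f : P 4, f.IsHomogeneous 67 → f ∈ N := by
  apply all_mem hN
  intro i d e c1 c2 c3 c4
  have hs := iter_snd hN (bits_snd _ h) 16
  by_cases hde : d = e
  · subst hde
    have : br i d d (wd c1 c2 c3 c4) = XI i * ((X d * wd c1 c2 c3 c4) ^ 2) ^ 2 := by
      simp only [br]; ring
    rw [this]
    exact hN (XI_lift i (low2 ((hX d).mul (wdW_hom (c1, c2, c3, c4)))))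
  · obtain ⟨hm, hm0⟩ := msk_ok (c1, c2, c3, c4)
    have h1 := hs _ (final_mask i d e ⟨_, hm⟩ hde (by intro h; exact hm0 (Fin.ext_iff.1 h)))
    rw [sem_ix _ _ _ _ hm hde] at h1
    have h2 := hN (rep_q (c1, c2, c3, c4) i d e)
    exact (Submodule.add_mem_iff_left _ h1).1 h2

def mm (f : Fin n → ℕ) : P n := ∏ j, X j ^ f j

lemma mm_eq (f : Fin n → ℕ) : mm f = mono (Finsupp.equivFunOnFinite.symm f) := by
  rw [mm, mono, monomial_eq, Finsupp.prod_fintype _ _ (by simp)]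
  simp

lemma mono_eq (a : Fin n →₀ ℕ) : mono a = mm a := by
  rw [mm_eq]; congr 1; ext j; simp

lemma mm_mul (f g : Fin n → ℕ) : mm f * mm g = mm (fun j => f j + g j) := by
  simp only [mm, ← Finset.prod_mul_distrib, pow_add]

lemma mm_sq (f : Fin n → ℕ) : mm f ^ 2 = mm (fun j => f j * 2) := by
  simp only [mm, ← Finset.prod_pow, pow_mul]

lemma mm_X (c : Fin n) : (X c : P n) = mm (fun j => if j = c then 1 else 0) := by
  simp [mm, pow_ite, Finset.prod_ite_eq']

lemma mm_XI (i : Fin 4) : XI i = mm (fun j => if j = i then 0 else 1) := by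
  fin_cases i <;> simp [mm, Fin.prod_univ_four, ← XIe0, ← XIe1, ← XIe2, ← XIe3]

def exW (w : W) (j : Fin 4) : ℕ :=
  (if j = w.1 then 1 else 0) + ((if j = w.2.1 then 1 else 0) + ((if j = w.2.2.1 then 1 else 0) +
    (if j = w.2.2.2 then 1 else 0) * 2) * 2) * 2

def exN (k : ℕ) (j : Fin 4) : ℕ :=
  (if j = dI k then 0 else 1) + ((if j = (prr (k / 16 % 16)).1 then 1 else 0) +
    (if j = (prr (k / 16 % 16)).2 then 1 else 0) + exW (rep (k % 16)) j * 2) * 2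

lemma sem_mm (k : ℕ) : semN k = mm (exN k) := by
  simp only [semN, br, wdW, wd, mm_XI, mm_X, mm_mul, mm_sq]
  rfl

lemma Hd_nat {m d : ℕ} (α : P n →ₐ[ZMod 2] P m)
    (hα : ∀ j, St m (α (X j)) = Polynomial.C (α (X j)) + Polynomial.X * Polynomial.C (α (X j) ^ 2))
    (hh : ∀ j, (α (X j)).IsHomogeneous 1) {u : P n} (hu : u ∈ Hd n d) : α u ∈ Hd m d := by
  have hom : ∀ e (f : P n), f.IsHomogeneous e → (α f).IsHomogeneous e := by
    intro e
    apply hom_ind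
    · rw [map_zero]; exact isHomogeneous_zero _ _ _
    · intro f g hf hg; rw [map_add]; exact hf.add hg
    · intro a ha
      have : (monomial a (1 : ZMod 2) : P n) = mm a := mono_eq a
      rw [this, mm, map_prod, ← ha, Finsupp.degree_eq_sum]
      apply IsHomogeneous.prod
      intro j _
      rw [map_pow]
      simpa using (hh j).pow (a j)
  unfold Hd at hu
  induction hu using Submodule.span_induction with
  | mem x hx =>
    obtain ⟨k, h, e, hk, he, hd, rfl⟩ := hx
    rw [← sq_nat α hα]
    exact sq_mem k e (hom _ _ hd) hk he
  | zero => rw [map_zero]; exact Submodule.zero_mem _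
  | add x y _ _ hx hy => rw [map_add]; exact Submodule.add_mem _ hx hy
  | smul c x _ hx => rw [map_smul]; exact Submodule.smul_mem _ _ hx

def kil (i : Fin n) : P n →ₐ[ZMod 2] P n := aeval fun j => if j = i then 0 else X j

lemma kil_Hd (i : Fin n) {d : ℕ} {u : P n} (hu : u ∈ Hd n d) : kil i u ∈ Hd n d := by
  apply Hd_nat _ _ _ hu
  · intro j
    simp only [kil, aeval_X]
    split_ifs
    · simp
    · exact St_X j
  · intro j
    simp only [kil, aeval_X]
    split_ifs
    · exact isHomogeneous_zero _ _ _
    · exact hX j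

lemma kil_mm (i : Fin n) (f : Fin n → ℕ) : kil i (mm f) = if f i = 0 then mm f else 0 := by
  simp only [mm, map_prod, map_pow, kil, aeval_X]
  split_ifs with h
  · apply Finset.prod_congr rfl
    intro j _
    by_cases hj : j = i
    · subst hj; simp [h]
    · simp [hj]
  · apply Finset.prod_eq_zero (Finset.mem_univ i)
    simp [h]

lemma pos_step (d : ℕ) (S : Set (Fin n → ℕ)) (i : Fin n) (f : Fin n → ℕ) (hf : f i ≠ 0)
    (h : mm f ∈ Hd n d ⊔ Submodule.span (ZMod 2) (mm '' S)) :
    mm f ∈ Hd n d ⊔ Submodule.span (ZMod 2) (mm '' {s | s ∈ S ∧ s i ≠ 0}) := by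
  obtain ⟨u, hu, v, hv, huv⟩ := Submodule.mem_sup.1 h
  have key : ∀ v ∈ Submodule.span (ZMod 2) (mm '' S), v + kil i v ∈
      Submodule.span (ZMod 2) (mm '' {s | s ∈ S ∧ s i ≠ 0}) := by
    intro v hv
    induction hv using Submodule.span_induction with
    | mem x hx =>
      obtain ⟨s, hs, rfl⟩ := hx
      rw [kil_mm]
      split_ifs with hsi
      · rw [two_eq]; exact Submodule.zero_mem _
      · rw [add_zero]; exact Submodule.subset_span ⟨s, ⟨hs, hsi⟩, rfl⟩
    | zero => simp
    | add x y _ _ hx hy =>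
      rw [map_add, add_add_add_comm]; exact Submodule.add_mem _ hx hy
    | smul c x _ hx => rw [map_smul, ← smul_add]; exact Submodule.smul_mem _ _ hx
  have e : mm f = (u + kil i u) + (v + kil i v) := by
    have : kil i (mm f) = 0 := by rw [kil_mm, if_neg hf]
    rw [add_add_add_comm, ← map_add, huv, this, add_zero]
  rw [e]
  exact Submodule.add_mem_sup (Submodule.add_mem _ hu (kil_Hd i hu)) (key v hv)

lemma pos_all (d : ℕ) (S : Set (Fin n → ℕ)) (f : Fin n → ℕ) (hf : ∀ i, f i ≠ 0)
    (h : mm f ∈ Hd n d ⊔ Submodule.span (ZMod 2) (mm '' S)) :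
    mm f ∈ Hd n d ⊔ Submodule.span (ZMod 2) (mm '' {s | s ∈ S ∧ ∀ i, s i ≠ 0}) := by
  have : ∀ T : Finset (Fin n), mm f ∈ Hd n d ⊔ Submodule.span (ZMod 2)
      (mm '' {s | s ∈ S ∧ ∀ i ∈ T, s i ≠ 0}) := by
    intro T
    induction T using Finset.induction_on with
    | empty => simpa using h
    | insert a T _ ih =>
      have := pos_step d _ a f (hf a) ih
      convert this using 6
      simp only [Finset.mem_insert, forall_eq_or_imp, Set.mem_ofPred_eq]
      tauto
  simpa using this Finset.univ

lemma mm_hom (f : Fin n → ℕ) : (mm f).IsHomogeneous (∑ i, f i) := by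
  apply IsHomogeneous.prod
  intro j _
  simpa using (hX j).pow (f j)

lemma span_base (f : Fin 4 → ℕ) (hf : ∑ i, f i = 67) :
    mm f ∈ Hd 4 67 ⊔ Submodule.span (ZMod 2) (mm '' {s | ∃ k ∈ L4 ++ L3 ++ LR, s = exN k}) := by
  refine span_all le_sup_left ?_ _ (hf ▸ mm_hom f)
  intro k hk
  rw [sem_mm]
  exact Submodule.mem_sup_right (Submodule.subset_span ⟨_, ⟨k, hk, rfl⟩, rfl⟩)

lemma span4 (f : Fin 4 → ℕ) (hp : ∀ i, f i ≠ 0) (hf : ∑ i, f i = 67) :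
    mm f ∈ Hd 4 67 ⊔ Submodule.span (ZMod 2) (mm '' {s | ∃ k ∈ L4, s = exN k}) := by
  have h := pos_all _ _ f hp (span_base f hf)
  refine (sup_le_sup_left (Submodule.span_mono (Set.image_mono ?_)) (Hd _ 67)) h
  rintro s ⟨⟨k, hk, rfl⟩, hs⟩
  refine ⟨k, ?_, rfl⟩
  have : ∀ k ∈ L3 ++ LR, ∃ i, exN k i = 0 := by decide +kernel
  rw [List.append_assoc, List.mem_append] at hk
  rcases hk with hk | hk
  · exact hk
  · obtain ⟨i, hi⟩ := this k hk
    exact absurd hi (hs i)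

def rho : P 4 →ₐ[ZMod 2] P 3 := aeval (Fin.snoc (fun j => X j) 0 : Fin 4 → P 3)

def dn (f : Fin 4 → ℕ) : Fin 3 → ℕ := fun j => f j.castSucc

lemma rho_mm (f : Fin 4 → ℕ) : rho (mm f) = if f 3 = 0 then mm (dn f) else 0 := by
  simp only [mm, map_prod, map_pow, rho, aeval_X]
  rw [Fin.prod_univ_castSucc]
  simp only [Fin.snoc_castSucc, Fin.snoc_last, dn]
  split_ifs with h
  · have : f (Fin.last 3) = 0 := h
    rw [this, pow_zero, mul_one]
  · rw [zero_pow (show f (Fin.last 3) ≠ 0 from h), mul_zero]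

lemma rho_Hd {d : ℕ} {u : P 4} (hu : u ∈ Hd 4 d) : rho u ∈ Hd 3 d := by
  apply Hd_nat _ _ _ hu
  · intro j
    simp only [rho, aeval_X]
    refine Fin.lastCases ?_ (fun j => ?_) j
    · simp only [Fin.snoc_last]; simp
    · simp only [Fin.snoc_castSucc]; exact St_X j
  · intro j
    simp only [rho, aeval_X]
    refine Fin.lastCases ?_ (fun j => ?_) j
    · simp only [Fin.snoc_last]; exact isHomogeneous_zero _ _ _
    · simp only [Fin.snoc_castSucc]; exact hX j

lemma span3 (f : Fin 3 → ℕ) (hp : ∀ i, f i ≠ 0) (hf : ∑ i, f i = 67) :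
    mm f ∈ Hd 3 67 ⊔ Submodule.span (ZMod 2) (mm '' {s | ∃ k ∈ L3, s = dn (exN k)}) := by
  have h0 := span_base (Fin.snoc f 0) (by rw [Fin.sum_univ_castSucc, Fin.snoc_last]; simpa using hf)
  have e : rho (mm (Fin.snoc f 0 : Fin 4 → ℕ)) = mm f := by
    have h3 : (Fin.snoc f 0 : Fin 4 → ℕ) 3 = 0 := Fin.snoc_last (α := fun _ => ℕ) _ _
    rw [rho_mm, if_pos h3]
    congr 1
    ext j
    exact Fin.snoc_castSucc (α := fun _ => ℕ) _ _ _
  obtain ⟨u, hu, v, hv, huv⟩ := Submodule.mem_sup.1 h0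
  have h1 : mm f ∈ Hd 3 67 ⊔ Submodule.span (ZMod 2)
      (mm '' {s | ∃ k ∈ L4 ++ L3 ++ LR, exN k 3 = 0 ∧ s = dn (exN k)}) := by
    rw [← e, ← huv, map_add]
    refine Submodule.add_mem_sup (rho_Hd hu) ?_
    clear huv
    induction hv using Submodule.span_induction with
    | mem x hx =>
      obtain ⟨_, ⟨k, hk, rfl⟩, rfl⟩ := hx
      rw [rho_mm]
      split_ifs with hk3
      · exact Submodule.subset_span ⟨_, ⟨k, hk, hk3, rfl⟩, rfl⟩
      · exact Submodule.zero_mem _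
    | zero => simp
    | add x y _ _ hx hy => rw [map_add]; exact Submodule.add_mem _ hx hy
    | smul c x _ hx => rw [map_smul]; exact Submodule.smul_mem _ _ hx
  have h := pos_all _ _ f hp h1
  refine (sup_le_sup_left (Submodule.span_mono (Set.image_mono ?_)) (Hd _ 67)) h
  rintro s ⟨⟨k, hk, hk3, rfl⟩, hs⟩
  refine ⟨k, ?_, rfl⟩
  have : ∀ k ∈ L4 ++ LR, exN k 3 ≠ 0 ∨ ∃ i, dn (exN k) i = 0 := by decide +kernel
  by_contra hk'
  have hk2 : k ∈ L4 ++ LR := by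
    simp only [List.mem_append] at hk ⊢
    tauto
  rcases this k hk2 with h | ⟨i, hi⟩
  · exact h hk3
  · exact hs i hi

def e3 (A b c : ℕ) : Fin 3 →₀ ℕ := Finsupp.equivFunOnFinite.symm ![A, b, c]

def cf (A b c : ℕ) : P 3 →ₗ[ZMod 2] ZMod 2 := lcoeff (ZMod 2) (e3 A b c)

lemma cf_def (A b c : ℕ) (f : P 3) : cf A b c f = coeff (e3 A b c) f := rfl

lemma sq_pow (k a : ℕ) (j : Fin n) : sq k (X j ^ a : P n) = (a.choose k : P n) * X j ^ (a + k) := by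
  have : St n (X j ^ a) = Polynomial.C (X j ^ a) * (1 + Polynomial.X * Polynomial.C (X j)) ^ a := by
    rw [map_pow, St_X, Polynomial.C_pow, Polynomial.C_pow, ← mul_pow]
    congr 1
    ring
  rw [sq_def, this, Polynomial.coeff_C_mul]
  have h2 : (1 + Polynomial.X * Polynomial.C (X j) : PP n) ^ a =
      ((1 + Polynomial.X) ^ a).comp (Polynomial.C (X j) * Polynomial.X) := by
    simp only [Polynomial.pow_comp, Polynomial.add_comp, Polynomial.one_comp, Polynomial.X_comp]
    rw [mul_comm Polynomial.X]
  rw [h2, Polynomial.comp_C_mul_X_coeff, Polynomial.coeff_one_add_X_pow]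
  ring

lemma ch63 (c : ℕ) (hc : 0 < c) (h : c ≤ 63) : (63 - c).choose c % 2 = 0 := by
  have key : ∀ c < 64, 0 < c → ((63 - c).descFactorial c / c.factorial) % 2 = 0 := by
    decide +kernel
  rw [Nat.choose_eq_descFactorial_div_factorial]
  exact key c (by omega) hc

lemma ch3 (c : ℕ) (hc : 0 < c) (h : c ≤ 3) : (3 - c).choose c % 2 = 0 := by
  interval_cases c <;> decide

lemma ch1 (c : ℕ) (hc : 0 < c) (h : c ≤ 1) : (1 - c).choose c % 2 = 0 := by
  interval_cases c; decide

lemma cf_mm (A b c : ℕ) (f : Fin 3 → ℕ) : cf A b c (mm f) = if f 0 = A ∧ f 1 = b ∧ f 2 = c then 1 else 0 := by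
  rw [cf_def, mm_eq, mono, coeff_monomial]
  congr 1
  rw [eq_iff_iff, Finsupp.ext_iff]
  simp [Fin.forall_fin_succ, e3]

lemma cf_spike (k : ℕ) (hk : 1 ≤ k) (g : P 3) : cf 63 3 1 (sq k g) = 0 := by
  induction g using MvPolynomial.induction_on' with
  | add p q hp hq => rw [map_add, map_add, hp, hq, add_zero]
  | monomial a r =>
    have : (monomial a r : P 3) = r • (X 0 ^ a 0 * X 1 ^ a 1 * X 2 ^ a 2) := by
      rw [monomial_eq, Finsupp.prod_fintype _ _ (by simp), Fin.prod_univ_three, smul_eq_C_mul]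
    rw [this, map_smul, map_smul, sq_mul, map_sum]
    rw [Finset.sum_eq_zero, smul_zero]
    rintro ⟨i, j⟩ hij
    rw [Finset.HasAntidiagonal.mem_antidiagonal] at hij
    simp only at hij ⊢
    rw [sq_mul, Finset.sum_mul, map_sum]
    apply Finset.sum_eq_zero
    rintro ⟨i1, i2⟩ hi
    rw [Finset.HasAntidiagonal.mem_antidiagonal] at hi
    simp only at hi ⊢
    rw [sq_pow, sq_pow, sq_pow]
    have e : ((a 0).choose i1 : P 3) * X 0 ^ (a 0 + i1) * (((a 1).choose i2 : P 3) * X 1 ^ (a 1 + i2)) *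
        (((a 2).choose j : P 3) * X 2 ^ (a 2 + j)) =
        (((a 0).choose i1 * (a 1).choose i2 * (a 2).choose j : ℕ) : ZMod 2) •
          mm ![a 0 + i1, a 1 + i2, a 2 + j] := by
      rw [smul_eq_C_mul, mm, Fin.prod_univ_three]
      simp
      ring
    rw [e, map_smul, cf_mm]
    split_ifs with h
    · simp at h
      obtain ⟨h0, h1, h2⟩ := h
      have h0' : a 0 = 63 - i1 := by omega
      have h1' : a 1 = 3 - i2 := by omega
      have h2' : a 2 = 1 - j := by omega
      rw [h0', h1', h2', smul_eq_mul, mul_one, ZMod.natCast_eq_zero_iff, Nat.dvd_iff_mod_eq_zero]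
      by_cases c0 : 0 < i1
      · have := ch63 i1 c0 (by omega)
        simp [Nat.mul_mod, this]
      by_cases c1 : 0 < i2
      · have := ch3 i2 c1 (by omega)
        simp [Nat.mul_mod, this]
      · have := ch1 j (by omega) (by omega)
        simp [Nat.mul_mod, this]
    · simp

def lin (v w u : Bool) : P 3 := (bif v then X 0 else 0) + (bif w then X 1 else 0) + (bif u then X 2 else 0)

def fal (v w u : ℕ) : P n →ₐ[ZMod 2] P 3 :=
  aeval fun j => lin (v.testBit j) (w.testBit j) (u.testBit j)

def fun3 (v w u : ℕ) : P n →ₗ[ZMod 2] ZMod 2 := (cf 63 3 1).comp (fal v w u).toLinearMap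

lemma lin_St (v w u : Bool) : St 3 (lin v w u) = Polynomial.C (lin v w u) +
    Polynomial.X * Polynomial.C (lin v w u ^ 2) := by
  cases v <;> cases w <;> cases u <;> simp [lin, St_X, add_sq2] <;> ring

lemma fun3_Hd (v w u d : ℕ) {f : P n} (hf : f ∈ Hd n d) : fun3 v w u f = 0 := by
  unfold Hd at hf
  induction hf using Submodule.span_induction with
  | mem x hx =>
    obtain ⟨k, h, e, hk, he, hd, rfl⟩ := hx
    simp only [fun3, LinearMap.comp_apply, AlgHom.toLinearMap_apply]
    rw [← sq_nat]
    · exact cf_spike k hk _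
    · intro j
      simp only [fal, aeval_X]
      exact lin_St _ _ _
  | zero => simp
  | add x y _ _ hx hy => rw [map_add, hx, hy, add_zero]
  | smul c x _ hx => rw [map_smul, hx, smul_zero]

def bz (x : Bool) : ZMod 2 := bif x then 1 else 0

def Rp (D t : ℕ) (f : P 3) : Prop := ∀ b c, b < 4 → c < 2 →
  (∀ A, A + b + c = D → cf A b c f = bz (t.testBit (b + 4 * c))) ∧
  (D < b + c → t.testBit (b + 4 * c) = false)

lemma cf_X0 (A b c : ℕ) (f : P 3) : cf A b c (X 0 * f) = if A = 0 then 0 else cf (A - 1) b c f := by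
  rw [cf_def, coeff_X_mul']
  have : e3 A b c - Finsupp.single 0 1 = e3 (A - 1) b c := by
    ext j; fin_cases j <;> simp [e3]
  rw [this]
  simp [e3, cf_def]

lemma cf_X1 (A b c : ℕ) (f : P 3) : cf A b c (X 1 * f) = if b = 0 then 0 else cf A (b - 1) c f := by
  rw [cf_def, coeff_X_mul']
  have : e3 A b c - Finsupp.single 1 1 = e3 A (b - 1) c := by
    ext j; fin_cases j <;> simp [e3]
  rw [this]
  simp [e3, cf_def]

lemma cf_X2 (A b c : ℕ) (f : P 3) : cf A b c (X 2 * f) = if c = 0 then 0 else cf A b (c - 1) f := by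
  rw [cf_def, coeff_X_mul']
  have : e3 A b c - Finsupp.single 2 1 = e3 A b (c - 1) := by
    ext j; fin_cases j <;> simp [e3]
  rw [this]
  simp [e3, cf_def]

lemma Rp_zero (D : ℕ) : Rp D 0 0 := by
  intro b c _ _
  simp [bz]

lemma Rp_one : Rp 0 1 1 := by
  intro b c hb hc
  have h1 : (1 : P 3) = mm 0 := by simp [mm]
  constructor
  · intro A h
    have : A = 0 ∧ b = 0 ∧ c = 0 := by omega
    obtain ⟨rfl, rfl, rfl⟩ := this
    rw [h1, cf_mm]; simp [bz]
  · intro h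
    have : b + 4 * c ≠ 0 := by omega
    simp [Nat.testBit_one_eq_true_iff_self_eq_zero, ← Bool.not_eq_true]
    omega

lemma bz_xor (x y : Bool) : bz (x ^^ y) = bz x + bz y := by
  cases x <;> cases y <;> decide

lemma Rp.add {D t t' : ℕ} {f f' : P 3} (h : Rp D t f) (h' : Rp D t' f') : Rp D (t ^^^ t') (f + f') := by
  intro b c hb hc
  obtain ⟨h1, h2⟩ := h b c hb hc
  obtain ⟨h1', h2'⟩ := h' b c hb hc
  constructor
  · intro A hA
    rw [map_add, h1 A hA, h1' A hA, Nat.testBit_xor, bz_xor]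
  · intro hD
    rw [Nat.testBit_xor, h2 hD, h2' hD]; rfl

lemma Rp.X0 {D t : ℕ} {f : P 3} (h : Rp D t f) : Rp (D + 1) t (X 0 * f) := by
  intro b c hb hc
  obtain ⟨h1, h2⟩ := h b c hb hc
  constructor
  · intro A hA
    rw [cf_X0]
    split_ifs with h0
    · rw [h2 (by omega)]; rfl
    · exact h1 _ (by omega)
  · intro hD; exact h2 (by omega)

lemma bit1 (t b c : ℕ) (hb : b < 4) (hc : c < 2) : ((t <<< 1) &&& 0xEE).testBit (b + 4 * c) =
    if b = 0 then false else t.testBit (b - 1 + 4 * c) := by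
  interval_cases b <;> interval_cases c <;> simp [Nat.testBit_shiftLeft, Nat.testBit_and] <;>
    simp [Nat.testBit]

lemma bit2 (t b c : ℕ) (hb : b < 4) (hc : c < 2) : ((t <<< 4) &&& 0xF0).testBit (b + 4 * c) =
    if c = 0 then false else t.testBit (b + 4 * (c - 1)) := by
  interval_cases b <;> interval_cases c <;> simp [Nat.testBit_shiftLeft, Nat.testBit_and] <;>
    simp [Nat.testBit]

lemma Rp.X1 {D t : ℕ} {f : P 3} (h : Rp D t f) : Rp (D + 1) ((t <<< 1) &&& 0xEE) (X 1 * f) := by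
  intro b c hb hc
  obtain ⟨h1, h2⟩ := h (b - 1) c (by omega) hc
  rw [bit1 t b c hb hc]
  constructor
  · intro A hA
    rw [cf_X1]
    split_ifs with h0
    · rfl
    · exact h1 _ (by omega)
  · intro hD
    split_ifs with h0
    · rfl
    · exact h2 (by omega)

lemma Rp.X2 {D t : ℕ} {f : P 3} (h : Rp D t f) : Rp (D + 1) ((t <<< 4) &&& 0xF0) (X 2 * f) := by
  intro b c hb hc
  obtain ⟨h1, h2⟩ := h b (c - 1) hb (by omega)
  rw [bit2 t b c hb hc]
  constructor
  · intro A hA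
    rw [cf_X2]
    split_ifs with h0
    · rfl
    · exact h1 _ (by omega)
  · intro hD
    split_ifs with h0
    · rfl
    · exact h2 (by omega)

def mulL (v w u : Bool) (t : ℕ) : ℕ :=
  (bif v then t else 0) ^^^ (bif w then (t <<< 1) &&& 0xEE else 0) ^^^
    (bif u then (t <<< 4) &&& 0xF0 else 0)

lemma Rp.lin {D t : ℕ} {f : P 3} (h : Rp D t f) (v w u : Bool) :
    Rp (D + 1) (mulL v w u t) (lin v w u * f) := by
  rw [HitP.lin, add_mul, add_mul]
  refine Rp.add (Rp.add ?_ ?_) ?_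
  · cases v
    · simpa using Rp_zero (D + 1)
    · exact h.X0
  · cases w
    · simpa using Rp_zero (D + 1)
    · exact h.X1
  · cases u
    · simpa using Rp_zero (D + 1)
    · exact h.X2

lemma Rp.lin4 {D t : ℕ} {f : P 3} (h : Rp D t f) (v w u : Bool) :
    Rp (D + 4) (bif v then t else 0) (HitP.lin v w u ^ 4 * f) := by
  have e : HitP.lin v w u ^ 4 * f = (bif v then X 0 * (X 0 * (X 0 * (X 0 * f))) else 0) +
      ((bif w then X 1 * (X 1 * (X 1 * (X 1 * f))) else 0) +
      (bif u then X 2 * (X 2 * (X 2 * (X 2 * f))) else 0)) := by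
    have : HitP.lin v w u ^ 4 = (HitP.lin v w u ^ 2) ^ 2 := by ring
    rw [this, HitP.lin, add_sq2, add_sq2, add_sq2, add_sq2]
    cases v <;> cases w <;> cases u <;> simp <;> ring
  have z : ∀ g : P 3, (∀ A b c, b < 4 → c < 2 → cf A b c g = 0) → Rp (D + 4) 0 g := by
    intro g hg b c hb hc
    exact ⟨fun A _ => by rw [hg A b c hb hc]; simp [bz], fun _ => by simp⟩
  have h1 : Rp (D + 4) 0 (bif w then X 1 * (X 1 * (X 1 * (X 1 * f))) else 0) := by
    apply z
    intro A b c hb hc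
    cases w
    · simp
    · interval_cases b <;> simp [cf_X1]
  have h2 : Rp (D + 4) 0 (bif u then X 2 * (X 2 * (X 2 * (X 2 * f))) else 0) := by
    apply z
    intro A b c hb hc
    cases u
    · simp
    · interval_cases c <;> simp [cf_X2]
  have h0 : Rp (D + 4) (bif v then t else 0) (bif v then X 0 * (X 0 * (X 0 * (X 0 * f))) else 0) := by
    cases v
    · simpa using Rp_zero (D + 4)
    · exact h.X0.X0.X0.X0
  have := h0.add (h1.add h2)
  rw [e]
  simpa using this

def mulP (v w u : Bool) : ℕ → ℕ → ℕ
  | 0, t => t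
  | k + 1, t => mulP v w u k (mulL v w u t)

lemma Rp.linP {v w u : Bool} (k : ℕ) : ∀ {D t : ℕ} {f : P 3}, Rp D t f →
    Rp (D + k) (mulP v w u k t) (HitP.lin v w u ^ k * f) := by
  induction k with
  | zero => intro D t f h; simpa [mulP] using h
  | succ k ih =>
    intro D t f h
    have := ih (h.lin v w u)
    rw [mulP, pow_succ, mul_assoc]
    convert this using 1
    ring

lemma Rp.linQ {v w u : Bool} (q : ℕ) {D t : ℕ} {f : P 3} (h : Rp D t f) :
    Rp (D + 4 * q) (bif v || q == 0 then t else 0) (HitP.lin v w u ^ (4 * q) * f) := by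
  induction q with
  | zero => simpa using h
  | succ q ih =>
    have := ih.lin4 v w u
    rw [← mul_assoc, ← pow_add] at this
    convert this using 1
    · ring
    · cases v <;> rfl
    · ring

def mulE (v w u : Bool) (e t : ℕ) : ℕ :=
  mulP v w u (e % 4) (bif v || e / 4 == 0 then t else 0)

lemma Rp.linE {v w u : Bool} (e : ℕ) {D t : ℕ} {f : P 3} (h : Rp D t f) :
    Rp (D + e) (mulE v w u e t) (HitP.lin v w u ^ e * f) := by
  have := (h.linQ (v := v) (w := w) (u := u) (e / 4)).linP (v := v) (w := w) (u := u) (e % 4)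
  rw [← mul_assoc, ← pow_add, add_assoc, Nat.div_add_mod, Nat.mod_add_div] at this
  exact this

def pr (v w u : ℕ) : List (ℕ × ℕ) → ℕ
  | [] => 1
  | (j, e) :: l => mulE (v.testBit j) (w.testBit j) (u.testBit j) e (pr v w u l)

lemma Rp_pr (v w u : ℕ) (l : List (ℕ × ℕ)) : Rp (l.map Prod.snd).sum (pr v w u l)
    ((l.map fun p => lin (v.testBit p.1) (w.testBit p.1) (u.testBit p.1) ^ p.2).prod) := by
  induction l with
  | nil => exact Rp_one
  | cons p l ih =>
    have := ih.linE (v := v.testBit p.1) (w := w.testBit p.1) (u := u.testBit p.1) p.2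
    simp only [List.map_cons, List.sum_cons, List.prod_cons, pr]
    rw [add_comm]
    exact this

lemma fun3_mm (v w u : ℕ) (f : Fin n → ℕ) (hf : ∑ i, f i = 67) :
    fun3 v w u (mm f) = bz ((pr v w u ((List.finRange n).map fun j => (j.val, f j))).testBit 7) := by
  have h := Rp_pr v w u ((List.finRange n).map fun j => (j.val, f j))
  have e1 : ((((List.finRange n).map fun j => (j.val, f j))).map Prod.snd).sum = 67 := by
    rw [List.map_map, ← hf, ← List.sum_ofFn, List.ofFn_eq_map]; rfl
  rw [e1, List.map_map] at h
  have := (h 3 1 (by norm_num) (by norm_num)).1 63 rfl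
  rw [← this, fun3, LinearMap.comp_apply, AlgHom.toLinearMap_apply]
  congr 1
  rw [mm, map_prod, ← List.prod_ofFn, List.ofFn_eq_map]
  congr 1
  apply List.map_congr_left
  intro j _
  rw [map_pow, fal, aeval_X]
  rfl

lemma comp_span {n d : ℕ} {N : Submodule (ZMod 2) (P n)}
    (hN : ∀ f : Fin n → ℕ, (∀ i, f i ≠ 0) → ∑ i, f i = d → mm f ∈ N) {f : P n}
    (hf : f ∈ PplusSub n) (hd : f.IsHomogeneous d) : f ∈ N := by
  have key : homogeneousComponent d f ∈ N := by
    clear hd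
    unfold PplusSub at hf
    induction hf using Submodule.span_induction with
    | mem x hx =>
      obtain ⟨a, ha, rfl⟩ := hx
      rw [mono_eq]
      by_cases h : ∑ i, a i = d
      · rw [homogeneousComponent_of_mem (mm_hom _), if_pos h.symm]
        exact hN _ (fun i => (ha i).ne') h
      · rw [homogeneousComponent_of_mem (mm_hom _), if_neg (fun e => h e.symm)]
        exact N.zero_mem
    | zero => simp
    | add x y _ _ hx hy => rw [map_add]; exact N.add_mem hx hy
    | smul c x _ hx => rw [map_smul]; exact N.smul_mem _ hx
  rwa [homogeneousComponent_of_mem hd, if_pos rfl] at key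

theorem dim_thm (n d K : ℕ) (m : Fin K → Fin n → ℕ) (hpos : ∀ k i, m k i ≠ 0)
    (hdeg : ∀ k, ∑ i, m k i = d)
    (hspan : ∀ f : Fin n → ℕ, (∀ i, f i ≠ 0) → ∑ i, f i = d →
      mm f ∈ Hd n d ⊔ Submodule.span (ZMod 2) (Set.range fun k => mm (m k)))
    (φ : Fin K → P n →ₗ[ZMod 2] ZMod 2) (hφ : ∀ k, ∀ f ∈ Hd n d, φ k f = 0)
    (tri : ∀ i j, i < j → φ i (mm (m j)) = 0) (diag : ∀ i, φ i (mm (m i)) = 1) :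
    Module.finrank (ZMod 2) (Qplus n d) = K := by
  have hmem : ∀ k, mm (m k) ∈ homSub n d := fun k => by
    have := mm_hom (m k)
    rw [hdeg k] at this
    exact (mem_homogeneousSubmodule _ _).2 this
  set q := ((hitSub n d).comap (homSub n d).subtype).mkQ with hq
  let v : Fin K → QP n d := fun k => q ⟨mm (m k), hmem k⟩
  have hv : Qplus n d = Submodule.span (ZMod 2) (Set.range v) := by
    apply le_antisymm
    · unfold Qplus
      rw [Submodule.map_le_iff_le_comap]
      rintro ⟨f, hf⟩ hfp
      let T : Submodule (ZMod 2) (P n) :=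
        ((Submodule.span (ZMod 2) (Set.range v)).comap q).map (homSub n d).subtype
      have hT : f ∈ T := by
        refine comp_span (d := d) ?_ (Submodule.mem_comap.1 hfp) ((mem_homogeneousSubmodule _ _).1 hf)
        intro g g0 gd
        refine (sup_le ?_ ?_ : _ ≤ T) (hspan g g0 gd)
        · intro x hx
          have hx1 : x ∈ homSub n d := (mem_homogeneousSubmodule _ _).2 (Hd_hom hx)
          refine ⟨⟨x, hx1⟩, ?_, rfl⟩
          have : q ⟨x, hx1⟩ = 0 := by
            rw [hq, Submodule.mkQ_apply, Submodule.Quotient.mk_eq_zero]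
            rw [Hd_eq] at hx
            exact hx
          simp only [SetLike.mem_coe, Submodule.mem_comap, this]
          exact Submodule.zero_mem _
        · rw [Submodule.span_le]
          rintro _ ⟨k, rfl⟩
          exact ⟨⟨_, hmem k⟩, Submodule.subset_span ⟨k, rfl⟩, rfl⟩
      obtain ⟨⟨y, hy⟩, h1, h2⟩ := hT
      simp only [Submodule.subtype_apply] at h2
      subst h2
      exact h1
    · rw [Submodule.span_le]
      rintro _ ⟨k, rfl⟩
      refine ⟨⟨_, hmem k⟩, ?_, rfl⟩
      refine Submodule.subset_span ⟨Finsupp.equivFunOnFinite.symm (m k), ?_, ?_⟩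
      · intro i; exact Nat.pos_of_ne_zero (hpos k i)
      · exact mm_eq _
  have hli : LinearIndependent (ZMod 2) v := by
    rw [Fintype.linearIndependent_iff]
    intro g hg
    have h0 : ∑ k, g k • mm (m k) ∈ Hd n d := by
      have h1 : q (∑ k, g k • ⟨mm (m k), hmem k⟩) = 0 := by
        rw [map_sum, ← hg]
        simp only [map_smul]
        rfl
      rw [hq, Submodule.mkQ_apply, Submodule.Quotient.mk_eq_zero, Submodule.mem_comap] at h1
      rw [Hd_eq]
      convert h1
      simp
    intro i
    induction i using WellFoundedLT.induction with
    | ind i ih =>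
      have := hφ i _ h0
      rw [map_sum, Finset.sum_eq_single i] at this
      · simpa [diag i] using this
      · intro j _ hj
        rcases lt_or_gt_of_ne hj with h | h
        · rw [ih j h]; simp
        · rw [map_smul, tri i j h, smul_zero]
      · simp
  rw [hv, finrank_span_eq_card hli, Fintype.card_fin]

def T4 : List (ℕ × ℕ × ℕ) := [
  (1, 6, 8), (1, 10, 4), (2, 5, 8), (2, 9, 4), (4, 9, 2), (4, 3, 8), (5, 2, 8), (5, 3, 8),
  (5, 10, 1), (7, 2, 8), (8, 3, 4), (8, 5, 2), (9, 2, 4), (9, 4, 2), (10, 1, 4), (10, 3, 4),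
  (10, 5, 2), (6, 8, 1), (5, 8, 2), (3, 8, 4), (3, 9, 4), (3, 12, 1), (6, 1, 8), (6, 10, 1),
  (7, 1, 8), (3, 4, 8), (6, 3, 8), (7, 8, 1), (7, 8, 2), (11, 2, 4), (11, 1, 4), (9, 3, 4),
  (11, 3, 4), (12, 1, 2), (12, 2, 1), (13, 2, 4), (13, 4, 2), (12, 5, 2), (12, 3, 4), (13, 5, 2),
  (9, 5, 2), (13, 1, 2), (13, 3, 4), (14, 1, 2), (14, 1, 4), (14, 3, 5), (14, 5, 3), (10, 4, 1),
  (11, 4, 2), (7, 9, 2), (7, 3, 8), (11, 5, 2), (13, 2, 1), (14, 2, 1), (14, 4, 1), (15, 1, 2),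
  (15, 2, 1), (15, 2, 4), (15, 5, 2), (15, 4, 2), (15, 6, 1), (11, 4, 1), (15, 1, 4), (15, 3, 4)]

def T3 : List (ℕ × ℕ × ℕ) := [
  (1, 2, 4), (1, 4, 2), (2, 1, 4), (2, 4, 1), (3, 1, 4), (3, 4, 1), (4, 1, 2), (4, 2, 1),
  (5, 1, 2), (6, 1, 2), (5, 2, 1), (6, 2, 1), (7, 2, 1), (7, 1, 2)]

def nt (T : List (ℕ × ℕ × ℕ)) (i : ℕ) : ℕ × ℕ × ℕ := T.getD i (0, 0, 0)

def tb {n : ℕ} (t : ℕ × ℕ × ℕ) (f : Fin n → ℕ) : Bool :=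
  (pr t.1 t.2.1 t.2.2 ((List.finRange n).map fun j => (j.val, f j))).testBit 7

theorem dim4 : Module.finrank (ZMod 2) (Qplus 4 67) = 64 := by
  have hl : L4.length = 64 := by decide +kernel
  have hdeg : ∀ k : Fin 64, ∑ i, exN (L4.getD k 0) i = 67 := by decide +kernel
  refine dim_thm 4 67 64 (fun k => exN (L4.getD k 0)) ?_ hdeg ?_
    (fun k => fun3 (nt T4 k).1 (nt T4 k).2.1 (nt T4 k).2.2) (fun k f hf => fun3_Hd _ _ _ _ hf) ?_ ?_
  · decide +kernel
  · intro f h0 h1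
    have hs := span4 f h0 h1
    revert hs
    apply SetLike.le_def.1
    apply sup_le_sup_left
    apply Submodule.span_mono
    rintro _ ⟨_, ⟨k, hk, rfl⟩, rfl⟩
    obtain ⟨i, hi, rfl⟩ := List.getElem_of_mem hk
    exact ⟨⟨i, hl ▸ hi⟩, by simp only [List.getD_eq_getElem _ _ hi]⟩
  · intro i j hij
    have key : ∀ i j : Fin 64, i < j → tb (nt T4 i) (exN (L4.getD j 0)) = false := by decide +kernel
    rw [fun3_mm _ _ _ _ (hdeg j)]
    have := key i j hij
    unfold tb at this
    rw [this]; rfl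
  · intro i
    have key : ∀ i : Fin 64, tb (nt T4 i) (exN (L4.getD i 0)) = true := by decide +kernel
    rw [fun3_mm _ _ _ _ (hdeg i)]
    have := key i
    unfold tb at this
    rw [this]; rfl

theorem dim3 : Module.finrank (ZMod 2) (Qplus 3 67) = 14 := by
  have hl : L3.length = 14 := by decide +kernel
  have hdeg : ∀ k : Fin 14, ∑ i, dn (exN (L3.getD k 0)) i = 67 := by decide +kernel
  refine dim_thm 3 67 14 (fun k => dn (exN (L3.getD k 0))) ?_ hdeg ?_
    (fun k => fun3 (nt T3 k).1 (nt T3 k).2.1 (nt T3 k).2.2) (fun k f hf => fun3_Hd _ _ _ _ hf) ?_ ?_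
  · decide +kernel
  · intro f h0 h1
    have hs := span3 f h0 h1
    revert hs
    apply SetLike.le_def.1
    apply sup_le_sup_left
    apply Submodule.span_mono
    rintro _ ⟨_, ⟨k, hk, rfl⟩, rfl⟩
    obtain ⟨i, hi, rfl⟩ := List.getElem_of_mem hk
    exact ⟨⟨i, hl ▸ hi⟩, by simp only [List.getD_eq_getElem _ _ hi]⟩
  · intro i j hij
    have key : ∀ i j : Fin 14, i < j → tb (nt T3 i) (dn (exN (L3.getD j 0))) = false := by
      decide +kernel
    rw [fun3_mm _ _ _ _ (hdeg j)]
    have := key i j hij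
    unfold tb at this
    rw [this]; rfl
  · intro i
    have key : ∀ i : Fin 14, tb (nt T3 i) (dn (exN (L3.getD i 0))) = true := by decide +kernel
    rw [fun3_mm _ _ _ _ (hdeg i)]
    have := key i
    unfold tb at this
    rw [this]; rfl


end HitP

/-- `(QP_3^+)_67` has dimension `14` and `(QP_4^+)_67` has dimension `64`
over `𝔽₂`. -/
theorem statement14 :
    Module.finrank (ZMod 2) (Qplus 3 67) = 14 ∧
    Module.finrank (ZMod 2) (Qplus 4 67) = 64 := by
  exact ⟨HitP.dim3, HitP.dim4⟩

end
end

section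
/- For every integer s ≥ 2, the 𝔽₂-vector spaces (QP_5)_{5(2^s−1)+13·2^s}^{GL(5,𝔽₂)} and (QP_5)_{67}^{GL(5,𝔽₂)} have the same dimension. -/
set_option synthInstance.maxHeartbeats 1000000
set_option maxHeartbeats 1000000

open MvPolynomial

noncomputable section

/-- The action of `g ∈ GL(5, 𝔽₂)` on `P_5`: the algebra automorphism with
`x_j ↦ ∑_i g_{ij} x_i`. -/
def glAct (g : Matrix.GeneralLinearGroup (Fin 5) (ZMod 2)) : P 5 →ₐ[ZMod 2] P 5 :=
  aeval fun j => ∑ i, C ((g : Matrix (Fin 5) (Fin 5) (ZMod 2)) i j) * X i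

/-- The set of `GL(5, 𝔽₂)`-invariant classes in `(QP_5)_d`: a class `x` is invariant iff
for every `g` and every representative `f` of `x`, `g·f - f` is hit (equivalently, the
class of `g·f` equals `x`). This set is a subspace; below we take its span to regard it
as a submodule. -/
def fixedSet (d : ℕ) : Set (QP 5 d) :=
  {x | ∀ g : Matrix.GeneralLinearGroup (Fin 5) (ZMod 2), ∀ f : homSub 5 d,
    Submodule.Quotient.mk f = x → glAct g (f : P 5) - (f : P 5) ∈ hitSub 5 d}

lemma zmod2_cases (r : ZMod 2) : r = 0 ∨ r = 1 := by
  revert r; decide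

lemma P_ind {n : ℕ} {M : P n → Prop} (h0 : M 0) (h1 : ∀ a, M (monomial a 1))
    (ha : ∀ p q, M p → M q → M (p + q)) (f : P n) : M f := by
  induction f using MvPolynomial.induction_on' with
  | monomial u a =>
    rcases zmod2_cases a with rfl | rfl
    · simpa using h0
    · exact h1 u
  | add p q hp hq => exact ha p q hp hq

lemma hit_gen {n m d : ℕ} (hm : m < d) {f : P n} (hf : f ∈ homSub n m) :
    homogeneousComponent d (SqT n f) ∈ hitSub n d := by
  classical
  apply Submodule.subset_span
  refine ⟨fun i => if i = d - m then f else 0, ?_, ?_⟩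
  · intro i
    dsimp only
    split_ifs with h
    · subst h
      have : d - (d - m) = m := by omega
      rw [this]; exact hf
    · exact Submodule.zero_mem _
  · rw [Finset.sum_eq_single (d - m)]
    · simp
    · intro b _ hb
      simp [hb]
    · intro h
      exfalso; apply h; simp; omega

lemma hit_le {n d : ℕ} (K : Submodule (ZMod 2) (P n))
    (h : ∀ m f, m < d → f ∈ homSub n m → homogeneousComponent d (SqT n f) ∈ K) :
    hitSub n d ≤ K := by
  apply Submodule.span_le.2
  rintro u ⟨f, hf, rfl⟩
  apply Submodule.sum_mem
  intro i hi
  rw [Finset.mem_Icc] at hi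
  exact h (d - i) _ (by omega) (hf i)

/-- all terms have degree `< n` -/
def lowD {n : ℕ} (m : ℕ) (f : P n) : Prop := ∀ x, m ≤ x.degree → f.coeff x = 0

lemma lowD_add {n m : ℕ} {f g : P n} (hf : lowD m f) (hg : lowD m g) : lowD m (f + g) := by
  intro x hx; simp [hf x hx, hg x hx]

lemma lowD_mul {n p q : ℕ} {f g : P n} (hf : lowD (p + 1) f) (hg : lowD q g) :
    lowD (p + q) (f * g) := by
  classical
  intro x hx
  rw [coeff_mul]
  apply Finset.sum_eq_zero
  rintro ⟨a, b⟩ hab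
  rw [Finset.HasAntidiagonal.mem_antidiagonal] at hab
  dsimp at hab ⊢
  have : a.degree + b.degree = x.degree := by rw [← hab, map_add]
  by_cases h : p + 1 ≤ a.degree
  · rw [hf a h, zero_mul]
  · rw [hg b (by omega), mul_zero]

lemma lowD_mono {n p q : ℕ} (h : p ≤ q) {f : P n} (hf : lowD p f) : lowD q f :=
  fun x hx => hf x (h.trans hx)

lemma lowD_hom {n p : ℕ} {f : P n} (hf : f.IsHomogeneous p) : lowD (p + 1) f :=
  fun x hx => hf.coeff_eq_zero (by omega)

def TopP {n : ℕ} (f : P n) (m : ℕ) (g : P n) : Prop := g.IsHomogeneous m ∧ lowD m (f - g)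

lemma TopP.mul {n p q : ℕ} {f g f' g' : P n} (h : TopP f p g) (h' : TopP f' q g') :
    TopP (f * f') (p + q) (g * g') := by
  refine ⟨h.1.mul h'.1, ?_⟩
  have e : f * f' - g * g' = f' * (f - g) + g * (f' - g') := by ring
  rw [e]
  apply lowD_add
  · rw [add_comm p q]
    apply lowD_mul _ h.2
    have : f' = g' + (f' - g') := by ring
    rw [this]
    exact lowD_add (lowD_hom h'.1) (lowD_mono (by omega) h'.2)
  · exact lowD_mul (lowD_hom h.1) h'.2

lemma TopP.comp {n p : ℕ} {f g : P n} (h : TopP f p g) : homogeneousComponent p f = g := by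
  ext x
  rw [coeff_homogeneousComponent]
  split_ifs with hx
  · have := h.2 x hx.ge
    rw [coeff_sub, sub_eq_zero] at this
    exact this
  · exact (h.1.coeff_eq_zero hx).symm

lemma topP_self {n p : ℕ} {f : P n} (h : f.IsHomogeneous p) : TopP f p f :=
  ⟨h, by intro x _; simp⟩

lemma topP_sq {n : ℕ} (a : Fin n →₀ ℕ) (r : ZMod 2) :
    ∃ e, (monomial a r : P n).IsHomogeneous e ∧
      TopP (SqT n (monomial a r)) (2 * e) ((monomial a r) ^ 2) := by
  refine MvPolynomial.induction_on_monomial (motive := fun p : P n => ∃ e, p.IsHomogeneous e ∧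
      TopP (SqT n p) (2 * e) (p ^ 2)) ?_ ?_ a r
  · intro r
    refine ⟨0, isHomogeneous_C _ _, ?_⟩
    have : (C r : P n) ^ 2 = C r := by
      rw [← map_pow]; congr 1; revert r; decide
    rw [this]
    have h2 : SqT n (C r) = C r := by simp [SqT]
    rw [h2]
    exact topP_self (isHomogeneous_C _ _)
  · intro p i ih
    obtain ⟨e, h1, h2⟩ := ih
    refine ⟨e + 1, h1.mul (isHomogeneous_X _ _), ?_⟩
    rw [map_mul, mul_pow, mul_add]
    apply h2.mul
    have : SqT n (X i) = X i + X i ^ 2 := by simp [SqT]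
    rw [this]
    refine ⟨by simpa using (isHomogeneous_X_pow (R := ZMod 2) i 2), ?_⟩
    simp only [add_sub_cancel_right]
    exact lowD_hom (isHomogeneous_X _ _)

lemma hom_pow_ideal {n m : ℕ} {f : P n} (hf : f ∈ homSub n m) :
    f ∈ idealOfVars (Fin n) (ZMod 2) ^ m := by
  rw [mem_pow_idealOfVars_iff']
  intro x hx
  exact IsHomogeneous.coeff_eq_zero hf (by omega)

lemma SqT_pow_ideal {n m : ℕ} {f : P n} (hf : f ∈ idealOfVars (Fin n) (ZMod 2) ^ m) :
    SqT n f ∈ idealOfVars (Fin n) (ZMod 2) ^ m := by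
  have h1 : idealOfVars (Fin n) (ZMod 2) ≤ (idealOfVars (Fin n) (ZMod 2)).comap (SqT n) := by
    apply Ideal.span_le.2
    rintro _ ⟨i, rfl⟩
    have : SqT n (X i) = X i + X i ^ 2 := by simp [SqT]
    have hX : (X i : P n) ∈ idealOfVars (Fin n) (ZMod 2) := Ideal.subset_span ⟨i, rfl⟩
    change SqT n (X i) ∈ idealOfVars (Fin n) (ZMod 2)
    rw [this, sq]
    exact Ideal.add_mem _ hX (Ideal.mul_mem_left _ _ hX)
  exact Ideal.le_comap_pow _ _ (Ideal.pow_right_mono h1 m hf)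

lemma comp_pow_ideal {n m d : ℕ} (hd : d < m) {f : P n}
    (hf : f ∈ idealOfVars (Fin n) (ZMod 2) ^ m) : homogeneousComponent d f = 0 := by
  rw [mem_pow_idealOfVars_iff'] at hf
  ext x
  rw [coeff_homogeneousComponent]
  split_ifs with hx
  · simpa using hf x (by omega)
  · simp

lemma wood {n k e N : ℕ} (S : Finset (Fin n)) (hk : S.card = k) (a : Fin n →₀ ℕ)
    (ha : a.degree = e) (hN : k + 2 * e < 2 ^ N)
    (hT : homogeneousComponent (k + e)
      (∏ i ∈ S, ∑ j ∈ Finset.range N, (X i : P n) ^ (2 ^ j)) = 0) :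
    (∏ i ∈ S, (X i : P n)) * (monomial a 1) ^ 2 ∈ hitSub n (k + 2 * e) := by
  classical
  set v : P n := monomial a 1 with hv
  have hvh : v.IsHomogeneous e := isHomogeneous_monomial _ ha
  have hv0 : v ≠ 0 := by simp [hv]
  have htop : TopP (SqT n v) (2 * e) (v ^ 2) := by
    obtain ⟨e', h1, h2⟩ := topP_sq a 1
    rw [← hv] at h1 h2
    obtain rfl := h1.inj_right hvh hv0
    exact h2
  set T : P n := ∏ i ∈ S, ∑ j ∈ Finset.range N, (X i : P n) ^ (2 ^ j) with hTd
  set u : P n := ∏ i ∈ S, (X i : P n) with hu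
  have huh : u.IsHomogeneous k := by
    have := IsHomogeneous.prod S (fun i => (X i : P n)) (fun _ => 1)
      (fun i _ => isHomogeneous_X _ _)
    simpa [hk] using this
  have hST : SqT n T = ∏ i ∈ S, (X i + X i ^ (2 ^ N) : P n) := by
    rw [hTd, map_prod]
    apply Finset.prod_congr rfl
    intro i _
    clear_value T
    clear hT hN hTd
    induction N with
    | zero => simp [CharTwo.add_self_eq_zero]
    | succ N ih =>
      rw [Finset.sum_range_succ, map_add, ih, map_pow]
      have : SqT n (X i) = X i + X i ^ 2 := by simp [SqT]
      rw [this, add_pow_char_pow, ← pow_mul, ← pow_succ']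
      have h2 := CharTwo.add_self_eq_zero ((X i : P n) ^ 2 ^ N)
      linear_combination h2
  have hid : SqT n T - u ∈ idealOfVars (Fin n) (ZMod 2) ^ (2 ^ N) := by
    rw [← Ideal.Quotient.mk_eq_mk_iff_sub_mem, hST, hu, map_prod, map_prod]
    apply Finset.prod_congr rfl
    intro i _
    rw [Ideal.Quotient.mk_eq_mk_iff_sub_mem, add_sub_cancel_left]
    have hX : (X i : P n) ∈ idealOfVars (Fin n) (ZMod 2) := Ideal.subset_span ⟨i, rfl⟩
    exact Ideal.pow_mem_pow hX _
  have e1 : homogeneousComponent (k + 2 * e) (SqT n (T * v)) = u * v ^ 2 := by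
    have : SqT n (T * v) = (SqT n T - u) * SqT n v + u * SqT n v := by
      rw [map_mul]; ring
    rw [this, map_add, comp_pow_ideal hN (Ideal.mul_mem_right _ _ hid), zero_add]
    exact ((topP_self huh).mul htop).comp
  rw [← e1, ← sum_homogeneousComponent T, Finset.sum_mul, map_sum, map_sum]
  apply Submodule.sum_mem
  intro m _
  have hm : homogeneousComponent m T * v ∈ homSub n (m + e) :=
    (homogeneousComponent_isHomogeneous m T).mul hvh
  rcases lt_trichotomy m (k + e) with h | h | h
  · exact hit_gen (by omega) hm
  · rw [h, hT]; simp
  · rw [comp_pow_ideal (by omega : k + 2 * e < m + e) (SqT_pow_ideal (hom_pow_ideal hm))]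
    exact Submodule.zero_mem _

lemma pow2_cases (a : ℕ) : 2 ^ a = 1 ∨ 2 ^ a = 2 ∨ 2 ^ a = 4 ∨ ∃ t, 2 ^ a = 8 * t := by
  rcases a with _ | _ | _ | a
  · simp
  · simp
  · simp
  · right; right; right
    exact ⟨2 ^ a, by ring⟩

lemma T_zero {n k N u w : ℕ} (S : Finset (Fin n)) (hk : S.card = k) (hu : 1 ≤ u)
    (hw : (k = 1 ∧ w = 72 * u - 2) ∨ (k = 3 ∧ w = 72 * u - 1)) :
    homogeneousComponent w
      (∏ i ∈ S, ∑ j ∈ Finset.range N, (X i : P n) ^ (2 ^ j)) = 0 := by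
  classical
  rw [Finset.prod_sum, map_sum]
  apply Finset.sum_eq_zero
  intro p _
  have hh := IsHomogeneous.prod S.attach
    (fun x => (X x.1 : P n) ^ 2 ^ p x.1 x.2) (fun x => 2 ^ p x.1 x.2)
    (fun x _ => isHomogeneous_X_pow _ _)
  rw [homogeneousComponent_of_mem hh, if_neg]
  have hc : S.attach.card = k := by simpa using hk
  rcases hw with ⟨rfl, rfl⟩ | ⟨rfl, rfl⟩
  · obtain ⟨x, hx⟩ := Finset.card_eq_one.1 hc
    rw [hx]
    simp only [Finset.sum_singleton]
    rcases pow2_cases (p x.1 x.2) with h | h | h | ⟨t, h⟩ <;> rw [h] <;> omega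
  · obtain ⟨x, y, z, hxy, hxz, hyz, hx⟩ := Finset.card_eq_three.1 hc
    rw [hx, Finset.sum_insert (by simp [hxy, hxz]), Finset.sum_insert (by simp [hyz]),
      Finset.sum_singleton]
    rcases pow2_cases (p x.1 x.2) with h | h | h | ⟨t, h⟩ <;>
    rcases pow2_cases (p y.1 y.2) with h' | h' | h' | ⟨t', h'⟩ <;>
    rcases pow2_cases (p z.1 z.2) with h'' | h'' | h'' | ⟨t'', h''⟩ <;>
    rw [h, h', h''] <;> omega

def dblE (b : Fin 5 →₀ ℕ) : Fin 5 →₀ ℕ := Finsupp.equivFunOnFinite.symm fun i => 2 * b i + 1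

lemma deg5 (b : Fin 5 →₀ ℕ) : b.degree = ∑ i, b i := Finsupp.degree_eq_sum b

lemma dblE_degree (b : Fin 5 →₀ ℕ) : (dblE b).degree = 2 * b.degree + 5 := by
  rw [deg5, deg5, Finset.mul_sum]
  simp [dblE, Finset.sum_add_distrib]

lemma S5_monomial (a : Fin 5 →₀ ℕ) : S5 (monomial a 1) =
    if ∀ i, Odd (a i) then monomial (Finsupp.equivFunOnFinite.symm fun i => a i / 2) 1 else 0 := by
  have := (basisMonomials (Fin 5) (ZMod 2)).constr_basis (ZMod 2) (fun a =>
    if ∀ i, Odd (a i) then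
      (mono (Finsupp.equivFunOnFinite.symm fun i => a i / 2) : P 5) else 0) a
  rw [coe_basisMonomials] at this
  exact this

lemma S5_coeff (f : P 5) (b : Fin 5 →₀ ℕ) : coeff b (S5 f) = coeff (dblE b) f := by
  classical
  induction f using P_ind with
  | h0 => simp
  | ha p q hp hq => simp [hp, hq]
  | h1 a =>
    rw [S5_monomial, coeff_monomial]
    by_cases h : a = dblE b
    · subst h
      rw [if_pos, if_pos rfl, coeff_monomial, if_pos]
      · ext i; simp [dblE]; omega
      · intro i; simp [dblE]
    · rw [if_neg h]
      split_ifs with h2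
      · rw [coeff_monomial, if_neg]
        rintro rfl
        apply h
        ext i
        obtain ⟨t, ht⟩ := h2 i
        simp [dblE]; omega
      · simp

lemma S5_comp (d : ℕ) (f : P 5) :
    S5 (homogeneousComponent (2 * d + 5) f) = homogeneousComponent d (S5 f) := by
  ext b
  rw [S5_coeff, coeff_homogeneousComponent, coeff_homogeneousComponent, S5_coeff, dblE_degree]
  simp

lemma S5_hom {d m : ℕ} {f : P 5} (hf : f ∈ homSub 5 m) (hm : m = 2 * d + 5) :
    S5 f ∈ homSub 5 d := by
  subst hm
  have := S5_comp d f
  rw [homogeneousComponent_eq_self hf] at this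
  rw [this]
  exact homogeneousComponent_isHomogeneous _ _

lemma S5_hom_zero {m : ℕ} {f : P 5} (hf : f ∈ homSub 5 m) (hm : ∀ d, m ≠ 2 * d + 5) :
    S5 f = 0 := by
  ext b
  rw [S5_coeff, coeff_zero]
  apply IsHomogeneous.coeff_eq_zero hf
  rw [dblE_degree]
  exact (hm _).symm

lemma S5_mul_sq (u v : P 5) : S5 (u * v ^ 2) = S5 u * v := by
  induction v using P_ind with
  | h0 => simp
  | ha p q hp hq => rw [CharTwo.add_sq, mul_add, map_add, hp, hq, mul_add]
  | h1 b =>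
    induction u using P_ind with
    | h0 => simp
    | ha p q hp hq => rw [add_mul, map_add, hp, hq, map_add, add_mul]
    | h1 a =>
      rw [monomial_pow, monomial_mul, one_pow, one_mul, S5_monomial, S5_monomial]
      have : (∀ i, Odd ((a + 2 • b) i)) ↔ ∀ i, Odd (a i) := by
        apply forall_congr'
        intro i
        simp [Nat.odd_add]
      simp only [this]
      split_ifs
      · rw [monomial_mul, one_mul]
        apply congrArg (fun z => (monomial z 1 : P 5))
        ext i
        simp
        omega
      · simp

lemma prodX_eq (S : Finset (Fin 5)) : (∏ i ∈ S, (X i : P 5)) =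
    monomial (Finsupp.equivFunOnFinite.symm fun i => if i ∈ S then 1 else 0) 1 := by
  classical
  rw [monomial_eq, Finsupp.prod_fintype _ _ (by simp)]
  simp [pow_ite, Finset.prod_ite_mem]

lemma S5_prodX (S : Finset (Fin 5)) : S5 (∏ i ∈ S, X i) = if S = Finset.univ then 1 else 0 := by
  rw [prodX_eq, S5_monomial]
  by_cases h : S = Finset.univ
  · subst h
    have : (Finsupp.equivFunOnFinite.symm fun _ : Fin 5 => (0 : ℕ)) = 0 := by ext i; simp
    simp [this]
  · rw [if_neg h, if_neg]
    intro h2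
    apply h
    ext i
    have := h2 i
    by_contra h3
    simp at h3
    simp [h3] at this

def oddS (a : Fin 5 →₀ ℕ) : Finset (Fin 5) := Finset.univ.filter fun i => Odd (a i)
def halfE (a : Fin 5 →₀ ℕ) : Fin 5 →₀ ℕ := Finsupp.equivFunOnFinite.symm fun i => a i / 2

lemma mono_decomp (a : Fin 5 →₀ ℕ) : (monomial a 1 : P 5) =
    (∏ i ∈ oddS a, X i) * (monomial (halfE a) 1) ^ 2 := by
  rw [prodX_eq, monomial_pow, monomial_mul]
  simp only [one_pow, mul_one]
  apply congrArg (fun z => (monomial z 1 : P 5))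
  ext i
  simp only [oddS, halfE, Finsupp.add_apply, Finsupp.smul_apply, Finsupp.equivFunOnFinite_symm_apply_apply,
    Finset.mem_filter, Finset.mem_univ, true_and]
  split_ifs with h
  · obtain ⟨t, h⟩ := h
    simp; omega
  · rw [Nat.not_odd_iff_even] at h
    obtain ⟨t, h⟩ := h
    simp; omega

lemma S5_commute (h : P 5 →ₐ[ZMod 2] P 5)
    (H : ∀ S : Finset (Fin 5), S5 (∏ i ∈ S, h (X i)) = if S = Finset.univ then 1 else 0)
    (f : P 5) : S5 (h f) = h (S5 f) := by
  induction f using P_ind with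
  | h0 => simp
  | ha p q hp hq => simp only [map_add, hp, hq]
  | h1 a =>
    rw [mono_decomp, S5_mul_sq, S5_prodX, map_mul, map_pow, S5_mul_sq, map_prod, H]
    split_ifs <;> simp

lemma S5_SqT (f : P 5) : S5 (SqT 5 f) = SqT 5 (S5 f) := by
  classical
  apply S5_commute
  intro S
  have : ∀ i, SqT 5 (X i) = X i + X i ^ 2 := by intro i; simp [SqT]
  simp only [this]
  rw [Finset.prod_add, map_sum]
  simp only [Finset.prod_pow, S5_mul_sq, S5_prodX]
  by_cases h : S = Finset.univ
  · subst h
    rw [Finset.sum_eq_single Finset.univ]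
    · simp
    · intro b _ hb; simp [hb]
    · simp
  · rw [if_neg h]
    apply Finset.sum_eq_zero
    intro T hT
    rw [if_neg, zero_mul]
    rintro rfl
    apply h
    rw [Finset.mem_powerset] at hT
    exact Finset.univ_subset_iff.1 hT

lemma S5_prod_fun (p : Fin 5 → Fin 5) (hp : ¬ Function.Bijective p) :
    S5 (∏ j, X (p j)) = 0 := by
  have h1 : (∏ j, X (p j) : P 5) = monomial (∑ j, Finsupp.single (p j) 1) 1 := by
    rw [monomial_sum_one]; rfl
  have h2 : ¬ Function.Surjective p := fun h => hp (Finite.surjective_iff_bijective.1 h)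
  rw [Function.Surjective] at h2
  push Not at h2
  obtain ⟨b, hb⟩ := h2
  rw [h1, S5_monomial, if_neg]
  intro h
  have := h b
  rw [Finsupp.finsetSum_apply] at this
  simp [hb] at this

lemma S5_gl (g : Matrix.GeneralLinearGroup (Fin 5) (ZMod 2)) (f : P 5) :
    S5 (glAct g f) = glAct g (S5 f) := by
  classical
  apply S5_commute
  intro S
  have hX : ∀ j, glAct g (X j) =
      ∑ i, C ((g : Matrix (Fin 5) (Fin 5) (ZMod 2)) i j) * X i := by
    intro j; simp [glAct]
  simp only [hX]
  by_cases h : S = Finset.univ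
  · subst h
    rw [if_pos rfl, Finset.prod_univ_sum, map_sum]
    have hterm : ∀ p : Fin 5 → Fin 5, S5 (∏ j, C ((g : Matrix (Fin 5) (Fin 5) (ZMod 2)) (p j) j) * X (p j))
        = (∏ j, (g : Matrix (Fin 5) (Fin 5) (ZMod 2)) (p j) j) • S5 (∏ j, X (p j)) := by
      intro p
      rw [Finset.prod_mul_distrib, ← map_prod, C_mul', map_smul]
    simp only [hterm, Fintype.piFinset_univ]
    have hdet : ∑ σ : Equiv.Perm (Fin 5),
        ∏ j, (g : Matrix (Fin 5) (Fin 5) (ZMod 2)) (σ j) j = 1 := by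
      have h1 : (g : Matrix (Fin 5) (Fin 5) (ZMod 2)).det = 1 := by
        rcases zmod2_cases (g : Matrix (Fin 5) (Fin 5) (ZMod 2)).det with h | h
        · exact absurd h (Matrix.GeneralLinearGroup.det_ne_zero g)
        · exact h
      rw [← h1, Matrix.det_apply]
      apply Finset.sum_congr rfl
      intro σ _
      rcases Int.units_eq_one_or (Equiv.Perm.sign σ) with h | h
      · rw [h, one_smul]
      · rw [h, Units.neg_smul, one_smul, CharTwo.neg_eq]
    have hS1 : ∀ σ : Equiv.Perm (Fin 5), S5 (∏ j, X (σ j)) = 1 := by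
      intro σ
      rw [Equiv.prod_comp σ (fun j => (X j : P 5)), S5_prodX, if_pos rfl]
    have : (1 : P 5) = ∑ σ : Equiv.Perm (Fin 5),
        (∏ j, (g : Matrix (Fin 5) (Fin 5) (ZMod 2)) (σ j) j) • S5 (∏ j, X (σ j)) := by
      simp only [hS1]
      rw [← Finset.sum_smul, hdet, one_smul]
    rw [this]
    symm
    apply Finset.sum_of_injOn (fun σ : Equiv.Perm (Fin 5) => (σ : Fin 5 → Fin 5))
    · intro a _ b _ hab
      exact DFunLike.coe_injective hab
    · intro a _; simp
    · intro p _ hp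
      rw [S5_prod_fun, smul_zero]
      intro hb
      apply hp
      exact ⟨Equiv.ofBijective p hb, by simp, rfl⟩
    · intro σ _; rfl
  · rw [if_neg h]
    have hc : S.card < 5 := by
      have := (Finset.card_lt_iff_ne_univ S).2 h
      simpa using this
    have hh := IsHomogeneous.prod S (fun j => ∑ i, C ((g : Matrix (Fin 5) (Fin 5) (ZMod 2)) i j) * (X i : P 5))
      (fun _ => 1) (fun j _ => IsHomogeneous.sum _ _ _ (fun i _ => isHomogeneous_C_mul_X _ _))
    apply S5_hom_zero (m := S.card)
    · simpa using hh
    · intro d; omega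

lemma gl_hom (g : Matrix.GeneralLinearGroup (Fin 5) (ZMod 2)) {d : ℕ} {f : P 5}
    (hf : f ∈ homSub 5 d) : glAct g f ∈ homSub 5 d := by
  have := IsHomogeneous.aeval (n := 1) hf
    (fun j => ∑ i, C ((g : Matrix (Fin 5) (Fin 5) (ZMod 2)) i j) * (X i : P 5))
    (fun j => IsHomogeneous.sum _ _ _ (fun i _ => isHomogeneous_C_mul_X _ _))
  rw [one_mul] at this
  exact this

lemma S5_Phi (f : P 5) : S5 (Phi f) = f := by
  rw [Phi, S5_mul_sq, S5_prodX, if_pos rfl, one_mul]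

lemma Phi_add (f g : P 5) : Phi (f + g) = Phi f + Phi g := by
  simp only [Phi, CharTwo.add_sq, mul_add]

lemma Phi_hom {d : ℕ} {f : P 5} (hf : f ∈ homSub 5 d) : Phi f ∈ homSub 5 (2 * d + 5) := by
  have h1 := IsHomogeneous.prod Finset.univ (fun i : Fin 5 => (X i : P 5)) (fun _ => 1)
      (fun i _ => isHomogeneous_X _ _)
  have h2 : (f ^ 2).IsHomogeneous (d * 2) := IsHomogeneous.pow hf 2
  have := h1.mul h2
  have e : (∑ _i : Fin 5, 1) + d * 2 = 2 * d + 5 := by simp; omega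
  rw [e] at this
  exact this

lemma S5_hit {d : ℕ} {f : P 5} (hf : f ∈ hitSub 5 (2 * d + 5)) : S5 f ∈ hitSub 5 d := by
  have : hitSub 5 (2 * d + 5) ≤ (hitSub 5 d).comap S5 := by
    apply hit_le
    intro m f hm hf
    rw [Submodule.mem_comap, S5_comp, S5_SqT]
    by_cases h : ∃ e, m = 2 * e + 5
    · obtain ⟨e, he⟩ := h
      exact hit_gen (by omega) (S5_hom hf he)
    · push Not at h
      rw [S5_hom_zero hf h]
      simp
  exact this hf

lemma mono_hit {u D : ℕ} (hu : 1 ≤ u) (hD : D = 144 * u - 5) (a : Fin 5 →₀ ℕ)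
    (ha : a.degree = D) (h : ¬ ∀ i, Odd (a i)) : (monomial a 1 : P 5) ∈ hitSub 5 D := by
  have hc : (oddS a).card < 5 := by
    have : oddS a ≠ Finset.univ := by
      intro h2
      apply h
      intro i
      have : i ∈ oddS a := by rw [h2]; simp
      simpa [oddS] using this
    have := (Finset.card_lt_iff_ne_univ (oddS a)).2 this
    simpa using this
  have hdeg : (oddS a).card + 2 * (halfE a).degree = D := by
    rw [← ha, deg5, deg5, oddS, Finset.card_filter, Finset.mul_sum, ← Finset.sum_add_distrib]
    apply Finset.sum_congr rfl
    intro i _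
    simp only [halfE, Finsupp.equivFunOnFinite_symm_apply_apply]
    split_ifs with h
    · obtain ⟨t, h⟩ := h; omega
    · rw [Nat.not_odd_iff_even] at h
      obtain ⟨t, h⟩ := h; omega
  rw [mono_decomp, ← hdeg]
  refine wood (N := (oddS a).card + 2 * (halfE a).degree) _ rfl _ rfl Nat.lt_two_pow_self ?_
  apply T_zero (u := u) _ rfl hu
  omega

lemma sub_Phi_hit {u d : ℕ} (hu : 1 ≤ u) (hd : d = 72 * u - 5) (f : P 5)
    (hf : f ∈ homSub 5 (2 * d + 5)) : f + Phi (S5 f) ∈ hitSub 5 (2 * d + 5) := by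
  have key : ∀ f : P 5, homogeneousComponent (2 * d + 5) f + Phi (S5 (homogeneousComponent (2 * d + 5) f))
      ∈ hitSub 5 (2 * d + 5) := by
    intro f
    induction f using P_ind with
    | h0 => simp [Phi]
    | ha p q hp hq =>
      rw [map_add, map_add, Phi_add, add_add_add_comm]
      exact Submodule.add_mem _ hp hq
    | h1 a =>
      rw [homogeneousComponent_of_mem (isHomogeneous_monomial 1 rfl)]
      split_ifs with h
      · by_cases ho : ∀ i, Odd (a i)
        · have : (monomial a 1 : P 5) = Phi (S5 (monomial a 1)) := by
            rw [S5_monomial, if_pos ho, Phi]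
            conv_lhs => rw [mono_decomp]
            have : oddS a = Finset.univ := by ext i; simp [oddS, ho i]
            rw [this]; rfl
          rw [← this, CharTwo.add_self_eq_zero]
          exact Submodule.zero_mem _
        · rw [S5_monomial, if_neg ho]
          have := mono_hit hu (by omega) a h.symm ho
          simpa [Phi] using this
      · simp [Phi]
  have := key f
  rwa [homogeneousComponent_eq_self hf] at this

lemma Phi_hit {u d : ℕ} (hu : 1 ≤ u) (hd : d = 72 * u - 5) {f : P 5}
    (hf : f ∈ hitSub 5 d) : Phi f ∈ hitSub 5 (2 * d + 5) := by
  let PhiH : P 5 →+ P 5 := ⟨⟨Phi, by simp [Phi]⟩, Phi_add⟩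
  let L : P 5 →ₗ[ZMod 2] P 5 := PhiH.toZModLinearMap 2
  have : hitSub 5 d ≤ (hitSub 5 (2 * d + 5)).comap L := by
    apply hit_le
    intro m f hm hf
    change Phi _ ∈ hitSub 5 (2 * d + 5)
    set y := homogeneousComponent (2 * d + 5) (SqT 5 (Phi f)) with hy
    have h1 : y ∈ hitSub 5 (2 * d + 5) := hit_gen (by omega) (Phi_hom hf)
    have h2 := sub_Phi_hit hu hd y (homogeneousComponent_isHomogeneous _ _)
    rw [hy, S5_comp, S5_SqT, S5_Phi] at h2
    exact (Submodule.add_mem_iff_right _ h1).1 h2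
  exact this hf

lemma hit_iff {u d : ℕ} (hu : 1 ≤ u) (hd : d = 72 * u - 5) {f : P 5}
    (hf : f ∈ homSub 5 (2 * d + 5)) : f ∈ hitSub 5 (2 * d + 5) ↔ S5 f ∈ hitSub 5 d := by
  refine ⟨S5_hit, fun h => ?_⟩
  exact (Submodule.add_mem_iff_left _ (Phi_hit hu hd h)).1 (sub_Phi_hit hu hd f hf)

def S5r (d : ℕ) : homSub 5 (2 * d + 5) →ₗ[ZMod 2] homSub 5 d :=
  S5.restrict (fun _ hf => S5_hom hf rfl)

def S5q (d : ℕ) : QP 5 (2 * d + 5) →ₗ[ZMod 2] QP 5 d :=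
  Submodule.mapQ _ _ (S5r d) (by
    intro f hf
    exact S5_hit hf)

lemma S5q_mk (d : ℕ) (f : homSub 5 (2 * d + 5)) :
    S5q d (Submodule.Quotient.mk f) = Submodule.Quotient.mk (S5r d f) := rfl

lemma S5q_bij {u d : ℕ} (hu : 1 ≤ u) (hd : d = 72 * u - 5) : Function.Bijective (S5q d) := by
  constructor
  · rw [injective_iff_map_eq_zero]
    intro x hx
    obtain ⟨f, rfl⟩ := Submodule.Quotient.mk_surjective _ x
    rw [S5q_mk, Submodule.Quotient.mk_eq_zero] at hx
    rw [Submodule.Quotient.mk_eq_zero]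
    exact (hit_iff hu hd f.2).2 hx
  · intro y
    obtain ⟨f, rfl⟩ := Submodule.Quotient.mk_surjective _ y
    refine ⟨Submodule.Quotient.mk ⟨Phi f, Phi_hom f.2⟩, ?_⟩
    rw [S5q_mk]
    congr 1
    exact Subtype.ext (S5_Phi f)

lemma mem_fixed (d : ℕ) (x : QP 5 d) : x ∈ fixedSet d ↔
    ∀ g : Matrix.GeneralLinearGroup (Fin 5) (ZMod 2), ∀ f : homSub 5 d,
    Submodule.Quotient.mk f = x → glAct g (f : P 5) - (f : P 5) ∈ hitSub 5 d := Iff.rfl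

lemma fixed_iff {u d : ℕ} (hu : 1 ≤ u) (hd : d = 72 * u - 5) (x : QP 5 (2 * d + 5)) :
    x ∈ fixedSet (2 * d + 5) ↔ S5q d x ∈ fixedSet d := by
  have key : ∀ (g : Matrix.GeneralLinearGroup (Fin 5) (ZMod 2)) (f : P 5),
      f ∈ homSub 5 (2 * d + 5) → (glAct g f - f ∈ hitSub 5 (2 * d + 5) ↔
        glAct g (S5 f) - S5 f ∈ hitSub 5 d) := by
    intro g f hf
    rw [hit_iff hu hd (Submodule.sub_mem _ (gl_hom g hf) hf), map_sub, S5_gl]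
  rw [mem_fixed, mem_fixed]
  constructor
  · intro hx g h hh
    obtain ⟨w, hw⟩ : ∃ w : homSub 5 (2 * d + 5), (w : P 5) = Phi h := ⟨⟨Phi h, Phi_hom h.2⟩, rfl⟩
    have hr : S5r d w = h := by
      apply Subtype.ext
      have : ((S5r d w : homSub 5 d) : P 5) = S5 (w : P 5) := rfl
      rw [this, hw, S5_Phi]
    have hP : Submodule.Quotient.mk w = x := by
      apply (S5q_bij hu hd).1
      rw [← hh, S5q_mk, hr]
    have h3 := hx g w hP
    rw [key g w w.2, hw, S5_Phi] at h3
    exact h3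
  · intro hx g f hf
    rw [key g f f.2]
    have h3 := hx g (S5r d f) (by rw [← hf, S5q_mk])
    exact h3

lemma finrank_step {u d : ℕ} (hu : 1 ≤ u) (hd : d = 72 * u - 5) :
    Module.finrank (ZMod 2) (Submodule.span (ZMod 2) (fixedSet (2 * d + 5))) =
    Module.finrank (ZMod 2) (Submodule.span (ZMod 2) (fixedSet d)) := by
  let e := LinearEquiv.ofBijective (S5q d) (S5q_bij hu hd)
  have himg : (S5q d) '' fixedSet (2 * d + 5) = fixedSet d := by
    ext y
    constructor
    · rintro ⟨x, hx, rfl⟩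
      exact (fixed_iff hu hd x).1 hx
    · intro hy
      obtain ⟨x, rfl⟩ := (S5q_bij hu hd).2 y
      exact ⟨x, (fixed_iff hu hd x).2 hy, rfl⟩
  rw [← himg, ← Submodule.map_span]
  exact (LinearEquiv.finrank_map_eq e _).symm

/-- for every `s ≥ 2`, `(QP_5)_{5(2^s-1)+13·2^s}^{GL(5,𝔽₂)}` and
`(QP_5)_67^{GL(5,𝔽₂)}` have the same dimension over `𝔽₂`. -/
theorem statement15 (s : ℕ) (hs : 2 ≤ s) :
    Module.finrank (ZMod 2)
      (Submodule.span (ZMod 2) (fixedSet (5 * (2 ^ s - 1) + 13 * 2 ^ s))) =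
    Module.finrank (ZMod 2) (Submodule.span (ZMod 2) (fixedSet 67)) := by
  induction s, hs using Nat.le_induction with
  | base => rfl
  | succ s hs ih =>
    rw [← ih]
    obtain ⟨t, rfl⟩ := Nat.exists_eq_add_of_le hs
    have hp : 2 ^ (2 + t) = 4 * 2 ^ t := by rw [pow_add]; norm_num
    have h1 : 1 ≤ 2 ^ t := Nat.one_le_two_pow
    have e : 5 * (2 ^ (2 + t + 1) - 1) + 13 * 2 ^ (2 + t + 1) =
        2 * (5 * (2 ^ (2 + t) - 1) + 13 * 2 ^ (2 + t)) + 5 := by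
      rw [pow_succ]; omega
    rw [e]
    exact finrank_step (u := 2 ^ t) h1 (by omega)

end
end
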